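/- There exist a subgroup 𝔊 of GL₇₈₂(𝔽₁₇) and an element 𝔷 ∈ 𝔊 such that 𝔊 is a simple group of cardinality 2^18·3^13·5^2·7·11·13·17·23 = 4089470473293004800, 𝔷 has order 2, and the centralizer of 𝔷 in 𝔊 has cardinality 2^18·3^9·5^2·7·11·13 = 129123503308800, equivalently index 31671 in 𝔊. -/

import Mathlib

namespace Fi23

noncomputable section


/-- Octad incidence vectors of the 23 points (512-bit stride). -/
def SIGt : Nat :=
  0x281cc18738c803e13603308731a023c190fc0199cc443302587207670c830980c33188788180b800c1cc183c41c04e006103e81807820e142182681c118439a0164630d18e2648b88b988c518c5990b8ac069844632308b10e096111c2c8c44c21188c4cc8c8ac0860464e1648cc2b041040ac0c22e1070210902c0c88c508b001080d36549d210415043aab5af449250c4dd0c0020205a94d1b1102804484ea19a7421224240bac9aab2d01050304ab48413e4ca4db42810808064644e4881005a028721d9001558855cd90010d07d00a1754e48400b1a06480ca3465a12104d45c75646282f60216210483246a04025da8013657902456844d274002341d001243160a255802b481a902e830ad2411a514aa82b84482a2030d32ac99222884289202e313024e02e812e34095aa4a02035416d150122a429a30b0a313b024a0040559245481ca0c0a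319146430ab4a909122d3924986a130d042c42a41514c8098a91502435020a8854d2a9229999061314c5228d0cad408aa08350648b2c100572ab92006314881f2a546d1801020c056002092695907a4020c280245e6fd210222c82001ef666120000582795625d5b2a04ee2828102182b77a9620105a000f2e82001a031a239080991d16cc1a2200885693a2e92224235c084c41004f2944805e196363809407d103248200a66707720a204044358f0704522a2ddc40c03a8d546d0063148820d5ab921801020c05600209296a6f858020c2802ba1902dd0222c820fe10999d2000058286a9da2a4d5fb1128281021bd48856920105a0030d102001a0365dc508086e2e9321a220088496c5d16c2241ca3884c410048d6848041e69c9c6094382e83248200a198f88d8a2040444a70c7044dd5d22240c0050d5412001ceb0820ca5412e6010273faa00206d9659045801f3d4024519022102dd342001109a62d000057d8656252a4aa0491d628103e42a88516206fa40000d283e0e20cea2268806602190c05dc3088a912529521da24a008b44e00b1293b81a619929c0064042104db0c0099a0c68205d88047cb88f905a229222447002292140ac0a498971129840a2660c1cc5a631c11155240862051451f28226052ac1243058061d169103c6064185514650426630e1056603262cb0289c1926460010872c9ab62a10415042554a50a492533b230c002021a56b2e4910280448315e658a212242414536554ad0105030354884141b35b24c281080819b9bb1a88103a20280de210012a484a3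21000f2f8500a28ab14840f4e605b40ca0b9a51210b14538aa4628d09c22921048cdb9a040da2280149a99024494452d8c0024be3002240e81522a80d4a86560208c092c410551455034838815c04f132549622d684686c051c1d02310d141d1b40e4558a3a02a419299011d445643140a01c4823601c1a19439446461304324121829488969611332118a04510928a542258691b488a450128544a25058a68b29512a610c18c18a2c24a8d22ac952304b0850912700b5424a4b102d050655108245439510b09a5845a89814808d1982431151aa4114d05308948a682a17085d1825096c09114193082334898d07244d105492892d0300381e007f07001f800e0e00fc1e001f000e07e007c1c01f80380f800ff060040fe1800fe0060f003f078007e00383801f07007c00381f801fe1003f00607c01860c018c0b80c60ce1c3018c0603c4060c301e833c830c3a04e07a0f38c087083c070478070c730c2c3e033c03071c8608c18603981f00c206398601e03c06001a50ea94911b4a64264432942064c86c30566225098c44ca984998931b432332229043449481408a18a562a090c65047143441425630916311244109941311028b1c218254496436163490529522662604b488461210d1843127013428c40a6074031a11313585b05129ce8b230d05098019240863a458318982a4acc2180a004a82544490d2051a2ae08c4a406b10ac65a84248602b409166424c91a1a5a113204c889b95902514c8a2982216900a92a16c0850cb499284c45210646d0951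

/-- Translation of block `O` by the base transposition `i`. -/
def TRt : Nat :=
  0x380005813000150641a01c040341c07c0000800000000000102c10020190340005800000150681f0401302c0e02004000070080000400070000001a04c0d0541f0700b01c040641600000008010380000000040000200e0000b054000341a000070001606400000040081c0041f0001304008000130540b07c1c0580001c000681903400010000000203801040000200003400000000001a01c1f0401c000130200001015008160040b0381902c0004c0e000160001a0000705400070000000407c02064010400d0201c054000000b04c0d01c1f0400000000020040001a0080e0040006416000070001c04c190540d07c1000016000080000406802000010380b0000b000150000d06400070000001f0381601c040081a004130001002000000130340b064000581a01c000001f0540400002070000400103800020070000d058000000b0001f0400007019020000100e008000041a0541300000038150641a0580007c1001c1c000080100004c02000010000b0341a02c1c038000640d0001f040160541302004008000040000000000070001a0000b070000581f01c0003413064000100205401040000380800000000130640b07c16054070000d0701a01002004000000e00000040080340001c00064130380007c1005800000080000402c02070010541a0001507c16070000380d068070001904c00010020000b0001000400000080000e0580b000190341a000000700004c070100207c010540004000020130000b0541f0581c064000000e0000001c04000000081a00410034080580b04c19054000000007c100000d01c0801000038020680100000070190001f07015034130000001c1a000160100200410000000000e02c080540002c0e07c130001a01c000581c0000400002064000000103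410020160001502c1a03400000070100e07c1c00800000000041900013040080001904c1a000070000007c100540e00008000040700202c01058000340004c000001f02c1c0540001c000581a0100200419000100000d03808064000000e034000001307c1002c1a01c08000040580205401070000001c0641f04c0b0380006807010160540d0000000800000100040000008058000680b064000000e01c040001c04c0000801034000540007c100200b068000540704c000701f0400003819020040080000416000000340000019034000680b07c16000070381c04c0000004054020400102000000190341c0541f02c160380001c130001a000040001000800004000000802c1c034000640e04c1f01c00000150680001002058010400000000020000580007c1a0380004c000001c02c1901c00010000080d00415040080000d000070541602c0007c100640000008010020000104c000701a0380e0000001c00034130001f040150001902004000160081c0040b0001a07c000580004c000380b01c000341a06400000040000205401070100200b054000001c03813068070000d06416010000081f0001000400020000001c000190580d02c1a01c0007c000540400800038000000104c10020160000e07000000130541f0401a0000d02004008000040b000070640004c1c0000e0001f0640d01c0406800054000080102c000580000010020000681904c0e000070341f040160000002004000150080b0041c0000002c15038000580001c1a07c100641300008000040340200001000000700001c1c000000581a0541f040000380b020040000d00800004190001301c000640002c1c0541307c100000d000080100200001000000580e068190001f0001302c0e000070000007016010020000d0001a00415040080381a02c190001c0341507c1000000058080000401c0204c0100000000000700b0001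9000000681f040150580702004008000040e0000d000130680003400000000001907c1002c130000801000070020580105407038160000d068130641c07c0001c0002c0e0100000800000150041002000038190000d0700006815000070001f058000000404c02040010000b02007000150381302c000701f04000000160200400019008000040d06800058000001a07c1905413000070340e02c0001002000010700004000020190381a07c130001602c0001c1c0341501002004100000800000000000000b0001c0000e0640d0000707c1600000010000680204c0105410020000001c0001a02c000581f0400003415020000101300807004000640e0580b0000d04c190381f000000681500007010020700100000000100201f0001904c1c000150000001c160341a00004000100080e0040b0200004c150000d02c19058000000707c0e070040080000000068010001002000038000001a064000001f0401c01c0d020040000b008150041604c000581c0000702c1a0000007c1003400038080000406402000010001305416064150001c034070000007c000680b04008010130080000400038000001907c1c0581502c000000700000034040000004c020680103810020160701a04c0000000054070001907c0d010000080b004100000003808064000380b000130000d07c00000070701002004000020580106800054070381307000000160000007c0b0000004008010150080d004000641a0001607c19070130000e01c000000b00004008000680105400034100200001c0b0540d038000001f0400006413020040080000000004160681c0001f0381c05800034150000704c0006800010020000002c01064100200000000054130380b0680007c1600007040080101c008190040003400070000000004c160381a0000707c1902c0400000054020000103410020150680e01c000640002c1f0400003400000080101c008000040005813000150341f064000001a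01c040580b04c00000000380200001070100200b00000000130700001c1f040150000d0200400800000190041a0580e02c0e06800064000001507c100340004c00020040580201c010001c0001a0000b054160701f04c070100003800000000000d0081900410000080340b00000000160001c0001f0381306410020040680201c0100000054000381907c000541a058070100004c1c00000008000040d0000b0400806800000130580b0340007c000541c01c100200400002000010640e0001c034150641f0001a000070001602c13000040081000000004000380800016000130001902c1a07c100340e0540801002000000700101c00000000000d02c000001901c1f0401a03816000080101300815004000001c06400000150701f0581a01c0402c0e00002004000340004c00040080001f068130700b0000d054070101606400000020000000410000000380807c0004c16054000640b01c000700d0680400800040010000003800020000580b038000001c01c1f00019034000400801000008000041504c1a068000581c0640001c0007c100380d00008010020000004c0102c000540d01c0006816070130001f0400b0540000008010190080e00400000000341f06816070190000b0000000000038070100204c000540100010020000340e070000001a000070101504c0b0080100016000190001f0400800015070000640d02c1307c000000003810020040000206801058070000b04c1a0581507c0e000070100003400008000041c0001900000040080380d07c1502c1c0581a01c00000130640400000000020000100010020000581a038130641f02c0001c150700d010020000000400000100200004c0001c0b0001a0540e0001f0700d0001002004058020000106400000000701f02c1a06416000000001504c0001c040080d0000e0041002000000190001c0381a0001307c1000000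054000200401c02058010340002c1c0680e0000b064150340001c130001f0100000800004160000004008054000580002c0004c190001f00000070100200401c0206801038000340e034190001c054000001f0000b0580004008010000080700400068130000e0640d02c1f0001501c0404c0005802000010680007000040080001c02c0d0001a07c0006407010160540e00801000130000000000040080000e07000000150001601c000680d064000100207c0004c010400b02019000130000b054000001f040160701a000080100d00800004070000e0001a0001601c00070000001f0541904c100200402c0200001034000380e00000054000001c034000001a07c0b01c04008160001300419040080541607c1a0000b034190000004c1c0380001c040000204001000080001a000000640e04c000000007c0005800040080100d008150040b07007064000581a07c0e0700b01c0004c0005400010020400003401020000000d03800058130001a0641f000070001504008010000080b004000001c07c13038000001c0640001c040540d058000000002c02068010001002000070160640001c0b0001f040130000d000080101a008000041503800000160700001c000540007c10000130000002004038020640102c1a0341f000000641504c1606807000000000b010000080e0041c000100340800015064000341c000160001f068000001002004038020000101c1302c1c00000000000340e0581f04000064070000801015008130041a02c000341c04c00000000540e07c100001a02c080100200000058010001901c1f0541604c0d02c000680001c1907000010000000e008100040002000000130380d00000000070001f0000b0681002004064020700105815000000541c0001904c1f02c070101a0580000800000000000e004100340803400070000001f02c1301c040580e0540200001064000680004000020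1c03416054130381f00007000190001a01002000100040b00000020000001c064000581504c0001c0007c1a038040000203401000000400b020160000004c0d0001a0701f0401900000000080100b008000040e054070700d0381a01c0b0641307c10058000000801002000000000100015000000001a0000001c0d0000007c190540e0400801000008160041c02c13038150700005819068000000704c1f00004008000340102c00040000200b0681c0001f0641303800000160540d01c040080000000004100000800019034070541c0000e07c000580b04c1002004068020000100000000160001a03800054000001f0401c04c1902004008070000d0040002c0001c0d00015000000000007c100381a07000020040000202c01064130580b0381a0000d0700006407000150001f0100000016008130041000008064160001a0000b038150001f000000341002004000020000104c07070000680003415000000581f0401307000020040080b0000e0040001c190000001c0e070160000d07c100540b0000002004000020680104c190001c06816064000380004c070101507c0d000020000b0041000008000000700002c000541903813000070581f00000010020680003401000100200e01c000001a0001904c0007c0d0700004008010000080b0041505800068160001c000150000e01c040001307c020000006400034010400b020150001f068130381902c07010160341c00000008100040000000020000381500013058000341901c040680b0700200001000000000007c100200d02c000580e00013000070001f0540001000000190081a0041c040080380b05400000130701a07c1001c000000002004000020340105800064000001f0000e04c0b07007010190001600002000150041a00010034080001a0001c000070380007c000001302c100200406402054010000d0580b068000541c000000580001c1f00013010020000e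0040d000190400801c0000019070130680b07c100001503808010020580000001000000341a0540b03413000160381f0400001c190000801000008000041c000000580001c0d0680004c0b07c000000e000100200405402064010001c0001a02c000701f04c19054070000003800000040080000016004100340802c0d0701305419000000001f01c000581002004000020380106800000190680007c0d0540e0000701000070130000200016004000001002c080540004c000000e01c1c07c0006800034100200405802000010000b0641602c1f04c190381a000070101c0341500800000100000000408000000000b01c000380d0580007c1006400070080100206800054010000004c000001902c000700d07c07000160381a01000000130081500410020000541c07c1602c0e0341301c00068190000400002000010400002000000000700d038190541a02c0007c0001c000400801000008130040000016000000681501c000000007c0004c00058100200403402070010381902c0d0001f04c000641c0540001c0006816010020000b0040e000000400807c0b00000068130001501c040641600000000020700103800034100200e04c1c05800000000341f0401a00007020040081900000004150000b07c1a000000381604c0000000070000540001c0402c020640103410020130380d0000b01c000701f040000580002004008150001a00419000000641604c15000000341a000070701f0380400000000020400102c00020000000b0700d000130380001c1606800010000081f0041500019040080701300000038000001507c000001a064100200402c020000101c160341a07c00058000640e0000001c0d0541c01000008130040b000100200002c07000190001a0001607c00038000001002004070020340104c150001a04c0d058000640b0000001c0007015000040081f0000e0041000008000000701f02c1505819000000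001a04c0001c0403402000010381002013000190581a0380d0001f040000000b00008010000081c0040001c150641500007068000700007c100000005808010020380002c0104c0d000130541a0700d00000064000001607c00000070100e008100040b00008000000000002c160641a07c000701500010020040380204c010340001c1904c00000000541c034070001f0381a0100200000004160000b040080580d068190540007c0001c0404c0007000000020400102c00038000201506400000000580d0001f0400b01c000200400813000000040e0701a0540006816064000700d01c0407c0004c02000000400002c010000e0201903800058130701a054070100b0000d00000000000081f004100200001c0b05800000000540007c0003419068100200404c0203801070000001f0700d04c0e0640002c0001c000581a010000081500400000100000800013000000540b01c1907c1007016038000200400002000010000d0680000019000160000e0541f0400702c1a020040081c000000040d04c000700002c07058000000d0001f04c0e054100200400002000010001a0641f0540004c0b064000380001c0d06816000040081c00000004100200004c1c0541a034190580007c0000000000100200401c020000102c00038000001502c00068130641f0400000000020040080d000070041c038160680e02c160641f04c1c01c04000000340200400000000540004000020150380002c00000070581f040000680002004008190041c000130000d0001302c0d0540e0701a01c040001f064000080005800040010000800000000000700d0000b0381f040000541a020040000000807004130581907c1c064000340b0581a01c0400000038000000204c00000010541002013064000001c02c1601c1f0400d0001a020040080e0040000015000000001a0000d0580e0701901c0402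c1504c020000007c0104000000000201300000054000341c0641f0401a02c0002000010000080e00400058070700e07c000640d0000b000070001306800010000000205401058100201907c1c058000000b068070101504c00000000080d000100040e02000054190001a0001c0340e01c0002c13058000000407c020000104000020150700700016000190001f0400e000130200400000008000041a0340b0641c054000380004c1601c0002c000000400801068000340007c100200004c1902c07000160001f0400e0540d02000010000081a0040007000000000001f0380d0540001c040641c02c0000002058000680104c10020000000d04c160541c0001f040000640e020040081a004070000b000000700e0580007c00000000000702c1504c04000020340006801064100200d0641a02c000381c0001f04000058000200400000008130040705400054160381c0001f0340b01c000001a064040080104c0000000040080000e054160680d000000001f0401c02c000200400813004000001901c00054000000e0641c0001301c0007c1a02c00010000580203401000100201f04c1c000000341a05400000000380001c00010190080b00416040080581904c1f034000001a01c000701502c04008000000004001038080001904c0700000068000001f040000000b02004008150040d0000e0581c0001a038000580004c15000000341c07c070100006402040010000b02015034130681c00016038000001f0001901c0001010008000040b0200004c0b0001f054190681c000070340000004000020380005801040000201607c0b0640d07000000070000005413000000101a0080e00410020000701504c00000000681f000070380b03400010020580100000064100200b058000341c01c0004c1f0401a064000200400000008000040e0001500000000190000e0000d07c1001c1305408010020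2c01000000681c05813054000680d07c00000070000e0641c01002004160000b000100000804c0e0341f07019058150000700000000000100202c0106800040080000d000000000e0001a0001f0401301c16020040081c004190000002c15034190580004c1f0680001c040701503800008010000002c0004008000000681507c160700b034070000e00000000000101900813004000400802c15058000681c04c0e01c000641f00000010000340200001040080000004c160701a064000000001c0b0340e00004008150041f000000400807016000000540e04c0007c1000007068080000400002034010640002c160681f034000001905407000000000e00004000130080b0041c040080581a0341300015000000000002c19070070100007c02000010400e0200001c130341a0000e0641f040000001c020040081600400000000540b0341c02c000540007c1901c04000130580200000068010400003808000190541c06800038000580001c1f04c000100200400000100000b034080000004c0e0341900015000070700b06804008000580007c0104000020000581500000034190381f0400b0700002004008070041a0000004c0004c000580001c1c0380b07c100641a05408010000000203401000000000d05400000160001f068070100b0641c0000200013000100040e000080581c0380d0001507c0001c0004c000640400002000000680102c1002000000160340e054190701f040070000b020000100000800004130001a04c1f0580e0000b0681901c040340000002000000700100000054100200003413070000641f0680001c0e05815010000080b00000004000400804c000581c07c0b05400000000680d06407000040400203801000000200e02c15000000640d0580001c1a0001f01002000130001c00410020000540b06813070000000e07c100000000008000040000206401034070581c0001a0581301c0002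c1f0400e00000020040080d0041500000000190540d0680e0580002c00000000001307007010020000107c00064100200004c0b06800054000581f0400d0001c02004000000081900400038070680e05400000160000b07c1004c190700800004000020000101c0d000150581f02c0e000130680001c0003400010020001c0000000419040080341a0000e04c0b05416000000001f06407010000700204001020000000b070150581904c00000070100e00000000020001f0001a0040d0400803419038160680b0001f01c0004c0007000010020000100000054100200d0641602c1f0541c0000001c130680000000010000080000410038080640d07c1a054070580b000000700e04c000000004000020000100200400d658d39f357f3e0b383f08156eae93040080127a00a000050020040c8c00abbc4d3dfce69970fc209d4f2ba410020048000256401400801018dd64005aab87f26db383f080dbeaf1e04008013f700a00005002004039f595a800f49fcc1ece0fc206c7ab9d01002004a7402800014008010335d66b8f48007f0d5b383f08263eada6040080114f00a000050020040de9a5c2f9dacc00999ce0fc20f4157ba4100200480002400013f080103e0d666dc1cd57f000b383f082b6ead73040080119a00a000050020040ad197ce653d3dfce68000fc20f8965ba41002004800023380140080103256e7e8d76af38eda5b80007f93752760400801200009000048010020ce9b9fdf5dabcfcb696e07c00e31cb9a4100200480002400012004008156d64db6c6637f2b6b383f08000eafc5040080132c00a000050020040f44f297336d3dfce69650fc20a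1c00ba41002004800026ac014008010293d671e9d1a67f173b383f083c5eac0004008010e900a000050020040ce9a9fdf4dabcfcb296e07c10e71db9e400020048000240001200400833a6a7ffd36a73f2ca5981f0439474e710200001200009000048010020cf9adfef4da9cfcb396607c10e51d79d408010008000240001200400827ad67f7a754f7f19ab383f0832ceace9040080100000a000050020040cf1adfef4fa9cfeb316607c10e59d59d408010028000040001200400827a567f7a774f7f39a3383f0832c6aee90400801200008000050020040cf5acfef4ea9cfeb356707c10e59d59d008010028000140000200400837a567f7e764f3f29a7383f0832c6aee90400801200009000040020040de9d9fdf1db3cfca694e0fc20eb1ab9a410020048000240001200001033a667f7d768f3f2da5383f083ac7ae690400801200009000048010000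

/-- Coordinate points of the blocks. -/
def IBt : Nat :=
  0x40d40c000000d4a0a3000000080d41c0000001020e5000000080828c000000d49ca3000000080728c000000d4a0a3000000352728c00000020a0e5000000100938c000000d49ca3000000352828c000000d4a0e50000001028394000000102507000000352728c00000040250300000008083940000002020a3000000352828c000000602507000000040938c000000103525000000352728c000000402507000000352728c0000004034e3000000040d41c000000d4a0e5000000104728c0000006020a30000001008394000000101ca30000003528394000000d4a0a3000000040728c00000040a4e3000000040940c000000d4a0e5000000040d41c000000d4a0a3000000352728c000000d4a0a30000003528394000000102503000000352728c000000d4a0e5000000352828c00000020a4e3000000100728c000000d4a0a30000000808394000000622507000000040828c000000d49ca3000000040839400000060a0a3000000040940c000000d4a0a3000000352728c000000941ca3000000040928c0000004024e5000000250728c000000941ca30000000409414000000d4a0e3000000040838c000000941ca3000000040928c000000d41ca3000000040d28c000000d4a0e3000000350728c0000002034a3000000250728c0000001034e5000000250728c0000006020e3000000352838c000000d41ca3000000082d4a00000004035050000001809414000000941ca3000000352838c000000d41ca3000000040838c000000103528000000250728c000000103527000000040928c00000020a505000000250728c00000020a0e3000000350728c0000001024e5000000250728c000000941ca3000000082d4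9c000000103528000000080838c000000d41ca3000000250728c0000001020e3000000102728c000000941ca3000000184838c000000941ca3000000040d28c000000d41ca3000000350728c0000002024e5000000250728c000000d41ca3000000352838c00000040a4a3000000250728c000000203523000000080d49c00000060a5050000000809394000000d41ca3000000352838c000000941ca300000008094140000002020e3000000250728c000000d4a0e3000000350728c0000002024a3000000250728c000000d4a0e3000000350728c000000413505000000040838c000000941ca3000000080d48c00000060b4e5000000040d49c0000001024a3000000350728c000000203505000000250728c000000102505000000352838c000000d41ca3000000250728c0000002020e3000000250728c000000203505000000250728c000000613523000000352838c00000020a4a30000001049394000000941ca3000000250728c000000102505000000040d394000000d4a0e3000000040728c000000d4a0e3000000100928c0000001024e5000000250728c00000020a4e5000000250728c0000002020e3000000040728c000000d41ca3000000352838c000000401ca3000000250728c000000102505000000180d394000000d4a0e3000000180d48c00000020b4a3000000250728c0000002024e5000000350728c000000d4a0e3000000250728c00000020a0e3000000250728c000000d4a0e3000000080d4a0000000d4a0e5000000102d40c000000d4a0a3000000040d38c000000d4a0e5000000100d494000000d49ca3000000040828c00000040b4e3000000080728c000000d4a0a3000000040941c000000d49ca3000000040d38c000000d4a0e5000000040938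c000000d4a0a3000000082941c000000d4a0e5000000040828c000000101ca3000000102940c000000d4a0e5000000100828c000000609ca3000000080938c000000209ca30000000408394000000d4a0a300000035283940000002025070000000828394000000d4a0e5000000082d41c000000101ca3000000082828c0000001020e5000000352728c0000001020a3000000080828c000000d4a0e5000000102d494000000402507000000080940c000000d4a0e5000000352828c000000403503000000040938c000000d49ca3000000040d4940000001024e3000000180728c00000020a503000000352728c000000d4a0e50000000408394000000d4a0a3000000352728c000000102503000000104828c0000001035030000000408394000000201ca3000000188208082081a941ca3308206a50728c82081a941ca3208206a50728c82081a941ca3310206a50728c82081a941ca3308206a50728cc41040941ca3310410250728c82081a941ca3308206a50728c82081a941ca3310410350728cc41040d49ca3310410352828c82081a941ca3310410352838cc2081a941ca33104103528394c4081a941ca3310406a50728cc4105a941ca3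

/-- Base neighbours of the blocks. -/
def BSt : Nat :=
  0x10000010000010000010000010000010000010000010000010000010000010000010000010000010000010000010000010000010000010000010000010000010000014805e05802560031d24a6088145857824012a580181c84a02a22a5802611891269110c1092812017a91104e0206c511a0210929a23405206cc007210c8320e1092982181c88b0a056140a19808181036646245044413642181804a9610641d458502846243488825446806084968145826084928145908320c5028b4c10925028b0a2c28020c83cb004a5e0900814584929822118916084940900bea234069110420c8388b0a048607259808123122823405606cc007210c4a60841b301209a444190708494c1c12015c20c8051614860720e4218058502a017823a800d104d218502882a234a800c7980819802548206cc4441351891411423110860702f0491a02a241c2080952c0063a901036522209c0e421a2340421253152c0109a4448212522402f269110298212a58024d9808023122b1d40040544648a118641c2448a11952c00c0e4224a6083c12011c20c80516163a800c805e058025402a2364508c320e100018ebb301004624508607282402e960094bc12009298228b0a14c10930832085028b508c48691104a88d020031d2402f04a960060721680a88a960084d22218081b02125344680a40d9800e4219092985850280206ce44413642181004a9701511b1d40024508c320e101c20c8c75000914230c8385891420d980814c1092a580213488b03908209a442530420d980bc12011c20c80516147210c1104d2100bc11d400605446ac012a6a00314680a84508c405e09641c200031d458502a00952f210c010366060206e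800c734054412a580181c84a11890a88d01458510a05178419060900b1782401253042181c83841962450831d400190708d980894c10809a4448269101b3011c843044134ba800c11a02a00bc12ea003044134c02f04104d23070830c48a1063a800bc121086070508c4854468c28145301035400639a02a20952c1802548206cc44413441c20c31228418ea0210c0e05e091142310680a88254b020e106063a800952c00c75000c751000001000001000001000001000001000001000001000001000001000001000001000001000001000001000001000001000001000001000001000001000001000001

/-- Octad masks of the blocks. -/
def MKt : Nat :=
  0xa000004001000000001002000002400048000004002000000008002000002210004000001100000000002800000400600200000400000000000240000040000810000080020000000004100000024000a0000001010000000040004000010084002000008080000000001400000040840800000200000000000808000040000400080000010008008002000004001004000200000080200400080000001008100004000008000408000200000800020200040000000000840004000040000000000924000000002042400000000000000000000000050840000000041110001025000000000000000010882000000000000000840800000000000000001300000004204010000008080000000100080800800000000081000000802010200010020000000002200000400208080000000004042000000000408000000004000000000000221400000000008400000240000000012000048000000000084210000000000840001100000000000420500000000000201020000000008800004000000000108000410000000042000002400144200000000000120440000000000004510000000000008810200000000000000000040000140000000044000040180000000042000000000044000030000000000820000a0012000000000808000000088000000010404080000280000000108000080000000000180000000080004002000002040000100100000804000100000020800010008000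00410000040000240000020400000082000000810010000020000000009000002008000000000000002000820200000000028040011000201200000000011010020000000008010210000000000110100010000000000000008002008000000000010820000002004000200000800400080004000404001000020000802000008000200200200004000040040002002000040000200040000400010000000100200010000000900000000004400404000000000104004100000000010800a00000000000108200200000001001100800000000008048010000000040002001000000001000000000000000000000000000000000000000000000000000000000000000000010002082001402020800808100220080880800c008080000880081400220800000002004000001080000040200000108082000000402000004200000040080001000800000840000100400000041000000000108000000004000010400000800020200000000100200404000000100100000020200210000000040100020200000000400420200000000004018040000042000000000000210100000000002000000000000000000000000000000000000000000000000000000000000000000100202002201004204100040240100220220010180100001080802022010040000014000004004000400002040000001010000080800000080021000000400800020000204000000800090000000401000011000000800000020001010000000040801400000000008003010000000000000000002003001000000000041010810008800200000000240001100000000000000000880000800000000200408000500280000000000000000000600c0000a001400000000000000000000500600000c0000600000000000000000050005002000060000000000000000004800100120000001100000000010040000200100000080800010004104000000140000000010002000020201800000010040000100000005000000000010020000800010000040800000100000208000200100000080400002008010000020080000008010000080800000402020000002008000002000008002000040000102000000000008020000010400220000200200000210000004008000000010020000008200000120000010020808000001010000080000000410000000000090000020000008400000080200000401000004040000100080000021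0000041000000010200200001001000000840000010020000200000010040000040800002004000000008104200100a0042001008221000101000000000000000000000000000000000000000000000000000000000000000000014010040208100808010140200400000000600000600000140000c000000000000060000000018480000000009000000c00000c00000000000003000001800080000000018000000005000000001000020200020000020020004000028000000028000010001002000008000042002000000010080040001002000200000402000000000401000010008080000000000000000000000000000000000000001080000218400004a080002401200000c000000000000000000000000000000004800010500000142100002111000040000000000088080080808082000000000000000000402081040100440000000000804040800000000000000000400822008408000000000000000000008404002080000000000003000002800084000000084000000005000000000c082000000000002013000000002800000000042000000200001200000500000000000100220000002200000000018000010800000000081000000a0000000014000000044410000002800000001400000000880000000100000004400000000900000080004200000000480000000028420000000000000210900000000900000000044008800000000000240000420000042000000004000041000002200000000000400400000210000010000810000020100008000000840000200008040000000840000040400000820008000004008000010008000000802000020000040080000002020104000000000000000010808008040080110000000000000000080204080802080800000000000000000080082102102008000000000000000000800200000000000100880080000000040804006002040200000000200420100000000020081001000000000410400200000000000000001000810200000000080004000001200001000008004000400003000001000004000088000000a0000010000400080080080000022000000020080010100000010020004000100100000000000000000000000000000000000000000002200028040050009000840020110010800000000000000000000000000000002008400209000030004201100002100000008400000810002000000810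0000004040000200400008001000800002002000200001010000200080004000004020000210000002100020000002000000000002d00000600a0000000000000000003000000120600012000000000000000000000000000000000050005000001a40000000000000000000a00028200000200420100800000000002801100000000002020200200000000204400020000000000000000041040200000000002800440000000008202002000000000011000021000000000011001040000000004200002040000000000440108000000000024420000000001080110000000000041000210000000000110008400000000000240000000000000900028000000082000000000504200000000040400001400000000900000120000000000422400000002080000000042004800000000000001100000000120000000000300001080000000240000000208008800001400000000000024000048022000000000220000048000060000000000014000000000000480000000a00000480000090000000048000000a00000000280000000088000000000a0000000440000110000002800000088000001200000000240000000000000000c0030000000000000000180c0000000002824000000000000000005900000000006c000000000000000001850000000028440000000000000000401000000204200100000000020410020000010800000000020801200000000000810000009001040000000001080100800002010000000008010800400000000000000001084040000000202000000020040040200000000402000000820804000002020000000000408000200801001000000040400802000008020000000000000000000010a20000141080000000000000001049000000000000000000000440c00000000420a00012440000000000000000282200000000000000000000084002000400020020000080020004004000000080020002000400010008000080012000020008000080200001000800002000400001004000004000000100400000080800000000200060002000000008020088000000000400900200000000002102010000000000900180000000000080a0010000000000880100000000008000000082000080000410000008010004000000408000100002200000040004008000800010000050000010002004000000410000200002400000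0002001000000000528000000000518000000000000000000000000000000000000034400a4800000000099002e0000000000000000000000000000000000000052000000000e0080000081000000400010100002008000001008000004200010000020100000084000020002000008000802000020400000102000100200000000040010000000000000000000000000000000000000000000412841480000000084c0412200000000000000000000000000000000000032200000000085042044000000025000002000202000100100004000080001010001000000400200001000400400100001002000000200400200004040002000020000840000200000000800004000004200000000040004800400000001002000000240081000000000800401800000000100040180000000000820200200010080000000001080004000000010000000000000000000000000000000000000000000000000000000000000000000008800001142000110010a100000090a0001412000004c0800800002144000040040020002000020000020004000800100010000080010010020020000400010000008008000200020400008000800200020000800200040000002000000800000010000200100000400040200020004000010000100400004002002000002002000100200000402000200000100040004008004000020010000200000020000000000000000000000808044021002040200208040404100200000000000000000010804080104042000000000000000000000000000000000080280002020400100110088000c00040000000000000002000280011004800800000000000000000000000000000002000c0001800110080000000000000001000800180030000000050000000005000110000a000000000120000090000000000240000000004800001400000000140048000006000000004800012000000000001000000002000500000a00000000500000000300000000009000000001200000002800000c0090000000004000000048000009000000000004800004200000008800000002000000000050000140120006000000000000300600000000000000000000c005000000000000046000002e00000000000180000060000000000000000c0000010000800400004000120000800040001001000100000200100001000100000800040040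008000000010400080000400020040020000200008000080008000400000000002440800000000420000000410000000410000820002040000000000001400000102020000000810000000004200000410001008000204000000000010000002010000001400402000080100000000000440000100050020000004800000044000000002000000008004000001808080000028000000000080400008000000000600500000000000900000c00000000a00000000c000300000000000009000000006200000000000480000a0000005000000000018018000000000000100080000840000004000402000002040000020800000200800400000082000004200000040000000800020400000801000004010000104000080000400200000000200010001000008008000800400000400040040000802000010008000040020000400400004000000200008000200800200004001000020010000200400000000000000000000000000000000000000000000000000000000000000000000004401100000240020010800092100050002800225000204002201080000a0040001002000000820000200004200000020080000010800002000404000000081002000001001000000000802000004040000200800004080002000010010000000800000410000040001008000010100000080100000021000400000042000008010000080080000000010080000080800000880000800400040000400400000000800400000400100080080000040002000100001100008000080000410000200000400100400000000200020020008004000200004000021000040000200000200140080000000000000000200220004000000000480204004400480000000000000000010100100110002080000000200440010000000000000000100220003a000000000000000000000000f000000000000009600000001b000000000000000000000000098000000004d000000000003a000000000000000000000000e00000012010010000000000a0100400000000002800802000000000a0010008000080000000000200828000000000008041100000000008008104000000001000000000008200480000000000840090001080011000000000104004400000000000008008800000000044000440000000000000000004800840000000000a0040008000200001100000008800080000080000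440000100008040000100000440000000400080000081000000020008020100000040040010000040200400000000000400820008000004100000000044001200000000000420000020024002000000020000000100200000048001040000000011011000000200080000000200000000012000c0000000a0000000000500440000000000180000042000a000000100000000000090000000050006000000000004800900000000120000000002000000000022008080800841000000000000000000018004420008800200000000008040400000000000000000800210400a00120000000000000000020024000000000000000000000000000000000000000000000000000000000000000000010044000000001a412210000000000a904a8000000001028444500000000424000010200004002000000410001000200000022000004020000008800000101000000002002000002010000080200000081000010400000008100001020000000000000000000000020800880180102000008800480050020400000000000000010000880028008800000000000000000000000000000000000042006002400800108040200000000000000001004010402200200800000000000000008002101100102000000000000000000010204010402009000000000000000000110100001202010000000000044081000000000000000000201004800000000020080211000240000000000040104020000000000000000202010010000000008408000000000000018210000042280000000000000000000049040002082800000000010200002000000000000000005000008608000110000000000000000120001001040000000004008081000000001001000000108080400000000022004010000000000400080200000000010408008000088000000000040802080000000020000000000048000018000000000c0a0000012108000000000024000028000000000500000200000000050280000000000000000000090240000000000048000200080004000042000000044000800000402000004000204000000c0000040000210000000000800400020040008000000880000040020002000080400800000000200000800201000010000080040400001000000200808000100000080040400000200000020000800104000001000040040100020000001001010000800000000000140044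00000000000c00900000004100000000001100420000000000084000000001400200000000800240008000800800000000200880020000000080000000000000000000101080410080108004200802200208200000000000000000100200100208200400000000000000000000000000000000800220800900800010002000000800401000400000800200800080000010020010008000000200204000200000400022000040000000004100004000040000202000200002000000100080010000100040010004000080000800100008000400080080004000100000100100004000400010001000000004008002001000004000040100008000000000810041000000800400000000410200020000000005000001000804400000048000000000402000004010400000000000440800100000030000000010000120000000000001080108000000090000000042000084000000000081120000000000004484000000000420000080000001400000000204004400000000000400000000000000000110000442400002100000000000000000011204000024480000000000000000000140900000102100000000000000000028000064080008000000000000000001400002800a0480000000000000000001040000810020a1000000000000000000088210001000009000000000000000000025080110000400000400420080000200020000000200120008000000008010000200082008000010080000000080040000800400008000000100180008000080080000000800000011000040000040000810002000020000050000020000400011000002000040008010004000008001002000000000200400200400000020008040080000000000810000004020000800002200000200008080000020200020000020800000800008200000108000800000400000000800082000004020008000008008000000000000040040802000000000240800040000000002804010000000002001028000000000041010800000000080010200000000080010108000000000441000000000404400800000000020240200000000001001800400000000400180010000801000000000100880800000000008020040000000008006000800000002000004020008000001000080400800000100200000010008040008000001000201020000004000804002000000200040000000800801000000040010080020000000020800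00000000300024000000000405200000000001040204000000000030002400000000010400500000000000040002200000000000c0003000000000100000080100080080008001000004000400800001000010000401000100400040001001000000080200001000040100000002000088000040000800200000400000000000021000040400000000102240000102120000000001080002010000000024000201000000000009080000000000000000001008840000000001200010000000802009000000000100802800000000002010048000000000200202100000022000000000100820000000000040201200000000020040022000000002000020020000020000080080010040100000020000080401000004002000002000040100800000080004000000040400200002000011000100000401000001000000010010000044000200000020800000800400008010000010002040000080040010000008010002000000010000010800000a000000800200080000440000000000008100000040800500000401000000801000001004000000040002000004200000104000001081000000000140000100800002008000000000440000100001040000000000400400002200810000004008000000004080000008012080000000000801808000000020000000000880000104020010000101000000000020000000000014010010021010400000000011004010000000000000000002202004000000001021001001010002000000001104002000000000000000001101000000000000000000000000000c01218220000000000000000030c300090000000000000000000000028028300800000000000000000000000000000000c498010281080000000140240000000000000000000011900984000000000000000000000000000000000000000102802109000000000000000000021024000000042402000800002200000100020000840000000480000020200000060000002004000000008008000005000000800000000280000080800004001000008080000400000000000140042000000000001080021208000c000000000000a0020400000000180104000000000004080010000000000000000420002800000000000240080000000008200000240000000005048000001504000000000208000104000000004400004400000000021040000000000000000000041408000000000880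000400001020000012000008000400800002020000000220000010004008000040020008000020010001000020000000021000040040000200100080000022000000000080100000120001000000202000004100000010010000400200040000012000020001004000004000800000001002000024000000400200100001020000000000010020440000001010000000100010820000000000800400040020041000000120000000008020000000010820000000020020208000000880000000008000000140000048000012000000000000c0500000000000018000030000000900028000000000000090000004000050000000004800028000018000000000000100820000000000440004200000000020200000200880080000000020011000800000000a00102000000000000802040002008000000001004040040000000100000004010000001080000101000000220000000802000022000000200800000840000004200000802000000008000020200000820000004010000084000000800000000004000a00040000000400240004000000000100048000000000014001200000000001400600000000000110018000000008000c0004000000040028000000001800000600000000060000000018000a00000040000180000000050000000018000000c000028000000018000000000048000000a00000000140000001000000000400808200208100800000000000000000200004200440100800000002000821000000000000000000101020402020408000000000000000000c02000020010008000080000100010000800100800100000000080000800008000800808000200002001000001000100020002040001001000200000008020000800002000400000800100000020020100004010000100000001000002000200010000804001000400010000200001000010008080010080004000000800400002000020800000000000406040000000000040400000044100000000000011028000000000000488800000000000024840000020800000000000106040000000000100000c14000000000000000000060000018000000000400001800c0500000000000000000000600000c0c0600000000000005060000000000000000000018000100020200008000040020000040002100000020400040000000040000100004010040000040000900000040020001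0000410000020010004000000480008000000100000400200000080800010800000102000000400200000020000004200000400400000120000100400000080200000808000014000000804000020020000000001002000100000404002004000040000004002000800000100080001000020008010000200008000010000800080020080100080000040000080400020000000040020100040000000800202000080080000100000400008000800000100080001000040800080002000040800040004002000004000100100040000040000000081000008020000021000008020000008010000040000000200400000088000800000101000040800000082000008020000408000000800200002040000000040828022000020400000000000000020800002400500400000000000000000000000000000000021000000c0006210000000000000000000105800180000800080004008000001000081000100008000020020000020002000000040800000820000008040001000400020000011000000c0000004010001000008800000000010000210000200000100021000020000000001080001000010000404000080080001000002000410000040000080020400020000080000820002000020000000800200080000800080040020000200000000004000800400200004000040042000040001001000040000400040020000020010002000020000200800100000000000c0014000002000400000010000a000000000001000800000a0008800000200200000000400400000120020400000000090022000001000200000001000000400040001000802001000400010000000000800080001080000400010040000200800080000800080000040002008200008002000100000004004004000000001040000011000002000200200000200000200000044000100000800100002000200800001008008000000120000010010020000080020020000024000000000002040802000000810000000008008000200000000081000004010020800000040200000000041000000802010100000000102080080000041000000000200000000000900001100000000240000028200000480000000120000090000000004100020400000002100000410000000000000004200001200000000810000800000000000000000000000000000000000100101040022020060020408000900800000000000000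000000000000000000204012008042000840100a00210400002400000000000a0000002081020000000040000000000a0000002040100200000000404008080001001000000000400400008082040000020004000000040000800800020400000040020001080000000000080000001004000022000000100404020000202000002010000040200000000104000000081000010200000020000208000000000208a000000000024000000000020082000000002800280000000000c0003000000000000082008080003000000000005000010200000000100000000000090010400000000402040010804004000000000080101008000000000180044000000002004400040000000000000001100005000000000100220000090000000000090002100000000008800000800040040000000400108002000000000a000880000000000880088000010008000000008009000200000001000080840040000000004021004000000000060000100000000005004020000000000000000002101010000000000110041000000000808100100000000040880000000100200000084000004020000008400000000100000820000010020000040800000420000040080000011000001004000041000000200800004100000080010001000002000080008004080008000040000000002000100010000804000400002000204000100080020000001000800040001080000200020008000020000010000200000900000004100020000040001000000800000a0000000200400200000300000200020020000010000104004000002000800800008020020000000010400a00000000000000000100900010104000200000000000000000400840040280410000000000000000004000a0201400410000000000000000020040800004020000200000088000040000810000000804002000020040000008000040000800000200402000001010004000008020000200000804000041000020000000000040801100000004400000000400042010000000004008000100010200000004400000000010100002000102200000000100110100000004800000000800000100100100000011000000401000100000800100400000050000002000001000400000020040040002000800200000108000002000400800004020040000000000500000000420020800000000000028000000248200000000020400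00010000000000819000000000012000000880000108000000009001100000000000080000800010800010000040010800008000200100000020004004001000000000080004004004001000008000400400400200008000080000404000400004000000000000000000000022a00000000a000c00000000000000000002401101a000000000000000000000000500050944000000000000000000000b20000000120201000000102000020000022000080080000002100000802000800000080000008008000100400000080400200000009000040080000010200010000201000000001000080080020001000040004000100008000400200100020000100000000100000400080008020008000020000200040020004004000100004000400040000010002000100200000004020000400020000400200008008008010000000020000040000100200040400010004000010080000804000008000040002002000000a000009a000002200000000000000000000000000000000024000011a0000012200000901400001400000000000000000000000000000003000002809000020001000800000c00000004400010000801000000040100010008000100400000000080100000030000004100000040010100000020200001000800010800000000804400100000000005001100000000000000000002808008000000000810000404810004000000001401000400000000000000003000404000000000809000000000900408000000a0000000000808000000120041000000c00000000000040000000048008200000280000000000084000000c00810000000300000000010000200800400000020020000800040400000104000080000801000000100020000800000100020200000100800010000102000040001020000001020004000000200000040080004000010080002020000040000804000000400002000002008000020080000042001000000020100008000410000010004000400040400000003000000900600480000000000000000000000000000000000000c20000a000048050002400007400000000000000000000000000000000000012088090000020000000000018002080000000008400108004800280000000000800201000000000050008400000000081000240000000000000000081000c0000000000440100000000000000000000000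00000000000010022020088004080040080101012010000000000000000000000000000000002100081080090080020902020080200000400800000900020000004040000080020001000010800000000010010000100008800000100400100000808000004000240000020010000800008200000000000040200000090000000a000010000840400000800800000010000002200000024000008002000100800000044000000002004000000300000040400001000000040010000040802020000800200000000010040000050002000000200100002008000001800000000001800000100a0008000082000000000081000010000000800020040000110000080200002000040008000401000000200000000080080004002000040100200200000200040080002004000002000080002001000000005000000001080000180000001020000000008214000000000000021800000000010400000c00000004020000060001100000000000012028000000000008000000081802000000400200000004004102000000000004080000100004080000021000000000120000000104804000000002008200100002002000000000200000000001800001400000000000c0180001414000000000004800004000000002800001800000000000c0300000000000000000000440a000000000001800010024000000000080800880000000010080000080021010000000020000200400000000081001100000000004080108000020400000000100042008000000040000000020800000402000002080000080400000200100000440000100000000022000002020000010400000040800000408000024000004001000000a000004000000000002008014000000000202001400088008080000000005000040000000004004201000000000401010080000000000000001010400040000000022080000000000000000a2200000000000004d000000900500000000000080440000000000001640000000000000224800000000000000000002406000000000001202000002805000000000614000000000000051400000000000000000200900000000000000000000600c0000000018a0000000000002980000000000000000018100020080000010400000401000002080000004020000804000000800000040200004000002400001002000000220000080800002008000001040000400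40000000000000008010084100080c000000000000000000402022008008008000000000012080020000000000000000108040401404004000000000000000000900800000020c10a0200000000000000000000000000000000000010a080000000030140000c08488820000000000000000000000000000000000005044000000013001002000004000000080080000840000000000800200000a00000400040000048008200000200400002200000020010000000024000002000800002400000400000a0020801001000400000000000000000000000000000002000808801002011040020810200405000000000000000000000000000000000004410010210400000000000000104800220000900000000044000012000000000000000000048c00000000001400008800a02200000000000048a0000000000000000000480002002041001000200880000000000000000012002010800420400000000000000000000000000000000200402040084020400000000000000000200409001082000040210400002401000808440040900080000000000000000000000000000000000000000000000000000000000000000041000824004002082040101201004000000c0000000004020000004010002000080000800003000002000400400000040003000001000100400000020008010008000200000900000040100200000000000000040000020400000000060300000088810000000000900000900000000018000018000000000824020000000000000000000420900000000004080008000008010000004000000400108000200000040004020010000020000408000200020040000002004020000100000200040800800000100040100040000040000040400000000080002100000000000880000040100802000000004002400100000000408004080000000001200440000040200000000100420010000000010000000040800000080010800002020000000600000010200000000010100000012000000820000080060020000010040002001000020200000000008040000800000080001004000000002000100800000840002000020040002001000004002000020080001000800010008000100020000400001002000010010000200400000004000100020000001000400080100002000004001000080000100100000800400002002000040201000004004000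01000801000100040000008000100200000008100000000040000204000000004004000002010108000000000802020100000000100101040000000004020201000008400000000002080210000000004000000082000000004000002200000400401002000001040000080800000202000080200000404000010200000040200000000010200000040800000810000020000000000000c200000000000a0000000f00000005000000000031100000000002200000090000000000a28000000000000000000000342000000000090000020000000a000000000480020000900000000000048000008004800800000840000010020000084000000000408000001005001000021000000000008400000080000000801000000020000010100000084000010010000011000004002000001080000041000001008000004080000040400000108000004010000020800000800000000012000010000400200001000100004000048000100008010000000800400010020008008002000040000020000800100100200020010000400002000000800000000000201200100000000204000000010804020000000042008010000000010010201000000000080102010000410000000002008004080000000040000008180000000000600000500000000000000000280001800000000000c0600030000180000000000c01800000000000000000000018180000000000c000010000000080010002000002010004000402000008000400080200001000080002000100200020008000100040008000400004000100002000200080008000400002000000500000000000000000012c0000000000000024c001800000300000000000000000c000009000c1800000000000001e0000000000000000000c0000010000200008004000001080000044000002000800002010000020800000048000000000201000000600000200010000041000000c0000000880000100200008000010000120000000005000009000000000005108000000000001811000000000000000000000294000000000000044240000000001200000600000000090000200400000008000000820000408000000080100020000090000004004000000a0000080040000024000040020000002200010000204000000400200010100000000000002004800000001100000000048000050000000001800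000003000a00000090000000000000880005000000018000000300000030000300000000000002000100000000400020002000100100002000800004001000800100001000040020001000800080004000800040004000100020008004000004000400400400000000400000800002000800010000810000080000080002200000408000100000100008040008000006000000200080100200000100100080000008100020000000080000000008002004001000002000202000400000040040080080000001001040001000001000104000080000080008400010000040000440001000008000000001041000000000000000000008090921020000000000000000000082110002018800000000000000000000848080000004111000000000000000000002500000008001400000000000021009000000004400000000020490000000000048000000020400220000000120002800000110000000000044000104000000000802010000020400000200200002000000010200000080400001020000008020000000000801000004100000040100000108000008100000020400000810000020020010000000000880000020208000000000008004014000008010000000000820022000000000808000000480800080000000408800200000090000000002000040000100400000080100800000100000400000020200001000820000008040000041000000202000200000020200002001010000008100000200002040000000804000000000220000010011000000000000200208100000108000000000028010100000000080080000018008040000000044020080000100080000001000000000000040440100000000000108010080088040000000004012010000000000804010010000000082000801000000000000000801000404000000040200400004000800020008002000040000000080100000800100002002000800002001020000000880000004004400000000900000440000000880020000001100000000820000000001001000008010040000000410000000004004000400100880000000008004040800002800000000004010000200420800000004200000000100000000000c004800000000000000001c00a0300000000000000000503000000000301800000000000000004830000000000000000078000000000000000018010020020000002001001000800001000000400100000020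0200200400000004004040000800002000110000100000200010800020000100001040000800010000000120280004210801100002118000004000000000000000000000000000000000000000000000000000000000000000000412200004202801100000981000080000000000a002100000000000102002000084004400000000c00084000000000000880102000000005000c00000000000000000084000500000000000044010000000000401020040000000002040800020020201000000020040808000000000080420020000000082020010000000000000000400420080000000002020400000000000202400800000000081000200000000000210810000000000040840800000000040400840000000002008010800000008008008100000000200802000000000000000000100030021020000100a0001800440202000000000000000000820202002400a000000000000000000000000000000000020090012002400010020000000000a000880000000000008000020010440000000000880800080000000800804800000000001408002000200200000000002801020000000040000000401000a00000020400000000000040420000000010010000010020840000002800000000100800000800204100000000400404200000008800000000080001000400000100040004000840000000010004000000800400040000210000100000400200200200100001000001000200040020100010000200010000100000050c000018030000000009050000022200000000000000000000000000000000000000000000000000000000000000001801800006280000000005140000181004000010000408000000040080000020000210000200001004000000400040400000410000100004040000010001004008000020000440000001020004000000000001020088000004000000000001011010000000001002000004200402000008040000000002200000200104010000000000821000800000210000000004000000000000000000100010010240082000000000000000000802010200440042000000000000000001400024020020440000000000000000008208108003000000000000090000408004088000000000000440c0000000000000000001800004400000000900001040820900000000000041180000000000000000001800008000080004100001000000008000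8000010010000088000200100000400001000040040000240000800800010000020002001000014000004004000100000800000000208021000000010000000000410000048000000000084000001100022000201000000000104000000c00050000000000000c001200000010200000000100000000000000000000008810044010200802004401020801000000000000000004005000202100900000000000000000000000000000000000480140400280000004400000008800000000024000002000800000410000040010010000008020010000100020000800040020000081000001080000404000200000080800000000200200080000200000000100040800000800800200002002000000400009000200002000080400000204000100000048000040008002000000280002000000000200808000002008000000000800800000201000800002200000200000210000100000400084000040400000800004010000020100200000021000010000001001000004100000000000800000200080000024000004010802000000810000000000600000080088020000002800002000800004800000000004400001000002040404000000000041080000000000080404008000000001102001000000000000000001010808000000000048040200000000041004020000000000c02000004000100008004002000000400004000004000040008008040020000400008001000040001002000002000200004000500004000400080000002004002000000402010204040201002040010204008080000000000000000000000000000000000000000000000000000000000000000102040404020102008022020084040017e33e78c737fc1ec9fccf78ce5fdc3e6f03fe6633bbccfda78df898f37cf67f3cce77877e7f47ff3e33e7c3be3fb1ff9efc17e7f87df1ebde7d97e3ee7bc65029b9cf2e71d9b747746773ae73a66f4753f967bb9cdcf74ef1f69eee3d373bb3dee773b3373753f79fb9b1e9b733d4fbefbf53f3dd1ef8fdef6f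d3f3773af7403ef7f2c9ab62defbeafbc554a50bb6daf3b22f3ffdfdfa56b2e4eefd7fbb7b15e658bdeddbdbf4536554d2fefafcfb54b7bec1b35b24bd7ef7f7f9b9bb1b77e03a5fd78de26ffeaa77aa326ffef2f82ff5e8ab1b7bff4e5f9b7f35cb9a5edefb2ba38a9b9d7d09fde9defb7cdb95fbfda257fec9a86fdba97bb2d8bffdcbe2f02dbce9f5daa7fd4b7e56fd17cf52dbee5aeb557d47bb7d5dfcf2cd5366ddd77bd76dfd1cecfdb1fd17ed1cbf6a55b5fdfcabe92eafedd5bd65cf4f5cec4fdb503bfaa6dbab7e35f3f5ce6eb9bcf54b56f6edd2c6db6795ecf2fbd3bd5beaeb37f6756eafdbcafdf577ab2d56dd6666f9eceb3add72f352bf755f7caf9b74d3e03a8d546dff9ceb77e0d5ab92e7fefdf3fa9ffdf6d96a6f85bfdf3d7fdba1902defddd37dffe10999edffffa7d86a9da2a4d5fb11d7d7efde7d488569dfefa5f030d17dffe5fce5dc6f7f66e2e933e5ddff77a96c5d16dddbdca3f7b3beffb0d6bb7fa1e69c9c7f6bf82efcdb7dff5998f88df5dfbfbbca70f8fbadd5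d223bf300572ab92ff9ceb77df2a546de7fefdf3fa9ffdf6d695907a7fdf3d7fd45e6fd22fddd37df01ef6662dffffa7d795625d5b2a04eed7d7efde42b77a96dfefa5f00f2efdffe5fc9a23af7f791d16cde5ddff77b693a2e93ddbe35c77b3beffb7297b7fbe1963639f6bc7d17cdb7dff5e67077275dfbfbbb58f38fbb22a2dddbf303af2abedffe314f7df35abed19fefd8c055ffdf9269a6fba7fe0c2bfdbae6fddefd22cbdffeef659d2ffffa8279a9dad5b55fb6e29d7efc1bd577ae9df905bf03f2d7c1f1df315dd977f99fde6f3fa23cf7756edad6ade25db5ff74bb1ff4ed6c47e59e66d63ff9bfbdefb24f3ff665f397dfa277fb8347706fa5dd6dddbb8f01d6debf53f5b6768eed67bf5d99f3e33a59ce3eeeaadbf79dfaebae0d7dd9fad53edbcfa7f9e2e96efc39f9be7aaeb9afbd99cf1efa99fcd9d34fd763e6d9b903ef78d36549d5efbeafbdaab5af5b6dacc4dcf3ffdfde5a94d1b6efd7fbb7cea19a75deddbdbebac9aab52fefafcfcab77bebe4ca4db3d7ef7f7e64644e577e005dfd7f21deffed5b7b5cdefff0d07aff5d754eb7bf0b1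9fa4bf35f465aedef4ebac755b9d72f63dd6defb732465fbf25dd7feb6566fdbb6bbad273ffdb41cf01dbf17eadd57f2b579a9fdf73f6d3befaaebaafcb7c77ea3fb0ecdab69dd297b9793fae3e2fdcef2ebe2e4bf1baa75c5fd5be6d66fee2bba9bcebf5fe3b7dc9023e5e6bc6bb9b9ecfbcdbede7d6b776969eeccdee75fbaef6d75abdda796e4b775bafed7abb5dafa75974d6aed59ef3e73e75d3db572dd536adcfb4f7af6ed8034abdb5b4efd2faf9aaef7dbabc6aef4f65a7ba5767eb7f72e67dbceeae55beeb2facf76b7597d5e8f7a2e7daf693f6eebe6cf7dccb7672f8dbb2efab6d76d200ffc7e1ff80f8ffe07ff1f1ff03e1ffe0fff1f81ff83e3fe07fc7f07ff00f9ffbf01e7ff01ff9f0ffc0f87ff81ffc7c7fe0f8ff83ffc7e07fe01effc0ff9f830279f3fe73f47f39f31e3cfe73f9fc3bf9f3cfe17cc37cf3c5fb1f85f0c73f78f7c3f8fb87f8f38cf3d3c1fcc3fcf8e379f73e79fc67e0ff3df9c679fe1fc3f903e5af156b6ee4b59bd9bbcd6bdf9b3793cfa99ddaf673bb3567b6676c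e4bcdccddd6fbcbb6b7ebf75e75a9d5f6f39afb8ebcbbebda9cf6e9ceedbbef66becee0174e3de7dabb69bc9e9cb6fad6add99d9fb4b77b9edef2e7bced8fecbd73bf59f8bfce5eececa7a4faed63174dcf2faf67fe6dbf79c5ba7ce767d5b533de7f503b57dabbb6f2dfae5d51f73b5bf94ef539a57bdb79fd4bf6e99bdb36e5e5a5eecdfb377646a6fdaeb375d67dde96ff56d5e93f7af34b66d7b3badef9b92f6ae

/-- Sign vectors of the block origins. -/
def S0t : Nat :=
  0x800000400000000000000000000000004000000400000000000000000000001000000000100000000000000000000020000000040000000000000000000000080000000002000000000410000002400000000000000000000000004000010000000000000000000000000400000040000800000200000000000000000000000400000000010000000000000004001000000200000080000000000000000000000004000000000408000200000000000000040000000000000000000000000000000924000000002040000000000000000000000000050840000000041000001020000000000000000000000000000000000000840000000000000000000000000000200000000008080000000000080000000000000001000000800000000000020000000000000000000008000000000004042000000000400000000000000000000000000000000000000000000240000000000000048000000000000000000000000000000000000000000420000000000000200000000000000000000000000000108000410000000042000000000004200000000000000000000000000000000000000000008800000000000000000000040000000000000000000000000000000000000000000040000010000000000820000a0002000000000800000000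00800000001000000000000000000000800000000000000000000000000000000200000204000010000000000000000000002080001000800000000000000000200000000000000080000000000010000000000000001000000000000000000000002000000200000000000000001000200000000000010010000000000000000210000000000100100000000000000000000002008000000000000000000000000000200000800000000004000400000000020000802000008000000000200004000040040000000000000000000000000000000000000000000000000000800000000000400400000000000004004100000000000000a000000000000002000000000010001000000000000080000000000000000000000000000000000000000000000000000000000000000000000000000000000000000000000000000000020000020008000000000200000808004008080000000080000200000000002004000001080000040200000108080000000002000000200000040000001000000000040000000400000040000000000000000000000000000000000000020200000000000000004000000000100000000200200000000000000000000000000000020200000000004008000000002000000000000000000000000000000000000000000000000000000000000000000000000000000000000000000000100000000200004204000000000100000200010180000000000800002000000000014000000000000400000040000000000000080000000080021000000000000020000204000000800010000000400000001000000800000000000000000000040800400000000008002010000000000000000002002001000000000000010000008800200000000200000000000000000000000800000000000000200000000000280000000000000000000600c0000a000000000000000000000000000000000c0000000000000000000000000000002000000000000000000000000000000120000000100000000010000000200100000000000010000004000000000000000010002000020001000000000000000100000004000000000010000000000000000040000000100000200000000100000080000002000000000020080000000010000080000000000000000000000000002000000000000000000000000000000000000000000000020000000200000000000004008000000000020000008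0000000200000100008080000000000000800000004000000000000000000000000080000000802000004010000000400001000000000000000041000000010000000000001000000000000010000000000000010040000000800000000000000008004000100a00400000000200001000000000000000000000000000000000000000000000000000000000000000000000140100400080008000100000000000000002000006000001400008000000000000040000000000480000000008000000000000400000000000002000000000080000000010000000004000000000000020200000000000020000000008000000020000000001002000008000000000000000000000000001000000200000002000000000400000000000000000000000000000000000000000000000000000000000210000004a0800024000000000000000000000000000000000000000000000010500000000000000000000000000000000000080000800000000000000000000000402001040000000000000000804000800000000000000000400000000008000000000000000000008000002000000000000001000000800004000000000000000000000000000c0000000000000020020000000008000000000400000002000000000000000000000000002200000022000000000080000008000000000810000000000000000400000004001000000200000000140000000000000000000000000400000000000000000000000000000048000000000042000000000000000000000000000000000000000880000000000000000042000000000000000000000000000000000000000000000000020000000000001000002010000800000080000020000804000000080000000000000080000800000400800000000000000000000002000000000000000202010400000000000000000000800804008000000000000000000000000000000000000000000000000000008008000210000000000000000000000000000000000000010088000000000000000400000000020000000000002000000000002000100100000000040000000000000000000000000080000000000008000000000000000000000000400000000100000100000000000800000000000000000000000000000000000000000020080000000000010020000000000000000000000000000000000000000000000000000000000008040010008000040000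1000000000000000000000000000000000000020084000010000000000010000000000000000000000000020000008100000004040000000400000001000000002000000000001000000200080000000004000000000000000000000000000000000000002d0000020020000000000000000002000000020600000000000000000000000000000000000000000005000000a00000000000000000000800020000000000000100000000000000800000000000002020000200000000004000000000000000000000000000200000000002000000000000008202000000000000000000001000000000001001000000000000200002040000000000440108000000000000400000000000080100000000000040000210000000000000000000000000000200000000000000000028000000002000000000400000000000000000001000000000900000020000000000400000000000000000000040004000000000000001100000000100000000000100000000000000200000000000000000001000000000000004000000022000000000200000000000040000000000010000000000000000000000800000400000090000000040000000a00000000000000000080000000000800000000000001100000020000000880000010000000002000000000000000008001000000000000000010040000000002004000000000000000001800000000006c000000000000000000000000000000000000000000000000000000000004000100000000020000020000010800000000020801200000000000000000008000040000000001000100000002010000000000000000000000000000000001000040000000000000000000000000000000000402000000800800000002020000000000000000200001000000000000400800000000000000000000000000000000000000140000000000000000000009000000000000000000000000000000000420a0001200000000000000000028000000000000000000000000000200000002000000000000000400400000008000000200000001000800000000200000000000008000000000000000000000000100400000000000000000000000080000000000000000200000000000008000000000040080020000000000000001000000000090010000000000000020000000000000000100000000000000000000000080000410000000010000000000008000100000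0000000000000000000000000000500000100000040000000000002000020000000000000000000000528000000000000000000000000000000000000000000000000024000840000000000110024000000000000000000000000000000000000000000000000000080000081000000000010000000000000000000000000200010000000000000000000000000000008000800000000000000102000100000000000000000000000000000000000000000000000000000000000400840080000000084c000000000000000000000000000000000000000002020000000000500000000000000000000000000200000000000400000000000000100000040020000100040040000000100000000020040000000004000000002000084000000000000000000000000420000000000000080040000000000000000000008100000000080040000000000010004018000000000000000000000000000000000000000000000000000000000000000000000000000000000000000000000000000000000000000000000000000000000011001080000000000000141200000480000800000000000000000020002000000000000000000000000010000000010000020020000000000000008000000200000400008000000000000000800200000000000000000000000010000000100000000000200020000000000000000400004000000000000000000000200000002000000000100040000008004000000000000000000000000000000000000000000000044001002000200208040400100000000000000000000000804000104000000000000000000000000000000000000080080000000000100000088000c0004000000000000000200008000100400000000000000000000000000000000000200040000800100000000000000000000000800000000000000000000000000000000000000000000012000009000000000000000000000000000140000000014000000000000000000000000000000000000000000000000000000080000000050000000020000000000800000000000000000080000000090000000004000000000000008000000000000800000000000008000000000000000000010000040100004000000000000100400000000000000000000400400000000000000600000280000000000000000000000000000000000000000000000800400004000000000800000000000000100000200100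00000000000080000004000000000001040008000040000000000000020000000008000000000000000000244000000000040000000000000000040000082000000000000000000100000010002000000000000000000400000041000100000020000000000000000000201000000140040200008010000000000040000010001000000000400000004000000000000000000800000000100000000000000000000000000000000000000040040000000000080000080000000080000000040001000000000000080000000002000000000004800000000000000000000000000000000000000000008000004000000400000200000000000000000000020000000000000200000000000000000000080002040000080000000400000000000008000000000000000000001000000000000800000000000000000000000080000001000800004000000000000000400000020000800020000000000400000000001000000000000000000000000000000000000000000000000000000000000000000000000000000000000000024000001080009210000000000022000000000220000000000000001000000000820000000000000000020000000010000000000404000000080000000000001000000000800000000000000000000004000002000000000000000000000000000000000008000010000000000000000000000000000042000000000000080080000000000000000000000000080000800000000000000000000000000000000400100080080000000000000100001000000000080000400000000000400100400000000000000000000000000000000000000000000000000000000100000000000000000000200000000000000000080000004000000000000000000000000100000100000000000000000400000000000000000000100000003a000000000000000000000000a00000000000000960000000120000000000000000000000000800000000000000000000002800000000000000000000000000000001201000000000000080000000000000002000000000000000a0010000000080000000000000028000000000008001100000000008000100000000000000000000008200480000000000840090000000011000000000104000000000000000000008800000000044000000000000000000000000000000000000000000000000002000011000000000000000000800000400001000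0804000010000040000000000000000008100000000000000010000004004000000004000000000000000040082000000000400000000004400120000000000002000002000000000000002000000010000000000800000000000000001000000020000000000000000000000000000000000200000000001000000000000001800000020008000000000000000000080000000050000000000000004000800000000000000000000000000000002000080800800000000000000000000008004000000000000000000008000400000000000000000800200000200100000000000000000000000000000000000000000000000000000000000000000000000000000000000000000010000000000001a40021000000000000048000000000000004400000000000000000020000400000000000000000000000000200000400000000000000000000000000200200000000000000000000000000001040000000000000000000000000000000000000000080080008000200000880000000000000000000000000001000008002000800000000000000000000000000000000000004200000000000010804000000000000000000100400040000020000000000000000000800210000010200000000000000000000020000000200000000000000000000010000000120000000000000000408000000000000000000000100080000000000000000000004000000000000010400000000000000000020001000000000000000000000000000000801000000220000000000000000000000900000200200000000001020000200000000000000000500000020800000000000000000000000000000104000000000000008000000000000100000000008040000000000200400000000000040008000000000000000000000008000000000004000000000000000000000000000800000000000000040a0000012008000000000024000020000000000000000000000000050200000000000000000000010000000000000040000000000004000042000000000000000000400000000000200000000400000000000000000000000000000000000080000000800000400200000000800000000000002000000002010000000000000004000000000002008080000000000000400000000000000000008000040000000000000000000200000000010000000000000000000400400000000000040010000000400000000000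0100400000000000080000000001000000000000000000000000800800000000000000000000000000000000000000000000101000000000108004200802000000000000000000000000100200000208000000000000000000000000000000000000000000000000000010000000000800401000000000000000000080000000000010000000000000004000000000400022000000000000000000004000000000002000000000000000000080010000100040000004000080000000100000000000080000000000000000100000000000000000001000000000000002000000000000040000000000000000000000000000000000000000000000020000000001000001000004000000008000000000002000004000400000000000000000000000000000000000000000000000000001080000000000000000000000000000000000000081000000000000004484000000000420000000000001400000000000000000000000000000000000000000000100000042000002000000000000000000010004000020400000000000000000000140000000000000000000000000000028000000000000000000000000000001400000000a0480000000000000000001040000810020800000000000000000000000000010000000000000000000000000240000000000000004004200000002000000000002001000000000000000100000000800000000000000000000800000008000000000000000000800000000800000000000000000000000400000000008100000000200000000000000004000110000020000000000100000000000000020000000000004000000000000000080000000000000000100000000200000000000000000000080000000002000200000200000000000002000001000008000004000000000000800000040000000000000000000000000000400008000000000002008000000000000008000100000000020000200000000000410108000000000000000000000000000000000000000000000000000000000008000000000000400000000000010000000000000000001000000008010000000000008808000000000080000400000000000020000000000000000000000080000000000800008000001000000000000080000000000010000000000000000000040020000000000000000008008010000000000100000000000000000000000000010000000000000040120000000000100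000000000000002000200000000001040040000000000000000020000000000000002000000000000000000100080000008000000004000000800001000010000401000100000000000001000000000200000000040100000002000080000000000000000000000000000000000000040400000000100200000102120000000000080002000000000020000200000000000008000000000000000000000008800000000000000000000000802008000000000000802800000000000000008000000000200000000000022000000000100020000000000000001200000000020000020000000000000000020000000000000080000000000000000000000400000004002000002000000000000000080000000000040400000000000010000000000400000000000000000010000000000000000000800000000000008010000010002040000080000010000008000002000000010000000000000a000000800000080000000000000000000000000000800100000000000000001000001004000000000000000004000000004000000001000000000100000000000002000000000000400000000001040000000000400400000200010000000000000000000000000008002000000000000800800000000000000000000000000100020000000000000000000000000000000004010010021010000000000001004010000000000000000002202000000000001021000000000000000000001104000000000000000000001000000000000000000000000000000801210000000000000000000020c2000000000000000000000000000080002000000000000000000000000000000000004010000280000000000140240000000000000000000011900900000000000000000000000000000000000000000000002100000000000000000000021000000000000002000000002000000000000000840000000400000000200000000000000000000000008000000004000000800000000000000000800004000000000000000000000000000140042000000000000080020208000c0000000000002002000000000008010000000000000000000000000000000000002000200000000000000000000000000820000024000000000004800000150400000000020800000000000000000000440000000000000000000000000000000004100000000000000000000000002000001200000000000000000202000000022000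000000400000000000000800000000000000002000000002000004004000020000008000000000000000008010000012000000000000200000400000000001000040000000000000000002000100400000400080000000000000002400000000000000000000000000000000000004000000000000000010000002000000000080040000002000000000000000000000800000000001080000000000002000000000080000000000000000000000004800000200000000000040500000000000018000010000000800008000000000000010000004000000000000000800020000000000000000000000000000000000040004000000000000000000000880080000000020011000000000000800000000000000000802000002008000000001000040000000000000000004000000001080000100000000220000000802000002000000000000000800000000000000002000000008000020000000800000000000000080000000000000000000000000000000000400040000000000000100008000000000014000000000000000000600000000000010010000000008000400000000000000000000000008000006000000000400000000180008000000000000800000000000000000080000000000020000000000000000000008000000000000000100000000000000000000800000208100000000000000000000200004000040000000000002000000000000000000000000000020000000400000000000000000000800000000000000000000000000000000800100800000000000080000800000000800008000000002000000000000100020000040001000000000000000000000000002000400000000100000020020000004010000000000000000002000000000000000000000400000000000000000010000080000000000000000800000000000000800000000000002040000000000040000000004100000000000000020000000000000000800000000000004000000000000000000000102000000000000000000c0000000000000000000000000000000000000000000180000000000000000000000000000000c0000000000000000050000000000000000000000000000000200000080000000200000400000000000004000400000000000000000000000400000000008000000400200000000000000020010000000000000000000000100000000200000080800000800000102000000400000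000000000000200000000000000000000100400000080200000008000000000000004000000000000000001002000100000000000000000040000004000000000000100000000000000000000000000008000010000800080000080000000000000000080000000000000000000100040000000000002000080000000000000000000000000000000000001000040000000002000040000000000000000000000000000000000000000000000000000000000000000000000000000000000040000000200400000000000000000001000040800000080000000000000000000000000000000000000000000020022000000400000000000000020800002000500000000000000000000000000000000000020000000c0002000000000000000000000100000100000000080000008000001000081000000008000000000000020000000000040000000020000000000000000400020000010000000c0000004000001000000000000000000000200000000000000001000000000000000000001000010000000000000080000000002000400000000000080000400020000080000020000000000000000000000000000000080000020000000000000004000000400000000000000002000040001001000040000000040000000020000002000000000000000000000000000c0010000000000400000010000800000000000000000000000008000000200000000000400400000000020000000000090020000001000000000000000000000000001000002001000000010000000000000000000080000000000000000200800000000800000000000002000200000000000000000004000000000000001000000000000000000000000000200000000000000000100000800100000000000000000008008000000000000000010020000080000020000000000000000002040800000000800000000008008000000000000081000004010020000000040000000000000000000000010000000000000080000000040000000000000000000000100001100000000200000000000000480000000020000000000000000100000000000000100000000000000000000004000000000000000800000000000000000000000000000000000000000100101040002000060020408000100000000000000000000000000000000000200010000000000040000800000000002400000000000200000020800200000000400000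0000080000002040100000000000004000000000001000000000000000008000000000020000000000000000000800020400000000020001080000000000080000001004000002000000000004000000202000000010000000000000000100000000000000010000000000000208000000000000800000000000400000000000008200000000080020000000000080002000000000000000000000002000000000004000000000000000000000000000010010400000000002000000800004000000000080000000000000000100000000000000004000000000000000000000100000000000000100000000010000000000000002100000000000800000000000040000000400000000000000000200000000000000000008000001000800000000800100000000000000000084004000000000000100000000000004000000000000000000400000000000000000000210001000000000010000000000000000010000000000004000000000010020000008400000000000000840000000010000000000000000000000000000000000000000000001100000000000004100000000000000000000000001000000000200008000800008000800000000000000000010001000080400000000200020000010000000000000100000004000000000000002000000000000001000000000080000000000000000000000000000000000080000000000000000000100000000020000000000000000004000000000800000000000000000000010400200000000000000000100900000100000000000000000000000000800000000010000000000000000000000200004000000000000000000000200000000040200000000000000000400000100000000040020000000000000000000000000000000004020000010000040000000000002000008000000000000000000000000400010000000040000000004000020100000000000000001000100000000004000000000100000000001020000000000000000000000000000000000000001000001000000100000000000001000000001004000000400000000000000000000000000000400000008000000000000000000004000000040000000000000001000000004200008000000000000280000002000000000000200000000000000000080000000000001000000000000010000000000000100000000000000000000000000000000000001080000000020000000000000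4000000000000000000004004004001000000000400400000000008000080000000000000000000000000000000000000022800000000a00040000000000000000000000010080000000000000000000000001000008000000000000000000000002000000001000000000000000000000000220000800800000021000008020000000000000000000000000000000000000000000000000000000000000000000000000000000000010000000000000010000000000000000080004000001000000000000000000000004000800000200000000000002000000200000000000000040000000000000000020001002000000040000004000200000002000080080000100000000000000400000002000404000000000000000000008000000000000400000000000000000001800000000000000000000000000000000000000002400000120000000000000800400000000000000000000000000000000000003000002008000000001000000000c0000000000000000080000000000010000000800000000000000000010000000000000410000004000000000000020000000080000000000000080000000000000000100110000000000000000000200800800000000001000000080000000000000040000000000000000000000200000000000000080000000000090040000000080000000000808000000120040000000400000000000000000000048000200000200000000000000000000000800000000200000000000000000800400000000020000000040000000100000080000000000000100020000000000000000000000100800000000002000040000000000000000000000000200000000000000000000000002000000040000004000000400002000002000000000000000002000000000020000000000000000010000000400000000000000000000800400480000000000000000000000000000000000000c0000080000000500004000020000000000000000000000000000000000000120800800000000000000000080020800000000080001080048002000000000000002000000000000000080000000000810002000000000000000000010000000000000040000000000000000000000000000000000000000000020080004080040080000010000000000000000000000000000000000000000080080000000000100020000000000000000000800000000004000000000000001000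00000000000000001000000000800000000000010000080800000000024000002000000080000000000000000004000000009000000020000000000004000000000000000100000000000000040000080020001000000000000000000020000000000000000400000000000000400100000008000000008000000000000000000000400000000002000000000080000018000000000010000000002000000000000000000008000000000000000002004000011000008020000000000000000000100000020000000000000000400000000000020020000020000008000200400000000008000000000000000100000000100000010000000100000000000820000000000000000000000000000040000080000000400000004000110000000000000000000000000000000000008180000000040000000000000000200000000000000000000000400000000100000000000000000000080000000000200820000000200000000000000000000000100000100000000000040100001400000000000000000000000000002000001000000000000402000000000000000000004400000000000000000000024000000000080000000000000010000000080000000000000000000000000000000000001000000000004080100000000400000000000002000000000000000000020000000402000000000000000400000200100000040000100000000000000002000000010400000040800000400000000000004000000000800000000000000000200001400000000020200100000800000000000000500000000000000400400100000000040000000000000000000000000040000000000002000000000000000000082200000000000004c0000001000000000000000804000000000000014400000000000002000000000000000000000000040000000000010000000000000000000000140000000000000014000000000000000000000000000000000000000000000000000001800000000000002800000000000000000000000020000000010000000401000002080000004000000004000000800000000000000000002400000002000000200000000800000008000000000000000000000000000000080100840000804000000000000000000400020000000000000000000000000000000000000000000100040001004000000000000000000000000000000020c1000200000000000000000000000000000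00000001000800000000201000004004088000000000000000000000000000000000000050000000000000000000000040000000000000000000000000008000000008000000000400000400002000000004000002000000200000000000240000000000000000000000000002000080000100040000000000000000000000000000000200080880000201000000081020000400000000000000000000000000000000000041000000000000000000000010480000000010000000000000001000000000000000000000800000000000040000000000200000000000004880000000000000000000400000000040001000000080000000000000000012002010800400000000000000000000000000000000000200000040080020000000000000000000200400000000000040200400000401000008440040900000000000000000000000000000000000000000000000000000000000000000000040000820000002002040100200000000000c0000000004000000004010002000000000800000000002000400400000000001000000000000400000020008000000000000000800000040000000000000000000040000000400000000020100000000810000000000000000000000000010000008000000000804000000000000000000000420000000000000000000000000010000000000000000000000000000000000000000000000000408000000000000000000000000000100000200000000800000100000000000000000000000000000000000000100000000000800000000000802000000004000400000000000008000080000000001200000000000200000000100000000000000000000000000800000000010800000000000000200000010000000000000000000000000000020000000060020000000000000001000020000000000000000000000000000000004000000002000100800000000002000020040000001000000000000000000000000800000000000100000000000001000000000010000000000000004000100000000000000400000100000000000000000000000000100000800000000002000000201000004000000000000010001000000000000000000000000080000000000000000000000000040000000020100080000000008000000000000000001010400000000000002000000000000000000020002000000000000000000000000000040000002000004004000000000000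40000080000000000000000000000004000010000000000000000000010200000040000000800000000000000000000020000000000000000000a00000005000000000010000000000000000000010000000000a200000000000000000000002000000000000800000000000008000000000400000000100000000000008000000000800800000800000000000000080000000000400000000000000000020000000000008000000000000000801000000000000000000000000000000010000001000000002000001000000001000000008000000080000040000000108000000000000000000000000000000012000010000000000001000100004000008000000000010000000800000000020008000002000000000020000000100100000000000000000000000000800000000000200200100000000200000000010004020000000002000000000000010010001000000000000002000000400000000000000004000000000000000000080000000000600000100000000000000000200001800000000000800000000000800000000000010000000000000000000000080000000000008000000000000000010000000000000004000002000008000400000200001000080000000000200000000000000040000000000004000000000000000080000000000000000000500000000000000000000c0000000000000020800100000020000000000000000040000080004100000000000000000000000000000000000000000000000000000040000000000000040000000000000000100000208000000400000000000010000006000002000000000000000008000000000000010000000000001000012000000000500000100000000000010000000000000100000000000000000000000020000000000000000020000000000000000040000000008000000000000000000000000000040800000000010002000000000000400000000080000080000000020000040020000000000000000204000000000000000000000000000002000800000000000000000000000000000000001800000002000800000090000000000000000004000000010000000100000020000000000000000000000100000000400020000000000000002000000004001000800000000000040000000000000000004000000040000000000000000004000000000400000000000000400000000000000000010000010000000000080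0002000004080000000000000000000000000000000002000800000000001001000000000000000000000000000000000080000000010000020000000004000000400000000800000010000000000000000000000000000000000000000000000000000000000000000000000010000000000000000000000000109210200000000000000000000000000020100000000000000000000008400000000000000000000000000000000000000000000014000000000000000010000000004000000000204900000000000400000000000000200000001000000000001100000000000400001000000000000000100000000000002000000000000000002000000000000010000000000000000000000010000000000000400000000000000001000000000000008000000000200000000000008000000000000000000000080040140000080000000000008000220000000008080000004008000000000004008000000000000000000000000400000000000000801000000001000000000000202000000000200000080000000000000000000000000000000000000000000000000000000000000000000008000000000002200000000010000000000002000000000001080000000000200101000000000000800000080000000000000440200000001000000000000000000000000000000000000000001000100800800000000000000120000000000008000000100000000820000000000000000000008000004000000000000000000040000000000080020000000000000801000000001000000020000000020000200000008000000000044000000000000000000000000000000000000000000000000000000000000000000100400000004100000000000000000001008000000000080000008000028000000000000000002000200000000000000000000000000000004004800000000000000001000002000000000000000000020000000003008000000000000000000200000000000000000400000000000000000100000200000000020000000008000010000004001000000200200200400000000000040000000000000110000000000200000800020000000000000000000000000000000200004200801000000010000000000000000000000000000000000000000000000000000000000000000000000000410200000002001000000080000000000000000000010000000000010000000000000400000000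0400000000000000000880002000000001000000000000000000000084000400000000000040000000000000000000000000000000000000020020201000000000000000000000000080420020000000000000000000000000000000000000000000000000000000000000000002000000000000001000000000000000200810000000000000800000000000000400840000000002000000000000008000000000000000200000000000000000000000000000000020000000a000000040020000000000000000000080020000240000000000000000000000000000000000000000900000000000000000000000002000000000000000008000000000040000000000880800000000000000804800000000001000000000200000000000000001000000000000000000001000000000020000000000000000000000000000010000000000800000000000000000000800000000004000000000000400000000008000000000000001000400000000000000000040000000010000000000000400000000210000000000400000200000100000000001000000000000000000000000000000000000050c000010020000000001010000000000000000000000000000000000000000000000000000000000000000000000000000000004200000000004100000000000000010000400000000040080000020000210000000000004000000000040000000000000100004040000000001000000000020000400000000000000000000000001000000000004000000000000010000000000000002000000200000000000040000000000000000200104000000000000001000000000200000000000000000000000000000000000000200080000000000000000000000010200040040000000000000000001000004020020000000000000000000008008000000000000000000080000000000008000000000000040c0000000000000000001800004000000000900001000800000000000000041100000000000000000001000000000080004100001000000008000000000001000000800000000000040000100000004000000000080080000000002000000100001000000000000000000000000000020802100000001000000000041000004800000000008400000000000000020100000000010400000000000000000000000000000000000000000000000000000000000000000000088000040002008000040000208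000000000000000000040050002021000000000000000000000000000000000000004800000000000000004000000080000000000240000020008000000100000000100100000000000000001000000008000400200000000000000800004000000000000000000000000002000000000000000001000408000000000000000020000000000000080002000020000800000000000001000000000000400000000000002000000000000002008000000020080000000008008000002000008000020000000000002000000000004000840000404000008000000100000201000000000200000000000010000000000000000000008000002000800000240000000108020000008000000000006000000800000000000020000000008000000000000000040000000000020000000000000000010800000000000004040080000000010000000000000000000000010000000000000000400000000000000400000000000000008000000000000000080000000000004000000000000000400080080400000000000000010000400000020000000000000040001000000000000000000020000000000004020002000000010020400102040080000000000000000000000000000000000000000000000000000000000000000001000404040000000000200000800000004228184015940c012805280804040c2a01dc62120304a583003880012866561c044081580e47dc0c2086810a3e91341cd812c5a809602312508442e641460021888c2c3058b3055046532212202d4451692038145c1502e0501c0e09003b2288446231232043549d11a141312100e0c4b84203050678092b43d0d27718c7402212f0810a20d609428bc004210026023182240c915512022040ca405ba3301582488d4c99c030500414026612d41804040c41025820a97052d6a8b0b2114460085681010040d200220212651472b02401200100023d4e030b4c244b18129aa02900009a8d6c087c89dcb0749a9452a4004110c00841932133a048007541c210241068c5d28074010640ec178e128ae652294130078835018cd0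c000420883689168a50c0060917812e51cbf2200313c4421080e2e09d431204c4550e84942402302800b22280481e50c68b104544a14546d9002800111a0424381241028e106925142a2db086430022b2406856220c0400918d4608110ad304060a09910d1402a8d146d4e086a450000289200bc30503a092930804862810899143fd0a08005231080106d6000080c33f3a4904005a000442b0002450b9000000101db21a4a00081718820a864d4027e40a22911a010d205a14404009092c881f32188ed80d2817aa0a084942828b820dc0201d310907001241408138270308a804102239210056280007410685546225001a0643011d21f6d42c61400600d8e1822904e0ac026d0401c901ed6200524e8268590604501220464c5c5239802245292c1aa00c00522a54a64dc12238a6a58110284249993012202a08114c842106421be868301627d3c084062012882407449247340000032140904990083101b32282980b90012a082ac708100161b1408a9010c2d04005974a80402609849008091908e66d424500cbc9862c41112ed7ea0079285a00151804820430e80390232a944005aa0252d040818c011dc0206198de0e0382346671088a162dc00d801c408903c0ad2804608842c432709f9501b04b17c04531919900166801012068a15d4c10220d0052141e02e0941086a921bb509842a038088a0a82a213478102c2a0053d98721536d340808920e14c7039682c488421a20519430eda18b489c043516200493001246081050091a9aaa32588900c5304a00010f2ac8218429440028d51ea808680804452d081a882c902810ea58dc1821041a9c4c0040046e95f5664440047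6e00101947210cc381032b04d8bda000003744450280b80301a0495014045885a24c9a434080d20421d420c9b53040183604512dc824648c322092c031c5c0414d01018012a0d00029028a9998111082b2b2028a0bca1833822310089822089287b8711da2000540612ca0020be01a011c51440041607a001801b482b1c01a504800141a630032109c8ba059ed85429124168a0cc06814ba026600509d98090c0a77502bc170b80980a45110142e558072c02631505141009532214a34278642900140b415002400da9082ea5cb830280c0d218402104381115260441c44ae1036a82fa8f060151100e0e200a5c09212664a30444350c30032709a22678a601612003441816700a0e4805e50b1ac0020ac802340e01e38360b003a42103b800d8d98e01821b01ba9206840c829f01660503f60b05f005b068036a00ef800308c030059b26643747439d112101e01a8a023089306a11c01084280b90f05b0c00f5824c1589007d04208e01241b88250782310e12471306340b20db94271aa14014103e18e00492ae481880198442a50001412010888d032301a300092652c60944ccd456c801a0b320a414350815a233928006a022830094000804c4aa086608c680154c20c09002492c888422524424d1191a9024539e1eb0a288ac8a4c9d32a64808050a5684c826a448090116050f0b2465da642149853810074684b0134844402104500830f2958c5c4020384a404ae0198162c8793d41a2409a401241e1842e85283140008251a4207594798816610414c1331a1309000132925ed83101000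

/-- Number of low coordinates of each block. -/
def LOWt : Nat :=
  0x75b75daddb5badbadbaeb75b6ed6dd76daedadd6dd6ddb5bb5d75d76baebb5b76d6eb6ebaed6ddadd75daedaeb6ddb5bb6bb6b75b6ebaedaebaeb76b75d6ebaddaeb75baedaed75d75d6dd75d75d6dd6db76b75b6eb75b76b75b6ed76b6db1b6db6d6edadbaebb6

/-- First piece of each block. -/
def PBt : Nat :=
  0x12da5acb49672ca58cb095f2ba56cac9572aa54ca894f29a52ca494728a50ca093926e4bc9391f23a454899112124047f8fd1f63cc758e91c2364688cf18e2fc5b8b515a2ac5189b132244448810f21dc3a86d0ca1742d8530a213c2684b0861041f83d06a0b41582303604c08809001fe3fb7f4fe5fabf17e0fbdf5bea7ccf95f0be07b8f6ded3d67aaf45e83cc796f29e33c277cef5de3bb76eecdd93ae754e99d2ba1740e71cdb9a72ce49c738d718e21c23836fedf9bd3796f0dd1b9b726e2db5b63686c8d81ae35b6b4d65aab516a0d3da734a692d21a3b4367ecf99d336664cb996b29650c9191b22642c758e31862ec4d8930e614c2584304600bfd7dafa5ecbc978aed5d8ba1722e35c4b796ead95aab51682cc596b1d632c5588b015fabe5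74ae55aab4560abd55aaa54ca894f29d532a614a29351ea394528950aa053ea7c4f09d13826c4d099d332624bc9752ca554a29352624848890d1fa3b46e8d91aa3145a8b1142244408710da1a42c8550a210418821022003c0740e01b0340640c01702c0500901102003c0680b01202003005006008008000

/-- Images of the piece representatives under `T`. -/
def TTt : Nat :=
  0x170642e0685c1f0b834170542e0385c160b81722002420005c1c0b81c1704e3a00470008d80017042320005c088b800170102e0105c010d02828010aa00c4c0003beef7059d60d0d40a88801100620a0dbcc100c8323006c86010cc078780008a103005b84157a8090d0000f470225e808090a0403e0336c0177007090404e01bf409041aa071b40738440130c814f30120a0012c191c00c450060800020097303eed06c8206c08006d8381f06e02044281c1780c3f010360d4000003b08de069fc083e8121602afd061dc0c424011381425074a20d8b4027e00008c2c580fbf80a6f012fa00010c992400298344e009f0003ac148883c3506dee0000cf07a830e1000300fc340c2781edd04de8043681a0c82310021e6044140c2103e230007c0a3c80001a0c072f0680e134161e01eef001fa0809c1a770110906e0409b98147681041050076d444127b838eb0206a0b81d27042580795c06bdc081f76828e6020820c021f50186007ed87a08b8810238242401030034341570810f50400e678dc066f8203b018640a3f81a6f020fa024580713c047a026da02dba0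0022f0808381f05db604428017a004da041ba0593c1711034d9040380f8ac0103c5a082b41da41bc1366816d50213c0aa640a5102cd4020ee00836c10755cd106134012fc0632008055c9160f9a8172d032cf0001df82781e66820d504cde0c025fd64022a500996041801b02b4e09ec94a05b2c1964010600381c4c1cc03318188804d8c000356b62030a7028fc042b4130289409f68ae01b04105d032ae04108039f00c46018c00017e0c2681632014d10381b348161d04e029405d54002ec085a002c102574082b8012b82a0dd755e052e0104382c9b06d2006a18135b8107801904049d00d4a830b60001d372500f5a020aa0457600824ab590306c068bc049b81d077160d86d5e0c26c065c034870115c0c304002b838ba024fc01b10035383cad000131583b2b55030b4025280faec103881869034cc002a4000734cad038fc0ab1012538000d2254a0c1801164036cb04813280240a4c808d4058ee09a880007218093700a72b341e6a80a9e020de02038fb4483e61048f409270005c0068707536042bc164d030bf058c80b344124c8307707da80d2881c04d1c059901cbead8084a82082040e80a2a80f5d83eb407d28000344202d860963d200c1e01f5b83a860781ce20149a04aa084064f8093000c46000cf07cd40c16816458000e0d9380f9841d3d03a89000e6083180b3182688001360aae00e43810af01120032dc134301078034129da3019420207c00d800f837f33a038950216c0ca080002ff609dd41a799f8185382ac4021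5a0d83a023e0308c049800a2100b06ba0890353805184093d00005cb1200b9e0104300ab7019320ba880b3b810d40041c2f835a141038950116c0a9d0003983088060c603b181b02d7269064cc0aaa41c38800050d19a003541b378109e0116402978043602e6e0001bca2c8123701e6c020bc09036b245820cf05cd4041680f3883266071520a9a40004dce05e50d20a1c41533010a90201b9a990184d01cbf029a20218c1844016c6050e6078150c4482a9c048f4049840065806a50459003180000685c5e060d8012c80937028091d40ba103ad8678128b038d4039680006a260570d5c062e8052b810c106c064a0a01f2a8201a016260481efa7c02449028a6041381a01e7efc04c4a0b0b4102880008f3c9e0c368077a03edd070a6011241827010f802868093bc16268103c0740e0c410191c01e4502096000215c2702049040a6093e01801e8847061c4050f4021202c07d80700c11410258110402407010cc1921820300461e093c81f1181e3e06c8400398007680902034820000db31f8301b0305e054001421016f2030460e8f8001e830e2064480e11c0a2680a3c041de078d00b1b8223b040640d37c0e03e2e0375c8a0c0e0102582f0405864058ec191b810df07807cd3dc0b7580f110286a003bc1c268343c00c680010c1918000330221e078ec0a6f8083706c640002231878364302460040cc10178301b0507e054001e01fd62d060a2040940f7e014fa07dfc02b780616000220085608070166c802031040ea71541f140201a062260a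3b81213820fd00a12058207b7e03a510585a07894001e818470184804388041f01a23040840bbc8106c8341c03444040ac1a0475003ac20209b6c170f8110a0380fe9823646c81e2b038440a87000800142f0507e0a06c00140111307034041540d88002f30660a09064007a81e180421a0db841e94000170782e0ec80000b83727002540005c180b82f240024c0005c148f000170482e08c68000b81f1f002520005c0c91800170282e04c600092800170182e02c58000b80715002280005c00051740f040095b0188905a661086825948544100a521340c2ca0001da0a0de11dbc04d60328b00f100b89c2ba00036e07e16116f405cb811b80a5720a51c0cc4030930853613ac02d0084b680266410e88255683da80527c157e4165b819310a3800042402c30331801206132402c7784700024f60a1dc0c2203cdd085d6152c016e104bd809b800066402b505983012a614240193a0479009c300b6682a1405a6907b8a14db418dd8139f08d100aee00ddc8088508202012ac00350480006448130402c5785000057e012720201a81b3107eec15af41793011050144801ab0010204400026a014e8818ba03d0a09dd61536c16b485a9a08380000ac0275048c1010f00ad140da20467505f2002c7022fb056cb007320fa000807807030958a14ca0189f0430a09e3a06064147505b90670200ef001dd6ac40b076c0d6021560583b0e075f25b061a40703a9a5a81c0e9001d101f402073f88f0115003039874b03a0e54c1c95a840c4e8360e3001c5ab1c18070ec7607d1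40b03800418260df581bd69b41406ec0b9074ca0a8370706dead3004d609036805f0120d9681b19ac01b06bf27b040ea008358b628160d5001a97164133f8260d3001a5e29809068c093008be0703400067800054402ef05118013ce1602c263a047e4027c8129ec21ba03d7e033b61544c162e829d4016980ff4008b18456605d8000c2403f7857a709c8412e68213485af30328c149dc182e8298908de0126e020428083d0347a0104c005702a00060280b0242ac3852fe078d416fe827db8120c04ff8c20699209027804002a09d0013902f0013400e09b541353a600e04cc0a404158058260e6603a0974c12db2440f04ac08d0410a0d82519049c0a007166058248b2e82a091681216a8c0a047ce5003c4204023960e80808d001196bec0b6e02008b38115cc3804044c10b07862088220b7282a0870010d03e413042c04a071d2060211c041e708055ae06820951303608168101040c0903fce1e04dc60b01f8e2300007d000f9a8e8172a03407b640f5b4300e03ce6e805db00681e008902e077000ede3fc0403ac029039d40381d00039c0e003de00e01c9a8381a071340e1593018011f8125e4202204631035800034c023702afd061b615520166305231025fe16c2427a203c994083605f340bd019c1402ec05c008f2060171302dc09200ce40c8168b4b808059000b1aaf41d02bec5800d94038158e68024055700a9d1880c4f80a0531c0a5ca381a028c0c3028e00a01400063c81287c21e8053f2031fe16dd827fd8280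c017de158e017b1845050218000f5803a603e4f1701603f2c07da8d81a01ec048010a40f80f0001dc0ec068400800e99830200391c07101100201bec3905c800980d9c738360356806973c4067b02003300065695814018c02a005c80800c13023de1595c17e603f9c01580009800364044e4065ce161b02669850c3037f812414207c02b3d05cde15f20082603e0301490112b0032000294066bc1451826b5059e9082d4122ac0d3702a930212c0fb642b9702e8900580018500550044440b2341366419c885189035260a9b82435041ab

/-- Piece representatives. -/
def PRt : Nat :=
  0x12a00252004a00093801260024a004900091801220024200480008f8011e0023a00470008d8011a0023200460008b801160022a00450008983113042260444c0089001110622208444088880110062200844008880010f0621e0843c08878010e0021a0c43410868110d002180042c00850310a042140442800848310904212044240084001070020c004141882821050220a00410188202104022080040c008103102042040440800808310104202044040080031000420004400007f800fe061fc083f8087f000fd061fa083f4087e800fc061f8083f0087e000fb001f40c3e8107d010fa001f2003e0187c020f8021f0003dc187b820f7021ee003d8007a830f5041ea043d4007a030f4041e8043d00079830f3041e6043cc0079030f2041e4043c80078800f0001de0c3bc1077810ef001dc0c3b81077010ee001da0c3b41076810ed001d8003ac1875820eb021d6003a80074800e8001ce003981873020e6021cc003940072000e3001c40c3881071010e2001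c20c3841070810e1001c00037c186f820df021be00378186f020de021bc00374186e820dd021ba00370006d830db041b60436c006d030da041b404368006c830d9041b204364006c000d7001ac00354186a820d5021aa00350186a020d4021a80034c0069000d1061a2083440868800d00019e0c33c1067810cf0019c003341866820cd0219a003300065830cb041960432c0065000c9001900c3201064010c80018e003181863020c60218c003140062030c404188043100061800c2001820c3041060810c1001800c3001060010c00017e0c2fc105f810bf0017c002f4005e000bb06176082ec085d800ba06174082e8085d000b9001700c2e0105c010b80016e0c2dc105b810b70016c0c2d8105b010b60016a002d0185a020b402168002cc0059030b204164042c80058800b00015e0c2bc1057810af0015c0c2b81057010ae0015a0c2b41056810ad00158002ac0055030aa04154042a80054830a904152042a40054000a70614e0829c0853800a60014a0c2941052810a5001480028c0051030a204144042880050800a00013e00278184f0209e0213c00274004e0309c0413804270004d8309b041360426c004d0309a0413404268004c830990413204264004c000970012c00254184a820950212a00250184a02094021280024c004900091001200c2401048010900011e0023800468008c061180823008460008b061160822c08458008a001120c224104481089001100c2201044010880010e0c21c1043810870010c0c2181043010860010a00210184202084021080020c0041030820410404208004080080000fe001f8183f0207e020fc001f4003e0307c040f8041f0003d8007a060f4081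e8083d00079000f00c1e0103c01078000ee0c1dc103b81077000ec001d4003a03074040e8041d0003983073040e6041cc003900071060e2081c4083880070000de0c1bc10378106f000dc0c1b810370106e000da001b018360206c020d8001ac00350306a040d4041a8003483069040d2041a4003400067000cc0c198103301066000ca00190183202064020c80018c183182063020c600188003083061040c204184003003060040c004180002f8005e060bc08178082f0005d000b80016c002d0305a040b404168002c80058000ae0c15c102b81057000ac00154182a82055020aa00150002983053040a60414c002900051060a2081440828800500009e0c13c10278104f0009c0c13810270104e0009a0c13410268104d000980012c18258204b020960012800248304904092041240024000470608e0811c0823800460008a0c114102281045000880010c182182043020860010818210204202084001041820820410208200100001f8303f0407e040fc001f0303e0407c040f8001e8303d0407a040f4001e0303c04078040f0001d8303b04076040ec001d00039000700c0e0101c010380006e0c0dc101b810370006c000d4181a820350206a000d0181a0203402068000cc18198203302066000c818190203202064000c400180303004060040c000178302f0405e040bc00170002d0605a080b408168002c06058080b008160002b06056080ac08158002a00052000a0181402028020500009c1813820270204e000980012830250404a040940012030240404804090001183023040460408c00110302204044040880010800200003e0c07c100f8101f0003c00074000e0301c0403804070000d8301b040360406c000d0301a0403404068000c830190403204064000c0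30180403004060000b83e170782e0e85c1c0b836170682e0c85c180b82e170582e0a85c140b826170482e0885c100b81e170382e0685c0c0b816170282e0485c080b80e170182e0285c040b806170082e0085c000b78016e002da005b000b58016a002d2005a000b380166002ca0059000b180162002c20058000af8015e002ba0057000ad8015a002b20056000ab80156002aa0055000a980152002a20054000a78014e0029a0053000a58014a002920052000a3801460028a0051000a1801420028200500009f8013e0027a004f0009d8013a00272004e0009b801360026a004d000998013200262004c000978012e0025a004b000958012a00252004a00093801260024a004900091801220024200480008f8011e0023a00470008d8011a0023200460008b801160022a00450008980112002220044000878010e0021a0043000858010a00212004200083801060020a004100081801020020200400007f800fe001fa003f0007d800fa001f2003e0007b800f6001ea003d00079800f2001e2003c00077c00ef001dd003b80076c00ed001d9003b00075c00eb001d5003a80074c00e9001d1003a00073c00e7001cd003980072c00e5001c9003900071c00e3001c5003880070c00e1001c100380006fc00df001bd00378006ec00dd001b900370006dc00db001b500368006cc00d9001b100360006bc00d7001ad00358006ac00d5001a9003500069c00d3001a5003480068c00d1001a1003400067800ce0019a003300065800ca00192003200063800c60018a003100061800c20018200300005f800be0017a002f0005d800ba00172002e0005b800b60016a002d00059800b2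00162002c00057800ae0015a002b00055800aa00152002a00053800a60014a002900051800a20014200280004fc009f0013d00278004ec009d0013900270004dc009b0013500268004cc00990013100260004bc00970012d00258004ac009500129002500049c009300125002480048c009100121002400047c008f0011d002380046c008d00119002300045c008b00115002280044c008900111002200043c00870010d002180042c008500109002100041c008300105002080040c00810010100200003fc007f000fd001f8003ec007d000f9001f0003dc007b000f5001e8003cc0079000f1001e0003bc0077000ed001d8003ac0075000e9001d00039c0073000e5001c80038c0071000e1001c000378006e000da001b000358006a000d2001a0003380066000ca00190003180062000c200180002fc005f000bd00178002ec005d000b900170002dc005b000b500168002cc0059000b100160002bc0057000ad00158002ac0055000a9001500029c0053000a5001480028c0051000a10014000278004e0009a0013000258004a00092001200023800460008a001100021800420008200100001fc003f0007d000f8001ec003d00079000f0001dc003b00075000e8001cc003900071000e0001bc00370006d000d8001ac003500069000d00019c003300065000c80018c003100061000c000178002e0005a000b000158002a00052000a00013800260004a000900011800220004200080000f8001e0003a00070000d8001a0003200060000b800160002a00050000980012000220004000078000e0001a0003000058000a00012000200003800060000a0001000018000200002000000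

/-- Point permutation of the generator A. -/
def PIA : Nat :=
  0x3e3262802b2501354676ccab74094

/-- Block origin images of the generator A. -/
def IMA : Nat :=
  0x1230024a0049800900011e002280045800950011d0023800454008d001290022e0046c009080127002320047c00910012400230004a000258006b031fc089b81b4c83c460418002b4c087800ae104cf407ba8013a80aa1064d80491c192a00efd0783001bbc064983ccf070c2098fc19838106a02e240a2b8196f028c7028f8070640f2f024a50612c0d2f800168388902c4e0ca280f16034c501dc008964165881709064740eb58003f81e280391808298021d8165a052200cbfc1b868290503d5a0920c0a0f016b30461e08a781d7483c8d07846059e4091a8029103460030800d4d01a9f055ec07afc08660349504a1c0dabc0831004440115401c28161f01b03028b8050e4047c034b406862078ac0d480087101d3005124058301a4f041000c3700f6c836bb019700b8b815520004e000e60c30806438101d07da20abc41b240206f038d00015818380024307d7806398080e032f2045aa0d3b01d6501ca3010d20a94c086b80a8e02454012dc0142824920146c0e36c087b804a00420400a08051103678021ce0d07c047d82ca9010e400948037c8209b06cba094041610834ed02da007a181966832ac02c9407998083a02e970658c03204191983eda04dca0d374142803d11058c60c390116180a8807a1008108155b0225802882001901f8583af4018800a19c0164830eb0204c0f2f4144a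030b5040700697c1c2b8048f0745e0e38c0d7982ec10004a0a2e41d71020d803174042ac0e2a81a650747a013381a6a03cc8031dc059d8041e0166001626059441d1b8287b079a40c890166f8129d059f402bf0055103e32011d00c9dc121a0387d034360522c026200ca8030da089140f4e0124c06200020681f658207e02c520196c177a820b002e180e29c072681504055640fa101d0b8000f8b82364848750671e0a8cc017480ab50b71c09ca010d5007bf0331615eec07ab81ee306e92134dc0a0f82d0e0715010a6808ca050dd

/-- Octad permutation of the generator A. -/
def POA : Nat :=
  0x3aa647d1595c8a89529e2dab1e7b06c21a303356da5ed05b8ea9a70c7ece8a907a61d85d8055bd401ac8c1d9ce508a232f58a89487a8cc5e335caf789b3f30eb977c6ebd920ece81487c18445398aa8ea00bc245fb76d59675ea842d4be030474872f6a13eae1ace6a741138f2414b4bd0523f8f21fea4293774ffcb9b7c903de92905692ffb54712e40031a74dc12e5d111a94efbc100fb9c82eeac98d6798c7bd3858e2c58799036a90adf0df7e16fe1d798254d52a7b04977470407f28cf98ef636a87efa7df0125a5a645af47181361d089da43774d7540ac3aadfa70d3799f0e03d65c9ab67a13bc34cad6e9e7d59bf5bcedca2fa7b770637430a2b8b45f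5ad710ce1b4d3ff0c8ca4b655cdd1c774311cf43e8fa3fa459b803461b6d05ce0528e02696a708b9cfcbc768045f2cd0b31e77b970080035ec5330e307ec6ffbe697fc5b9eb167056f1b80781d7546f3c6080a7f725e4e8958467ccfeec93071a9d1386f5620834520b9284b4c1ebcc52700dba0e21db57195fe862e798c6ad917706dcfa4829189e91fca2f9320a0560099fb36045ed7461e0b0ad9c7213fe227215425746c4c8bbad2ed7336e795947910e81555e6d3dcf6b584d953738286cd571e1ca2ec5e19bb6444f282529993a4a6c60ae954d7075d0483ea4e1d2cea14fda3b41fe1246c3e48893e4908e94d4ca26146618bae439a5d54f1239042242fe750bcbb1cc265e0ab2a39a7af6f60b6f171f7f1594d09bdbdbdadea0aafe8d88cb09c0d3124e17162a993477215f49773a66beb034f56c5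

/-- Sign change of the generator A. -/
def EPA : Nat :=
  0x23dd07db42a95365770c286891f35953215d4f99869199a5bb4a28214dc006336aa2790c5f2405a5c660f514828be24d770a4b296eb336b19c1651fd043038b

/-- Point permutation of the generator B. -/
def PIB : Nat :=
  0x1833602d5225105bcad1c5c23ca8a

/-- Block origin images of the generator B. -/
def IMB : Nat :=
  0x11a0022a0049c00900011400254004a4008c0011d0023800490008f801230023200484008b801250024400458008d801260025000478006f0242a079b20a9e80b4381eb90454e011001a58034c8069e40ba4c09830251207138021bc0e2c8166c020c00698c1a1c83cf4018460d2fc19628204f068ca0baa81b1582ae3018fc09bac1844836ef018980a14807848224206564033a81d11022f10050603bd8027f81e5e014d6081501624038660115a0c0801e1400cdd0206a0034c1a5281d110647603b9c1c3d81ecc030320c1e0097c804a4079f80716c0f6780085039e600248148203cb1020b00e8e00d5001641015d20c090064503ac30292a02ae813288384a02d560c9881986830b606442068bc146a008c0001780b8600f6502230065660cc20118002474039c409204142e822f501c9c072b0091e83f0e0188a01a5c0c6802890060d00e1c0144e823100451a0907c0a0d832250696e0e9e4126901880018f808b840c2803cb503cb8002881d64802960657a05b04143501ea30161409408031f8049904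0ce0095c100e832840598e02a38047d814470593003ab80a7283cdb0251e061dc0343006910684c0c2300473006ce010a604aa007828370f01db80c8cc1b8181e5a041f0021c81b5082e4906862050b4057682ad6056020792c0285820430093e029d8156100c8b005ae029f40041022d800c5804390025d80f0c048c80f97c0c7b81eb4021dc0e8b8106a816be02d280f0e81d3481e440353c02c1c0d4d8263c050dc01b801a6302e34018e20e3f4022a8303604c5202b34000d032e8058380309c145c01f13000da09abc08440161e01da206368146f81646064ac0fbe80b1f02ea6061340faa40e2682c37018ea03bc00b6583aec07cfe070c80439832fe008c202310040b80006de8031c84d060650200b8c2cbc85458025fe099a810188430805f380fe780ab48351e01ffc114ac1de000bdf0393a12bec299b0296d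

/-- Octad permutation of the generator B. -/
def POB : Nat :=
  0x30f8d6b0cd818c72c5658ff2ef488894266daa99e71042d7831c72cc1e0523efecab45c79070c4c15b75e61f0002f4b160968ef0cc27e1272f5c6fc86f9ab11b0cc13d6de795bd696fcdaad6c003a76137427ea8516205ef5a19a66c917d302b7cbac711e80dd9a609d648494f9e253720e8ecb0da86c22dc81b225150c515ff92173e2476e2afa74d00fe3dda08d8e7e7f53c2db46aba02da39b2658a46607df9f408ee8b7d4b4564776c81234ee3f646b2209894e752ba7a403c43c161dc10c33ded97d7d16f08e366fa709c5b7cabcf4a18a1bec8ba09abb4a70e0835a31580bb6b54cc37cff15ce06e4c5a757336cd7c8b611018f8ffb065e116d0a6e27280945c941e25dc35fdb9a42074e4b673dc5c4d55ca299192df5ca02e821c07cedb9a6a4b0def44026698d7d45467ae3bf81c616f10dde45da8a6eb56f214426fd281defb081daef95392a93dac1f45fb3b4e79b8a8848192f3bca5246195949cd8ab1edc3cd1b82f1c7a0ab305dfa188aa24eb324fdca073ef352ccbbb60471232ced57274022a5545163ff1a49ccf2a766fc035a091867ccd6448cbd4dd860e07a96a1fd93241a72596f00e91ab6760046c7bb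865b77ba1751126adfccbda8d8e85349ae790a5b373bfcd934638d0f7dd003d441fc48577749f577235768ea03d831d861cab245d18bcb5464df09e4fd65a80c43b62758284237c2035cf69ce4fb6aadfa25d4bc798fe39cd7c82f41d71c4710969321ca8bcfc9a21bc7183474c7470de329f196afea855035c7560fe82a9b50958a353c2dac

/-- Sign change of the generator B. -/
def EPB : Nat :=
  0x157f53451e58b0e410578161c5b55b83986326036dad784419fd94a00cfae03cac80a676e2d677021726481aabe442a33376b2c4824eb2293be720de3b7d232

/-- Point permutation of the generator R. -/
def PIR : Nat :=
  0x2d5a4e5183dcd62d4941cc520c41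

/-- Block origin images of the generator R. -/
def IMR : Nat :=
  0x11400254004a40094001270024c00494009200123002440048400900011f0023c00474008e0011b0023400464008c001170022c00454004e0329b0252e042841a4f030a005d4600288065382aab0415206ab40157830ae0456a04ad81a59832b2019ac05354086a02ed00799e0b32c1f64820c50258408b001c5f03abf071780bae0096d818da01dc007370196e83edf051c40d3a01e73836e503dd60b3b80076810f203de6004480e8700d0f0462006c240b838290604e0606414197f01efb011f8083e4137b8283804478090ec121f83a400047c011041b2301a48018920912c0a2703c54048ac040d0101b02a3306856068b00a148242a0344c090940212026220383c01080110f82c1d034360f8640c0b83e7a07cf2089f4173f80e7c0250608a08194001e870311404a380d490049602d2a011d4143b01c74078e6079c0113582269078ce0419416320326305cbe0e180092e8225e014b40f1600d2b808d8001ae01364076f02ae4001c6013841f73002ec06dd4083a41678822f0025de004441a8982d0d03e180a42c0b8502f08006080a408078080500051fe0cbf4147d002f8075ec013d4057a0029a01d3a05264024c00a9f01550092981c52838a4035540dab01c5883cb005d6806b441969800d20419c0eb340266006ca03d8c083200463804c403d8204b0c135d00cbd00576092e4065b82e7b03cee029e0193f016810191004210194301485031160d22408478008c0651a0124c1048820900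45280f1c81e3703871070de0f9b41f360346a02cd00f9980c3101e61074b80a96c062c81039004740b8dc031e80044068860a1081923818450209a0b1301e2503052074a203140002782455074a6088d4111903c3102c60088b802178242d070500089c1311832210783806868080c01e000002c00054000a00013000240004400080000f0001c0003400060000b00014000240004000070000c00014000200003000040000400

/-- Octad permutation of the generator R. -/
def POR : Nat :=
  0x1f8fa82c0e090280c321d088541e2d148847e3b1e8dc6a3329934c25f379ccd66d32bc5e6eb76b95bae36cb5d9ac162af56ab959ac55ea953a753e974da4d1a9144a2d0e853f9d4eefb7fbe62f1383c2e1f0d93ca64b1b8ecc66b2da2ce677419fd3eb361b8dbec767b5fcfe3e7f6f77c3e5e6f4f8fc5dceef83bfd8ecf6fa9d2e8f4399cee7f2787c4e2f1f8dc0e16e8803a229189449209109c502894c9a4c2a964b05f30188c25c2f1a4d063381b0de753b9e4e8731b0dc6634188b8542b140903e20110843a1a0a05c2012070340e09060280c030100182bc5d31d90c66230998cf64b29aed368b81c2de6eb61b2db7438ddcec74be1f2f5783c5e6f25b2dd68b559ab958ab542a946a44f27d389b4ca4d208c47a1d128842a190882409f30581c05faf57bc662b1184c8e431f9bcce5f2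ba1cf6a34da5d268f5dafd6ea757aadcedb69b2fbfd7e9f1f7fafdbecf57a3cfe5f2787bddaebf4fadd5e6f2f95c8e0eff7dbdddef1f6ff7f3f60d0087c3617098ac5e271288c8641188e4924b2a9449e4722974c65b2c95ce26933b9ddee96db85bed569b1d92d167b2d86bf5dadd56ad52a8d42994aa3cf683409f4f180bb5faf97ac561b2d9ccd6b355a0d26a371beda73b89cce5723bddaea75bd1eef65cae164b1582b55ea953a8142a652a893a9a4c25d2c9548a51248a472351683401fcf47e3e9ec7e3e1e8f076482390c84542913c965b2d15cac5d3519ccc65321c8e26e369acf0761c8e06a32168c05e2c1489c4c251187838180d8642a16098441e0b040140801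

/-- Sign change of the generator R. -/
def EPR : Nat :=
  0x28878d78d1887a7980ef563690a7bafe7aec6586846cacade987396a45d21df42d54b8e58b02530af28327a715867fc23948be18157f25e2374695910bb8370

/-- Search tree on the pieces. -/
def BFPt : Nat :=
  0x1c8450c47410c931844194e7014e0ab98c656ac63e527b1f5635128a10c7be0eaba4e521eda51b0741c9ad5088c0426c66d6d96bb18d4a326c62671b45ee5a5367d5ec3422645d1664d959ca537aa928c5b16caae749759cea82a1f06b6cd9316babe6c6389384a139de948560954954b3df7939d2236374a612b462673df57c694a52727be4e8ce338ba556b570439075d26b6b1e8428f081e328c52d6314a5bc9522dce7be959cd33625e31c65084e12729f07cd8c736106b5eb31a499b8e774dce70a10ac20ea4290b22348c6ae9556b94a318c69552a57645e73b1ce741ce8c2779d2316458b5c61982a6a8a94bba9b26b6556b60a5368343e886b16f8be2a23c9155e0d6ceee746147be0773d4a6419092a0f53a527bdf183d739ce6bb39d56b16ba3a694b18c9c18a53a2e2ce65a3dad72aeaba20f9ced3335725c4f56519063d8d5ba4e739d1752052b2757bd965b166818d1635ee6b64e939759ce935b9738b9c752a2b7422e6c22d4a61083df46aeaa54a537bd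739ce6e751d18c62f8c9ea942316b5b06423094a518d19363d358429164d859ba8eac529ac63494a104b64844da08c2117ce0f6c9b0a1ea7702c021969128e321c663152569884414e711d2501c0099dcc6bdb47c8f093a4a4c48f7c5ea6c9cc24a2a8bdca6c22d245b5511919bd4a9b1cb5422f72deb645895bc707b21144dc3835f04ce4e7451012a42548ed62e113c1ee6c4d06c2506a1e98ba115cea85a18b72a655bdc9891b15a9c88b1a47b08e536696458a53deb3b4e7319f052d4d8adaf61a105398d4a1ce8252a7b9ad6460f9b98c338c97c1717c5ae5be06a31c653d6d8c1d35b1f07356f1352f346226250b1352f54d0b834d023dae7a1aa7a98e229aa4a5aa725cf8c5af921443c9cc68e0c1bdae441ce431303b2486350b48e30a42112ae6e9356c2b21072227421ac5cdab73d0a6b1ad71d4d8acf33ba2b442876c5aa639713bdd292cd04bd8e2d56e3314b73dee6255383cb103c00949122bd8b5b8af745ed73db28bce889d4f731cd4b9ee03e33635d134dc0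

/-- Search tree on the nonincident pairs (point, block). -/
def BF2t : Nat :=
  0x72101d00081e02601e0210009220218a26a100079e9200248400218a202188080085c84069a7948a200076198082501971d00000061a02286594072500079e9008a590002218090001c99a01d02001d81e75a78001501d89800086202458081c01e71488002066282275198001e72689c8a099d00044001a71465c70081d52201c85e02582679ca620008a47005a60004220227a58266400008167166967a10217629a002086580080081c74072100089c78078086079c84062175d858340d38b74db5c31b76c75b2dc32cb1b76d3501968031c01a88084002290002084078000086202202582486668002670095c96000096100064002170064082086571d0159a168001e74080081d02698001d02402095d8a549802182002182284070070001d89d680700821a2201944068085874070c82602102680075588091d02402199e01c80065d00071865870071975e00089c01e6210248247000208002a55808219805a17a682600089a71a01e71d76075c82201d88092671a79886292501501888059d0248808a272182285c22d031c72eb8d71b72c75c72cb6db4b72eb470079c60078002272682401e81c62289c7a074001c9009a078000084002502471c8a481e75201c02001c0150000207218629a264002680092101d02501a01a89c9009208213a099901882295986500090088089d88060081e82185d4403a466076601900076178001e00079500002694088082681c55e95601802251500002066501a00064070091d0218808265807805000006a102162401c89261e01e76279c01c74000098082161e020662825961a4069a8217a27a099c726020718235c80c34c70d74b72c75d2db7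6d34d72db582149e40084080076185e91d0188228207a68407948a602001a8a00005a296000000084001e8a082594086284080061d8a186259c01e80002401961d9247a08646658220223a099c8000007000008207a089902101500001ea0001c0256800008628009249620008548910009558a27a691502001c75d9560200009590248207a199c0008406210250008609264a56a200089a02284002175801e95e68068002685902299c84002102201c75e0219000007a16a07409a07a601e72275452dc74030e70c78a32b30d68c32d31a75c3100078060001a86588084081c60001e61c6a601e82072186672080086184002190069e02101675886101c9a092296260000095e65c88086092600082600085e80095c8408a261d01c71aa9a95902160002089900085580001d02501d56858085084001402698096601695901502189c82092201a80076074080075e0199400008159a48808007990228a175e60048089d72668058002662676584002178064076056201e02682482442178002190084095e01e000800761880022721714171cb4d00d74d76d2ec32c70bb6c3ac6ed3460069860071a75e00071e02289e71e0187a482102201d8208257a201968078002096064001e02184072180072681d60088081e02a71e02202585660090088000002680086229499d81c02189d76100071c84085901986102101e8612405a681c9a60148809a194091800079974050002279e8a081556201a60055e00002081e89900072102601d01d90001d72678088052169a78070000082601a5807a201900069d02271d7808a16a188094002081978069d8a5922020020880860860135db1d34039d71c79cb6d30c72c36d76cba8196a182001e9408a191d61a71d51e0200000190000007209809258a18a1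a1d89e7a484001e78076260079d70002170001e0007a580000002101e82181c8a182086501c9a52a199801d88000000072450085e79d99101d80002295956466485400000070000089d01e79578d84082082202291d89c66100e00088061102101c89d8408628606a08008210008203a669a61a79802282086076501a88001a0008607406400008a27227008a001a88001d79e8a16a182000084001e800018378eb4c34c40e75a36b36d28b36c35d75c3671878001881696068000082501c72200088001d8a09218648a20007a28a28a061d84075995d99c86289e74000000001e9809807a08a095e96672200085881e92600080094049c9408607409a188002180081200001d82581d9a06400214800148400089608a096085e94089501d62269d00078001465e01a7180208a190090074002281800082101d9266660253a57a16218926998006400000006805a574096264085e80090001960001401d81c99989e01979d02099e01c82064088042de35b76c76030b6ec72c2db70d31a78d3685d59c51c0228408619599208200008808dc6406188200008808a282786271882086199e78001e00002000002694001980082200001e7a095e01e86099e79d8a58a201b79d58000074002265d75d00000089e8a171901d70002475556748000065e71402585d0008207556997407228a101989c99b74094072001600094060001d90086176282088085d0009205a275a61571a01c52672572600e69e60075c00002102171e02662160069c01e70001d9967a26000006a2020500021800035cb5eb2d76d00a32c778e7a32a7096ed3992158001c61e9000227600007000007980229218a29657630008a10000248e472474095d89a86075e91c01f81e7627000210214998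a289e9e495e00082075d00086101a02101994071e80095902488002000089a7809279a09218400216a17c00228006247a496681a94081901d82000081f01e94001a01a61c02281c02201c01c8400007e58a20208a57a60226a689e61d81e69e02002271e81a02000001d00088085c8808e270002278001e69d81a89e02179f01c8a00226a201e01c029c31b34c70bec02ea338e39eea6ea2acb59217a051488001c00085e81d82282202059c94081c00082601899d71d7a172070000001d88000085d84079d621a0002102100079c88076294084072285e96289c86601e00001c91d02202285186452088079e79d00080002202495d3667a281876261002996286601a91989101100000088095c85864094081c74061e0217000000207a57226658008a07a600000000002179e01d61d7a464094002288054086088076086202186582000084002185d99d7a175992202001e88001c75c474bb5c32eb6db0b00b2ed669aac2ecaebb681d72040000065a71d65682002000080089c91882089d80089c00086000000082189e02169a8408628209618a502601594085a0007a288002091d9659228627a486602102259c9a40000160157657247240008407400227229a198060002075866280002699c9617629580008008209a101902201075c0127000227159a102080001c8a10200007618618a600002a79e0007967a698002676279679d72264084002685e8210259407209808007a291989d0000208000007008a284002232dd71b34c70d70b32032c6caaabb0b76cb291d00051c88001c82201a72200080069c02001d7259228259610257647a69800240219220169a079a0200218a686441994001e6a0700722a0082176199e0009800008a180049c0008589409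5d85d82574075675500d02570088076154001c02456661488001c0009209800117997240008257a089800075e01c74080085d01a71d94002070085d91982176600068089631974078062102265e6007806808a181d02284062002188001c89c8a290094089a8950258240009a2700840980335cb1c72c74c35c72d80c31b6ebb2c72e7501500002001282082196202285e81679c7a085580002400001c9a60216a40247658a191d85a01c01e022840862a607159198e002278001a00074050084064086074091b8214a19a101f71e75500082202201d00001590072196271d4407207dc7a401492400002588085b00089d60070078086191765995a01801a81a96184000094081c02498085f0259407205a101e02081600001c72201a79a9e20227646de84002082001e0000007806e279975988076149f72189d820626640000031d75c74d70c24976b340278f2a70a74d3581d62060001a02700089a92001c8216a000001a00082501f9008a10007a48640267a201a84001886784089982102000079d8e255e02202294088081e99e8d68a496271b78002192084086201f76571c82479e01e9407208808400210266a46e086290082096186100000059b75d81c99a89d68074002295601c762000840862821a5e85d01e00088079d7a28255a179a01e00078002180002101a89e7008658400008209258a68007e402076002185d99a0000000220207a202275d80002fdb1b36b70c2596ab32ac09e6b2da2ec370007a101c8008627e202192180080001468081d89a82180099e78071d02580084084086201e9c085e02074000086001976102676502401e9409208219620000209a58808210008a175c8607407607217a495501981d81d88090074056169d01c85e7009a5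84076101e84078094082092378078084076674071c76201d8a181881985c8407240009a17647a18a201e00071901e01a80076072474085c02201c0268e28808a076576102288002602102200089d0238c09a174078000081c02dcb1c72c6cb2492abb29e702aaaca6ecb301d79c02099d9228a28408408a260079870076184098062188002502580095c86202294080085c02182569d02696151901d8000218227808a18000200208807400266190260009a080094085d8598a202274065971976101ca4081c36500080076601002402484071800d02199d98080001e75891400085a61c65a01e99d71490089894076270086102502891c02288051d8000217007408667008a28a102065e66194086192501d61d02076680081d0220008a186102400002675d000274cb6db6db6c32aaabb2b2aa80baecaecb602101c71881e72301d76280070081a78002080090002181b7a089994001d02086098075d8008a064076079701c96181f7a570001882180096285870002201d72002500074039e90099486200002160062101e75581985902298001d6600255c07405109808a101c02001489965d02678089f98001366195250074079981d94072001f7606c002181d84078078002201a0257a648072102001c01601c89e0217da01e7e2a807250217a59dc7e58800119000216806409a08a680084061c033e76c34e75d6592ebb29e39ee031a35cb600001871875e01e78000092181986670002172181891970089a9a181e02696200002085d7a27408a58a601d82100051d85d78069d00001e82096000095699e0009619a595e0000156207a28408400296a19566809510219199a092200002274002271802286185e90001489995900099e88000071c76285e50056289a0196200217597a68007a1700000000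0224a179600085c69d0007258626960006228608809610000228a97200229a00008a186189d5800008648a489800056500036ddb5c76d35c74a6ab32c6a9aac80a6ed3681c00061081694079c98000072601a7007809806a000072202201d82384002182201e9407987a000082101f82086060099d0216a182261a96784081c9600000247a07006804808a070085e00086086076081869d78076261c8a10000275a001c86281872098076094001b88070091872088071e79702084001485a7009407186a19a28800228219008299619210008a260001e6a072002570089e00079a8407e585d0220000000207c07a07c000090085c79901f82184002689a61901c02dcb7b76c70ce4a6ebb28e39eaa7102ecb794069461c8807608a000090070071e02079e9597009009000209a690076002402576602259e02270088001c01e00084088092174088072602401d90098078076074001c78002289980084078065c824020640019899661000aa680076602191c00080c80092002280085969501901c01e89802601874084041e85e79d85571c98092285c99e01d96102502289e5a201a41d0007a172574056071e81a02675d01e85d96682580070050089c6408a590002179d7800228408808a295c790279cb6c72d76db6aaecb2da69aabaec40cb581c01c01881e7a001e88071960001d01c8a201d0009a200001c98086162088000082100085e69800072082186271c81c0218a27606a285e70001a72400076002400071885d39801d01c01e89954002061800059189d92589c86201c4626a2000026680924a4096571e85501985900086201d78001900075c80064001e85d80079d74002402575d0008a176202200089e50001a79e0268619407528a08a16616a2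0218808009a191d51e0208616190150008805a20208807a482102185c374e75b36db0c34b2eb36b28aaabb2cb603670079851472200079a75e01e02272175c8a08a101c90002082179d88074098082679d0197808807407a284098080071d79981e5809268a202299a01e01a01a82694081c02548000099c99e02166182501c02184085984090002294056502471800095082100074080099989d81570001d01c88094001d65661044069694002272001d99e86278001d8807807264a201e60071e68092254090078000085e0208808809629620260250208188a402084001e8996a174086485e021020718031d35d32eb5d76c32cb2c70baebb2c76d40

/-- Search tree on the heptads avoiding the first base point. -/
def PARt : Nat :=
  0xcd90cb70cab0c4e0c3a0af50ad308e8089a086c0868085d083f083d08310828081f080406fb06f706e206d106ce06cc06c506c106b0068906860661064806160613061202f302ee02ea02df02dc02d502cd02c902bd02bc02ba02b202a802a2029c028f028b0283027c02790275026d026b0264025e02560254024d023b022c02290222021902170209020701f901f801f601f401f101f001ef01ec01e901e501e401de01dd01db01da01d801d201d001ca01c801c601c401c301c001bf01be01bb01b601b501b401b101af01ae01a901a701a501a0019f019e019b01990195019401920191018e018d018c018a018701820181017f017e017a0178017601730171016f016e0169016601650160015f015c015a01580157015501520151014f014c0149014701460144014201390138013601350133012f012d012b01270125012401230120011d011c0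11b011a0118010f010e010c010a010801060102

/-- Octads disjoint from the heptads. -/
def HOt : Nat :=
  0x3e7f1ed733519dc2e0ae56fab5264f1980bf5f0ea68331429f431e8f26d2b094440afbfc3b7cdd36830b82b9dc6a94c9546a08fb7b3a5a6cb50279047b3b1bcaa270f82bede7e66ff67a5c7602ed65a5d066d27843fdf0e667af96ea5479f4ea661d8d84c12f3f93c3dedcecb5baaa35127f3a8b44219087c3c5dcec5428d3e992d9589e0802813cde1ed7436fafc65feef6ba1cf2471988425f0ed62b05549d4ba3ccc5e2c8c85606e8f3791c6cde5afb7aaa5467d3b87c2a0b006bb4980bc47225048028920821b0b80bb1d3e16f33595bedead96ab3586612d93489dcea7439166af54284ac401f0682c02fc7dfa5cdd167b1388afd668f459c4d61f0773b8d80ba592ad2a93381acae281380fe5e5e6f1b61a4c7e1ae959a9d02671a8a3f9d2e666b1956a545a10f0611d8e04217ecf2f8bbdcae4f157cbc5a6c15d9a4c2511d7bbb1cae05a2c150982d934861407827dbe2e8eef5d9fc75faed68aad0e732388c15f2e6693196aa94b204e45e260b04210f9fc38dc2db6bb097eb95b2893f99cc600fb7aba590bc5c2bd067a3b9b0943916021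f0e971b75a0ce62af56eab51a71228d419ecee6f31988ae4f1d8dc562411054220bf4f7b89bfd3677097fbbdc6ad4d9b4c62d0b7c3ada6ce5c2b9248c3217c74240f01febede46f765aac6602cb5da8d32552088c25ccda6ab3544984ba38ec711e8e060057c3b5cad96ab3184bd5b2c144994b231027d3a9c4c85c2d9407837178943a190801bd9eae971b6da1cd5f2e95fabcee5b288740de2dd6b2ed56a845200d868278c44018fb7bfc9e2dbea751a0aad26913c8943208ff7c3adced95aac9409c2b94c7e190701fedf4f4f9f2d95c5e2aef75b459a251083415deee6d3651c8c3f1f0e25e2e8481e00fa7c7a9d0d467b137cb1d6e913a9a4ba210e743658abd5a2cd288a3a158a8280e82ff1e2edf0353a3c8e12d762a6d0e71218bbede0db69ae962a946a0cd253228c83815f3f7789bed8eb7338dbadc2ad4b9447606fd7238590bd5babd288c3b958a02310027dfeae7f175da4c761ae163a4d125d2884405eae06a2ed6c9c489f4c0561f0dc4216f9fb3cde1ea72f93bedceb3479dcce53097c361a8c0562691c803717890381a0881bc5e1e572761aecde6ac5619e4ee6d3385c21deee6bb593a9c4220ce64c258984800f6f97abbdd8e8b1b8bb4d9ea1409ac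7e15057cb619ec2582952a7e3a93888301186ef173aed62af529f4ee733390c7a29117dbe8ec7330168b0401f0e468210e0602802e9f3f8fbbd9eaf479da9526873c9b4b2451e79ba9c4db4921d027d399b8ce130701bf3f3deef34ba3c9e3adf6aa35123f1e8bc45c2d86ab5162af43204ca50268d86804fcfd7b3d5d66af298fb3d828f4590479fcfa7b3c1aad3582b9168732118841f0e00fe5ede571f439fcd656bb58a9d425f2c83409eef360af954a547224cc52260d46202fb777b1c0d7ea32388bbd6ead4197c9a0f027538996c55ba79267c3794c92350f04febedf277b3193c5dfeed6bb05722f0d833fdeeed73b7d2687409f0ea703497c2605ea72f8fbbcb63f0d7abcdb6cd5d9ccba53207cbbdd0dc5b2c1549d2c12c883d0b81bd9e9ea6ff65a2c6e32e95ea5d1e5729883f9dee36baf5729947a00f05c289086024badc6c35fab52a913b9c4ae4d198843200fb3c9bcd45d2b9508240190b4482006823d7e6e7f23739fcc5eae55da94fe612386c05e2dc6a30566a245204da6826920721df6fafd5e8e97478fc5bcde2b959a9546813d592c144a04421d0a82198c4421f0c807edf1f477f63afd2682eb6db2d666b2e95465a4cc632f5228f411f8ae51248f4200cfcfd391c4d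c6cb1585b8daa7d3a984adfafa7b3c590c35c2d10c80389b0803c178abf3f6dfef35babc5e16bd5cab546552286429cee4663253c994aa48e26b231046c33fc7d3a1cdd0e831987b2d8a833b97cae29126eb698cc35cad51a89391bcb4591409be5efe7f376db3cde62ed73abd56632f85c1dbedd5f2e948a042a0cce6324114421eedf6b9bccc461eff7eaad4e9b4a81401fefc693459ece4220cfc7c2c95ca44e05003cbdeecf334b9ecc636e96fa2cfe693181bf1c6e06a339489f4a22cea6c238f06e2af277fb5d2d8ea7137eb95a68d3d91c762f0e7abb584bb54a7d288835188ae4d1b8b7b1d3e8f3771b6d86aed162afd720d027dbe9acd165b2570b5592b8d267309740e02faf9babc9d9e972d8ab5d769b3e9647e16fc7cb95aec35ca912e8139170a43a0e04befefe4eeb73a9c3df6e76fa34ee712d80bf1eaec61b0168b3419ecf26c218fc680bf5f97a7bedc67f2986b558ea13d9cc7a1d0379b8194c8582852c7a3a1849a4a12863e5f0f6faf85c0de6ee43208f46a1f0d8541dbedc6db619acb653245c2c1480c0401fbf7fb1bed66932387b658e95459a47628fb7b385a2bb55a851a8636194a84911052cd60aed6ead50a752e4f228fc7a2d1086c24ea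74389b48e42200e86a2e150240c04f6f77abc4dc69b2780bc5a29d419647a25047839592be58a792c853897cb4451183bedf1e56eb6faac45f6c35ea9d324f1a8843dd0da6833d469d4aa24f06f220fc5c0c7bbcdb8d86b34580bc582ad52a445a210681381b8d0652712c94431b884381a0b00bede9ecf175b9ec7e02e15ba65026b298b411d6df66af56ca349a14ea632a918520ff8777a1bad56872382b65629d3a96c8612fd7638594c158a61147a379889a40168476fafd368b3394c4e0af36db3d7aad4ea44f5e0eb7136da0ca612f46629138541a06fc7b3d1dfedf2f95babcda6cf58aa52a8f3b5caad54984ba21087b1c0ac381b06833d5e8e170361accde66e16dabd5253267f3edc8e25e2e95cab49244dc6b2c1544801f97c3b7d9db6d32390b3d92813d8ec6e07027bbd19cae55a4d20622f9288a2711807add4e06fb69b1d1686db6cb15861f0e8140194c662ab556aa549e0ee5e2e86c3400f7f8b9dbcdce9f2d84bc5a2a3449848216fa7737d78b653a49027634954862f0f83bc3deed74f5da9c5612cd60a7d2673327e3e9c0d968acd5886409a8c854258e46404f4f8389c2db6b73790b157a913a9c4b6250f793b992a74d200fe7737954a6270f02fc5e1eb7534fa4c7e3ad769a3d1a6b347f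bf1b4d96aa99468f469c8e044218e06e00f9f7fb5bed76971b86b6d9e9b439b46e2afe7cb797ead5323d086e32140943711057e3e0e86ef5f9fc95ead55ea5d06591f853f5d4de652b536893f9c4bc501e8c03a127b3c9d0e466b297ab055a6d309548209007137984ba5a2c1248435188a0460f0680be1e5e5f17639eccdf6e758a9cf65d2683c01eadc682ad428a411b4c64e238d44014fbf7bb1c2d869f2188b7d9293449b46a2aff7a37da6ac51a2d066b3394c8c361105be7e6e770367a7c75f6d958aa50e5f1a8a405d4dc692b53a91419d8ca521e8e04c11fcfb3d5dfcce37137aa953e8b3e994ba451f6a33180b4582853679371a8b81806827f3f8fbfd72792c8e42af54a9546612f96cb18ec461a79369a4c1a4d0673280c0401f2787b1ccd1e87318eb0d7ea74991c86290779b1576b559a0cf4743811c763417023b7d5e571f3796c5e22f173b2582713293489d6df6dac95c9e4d138963f1d03c1a02f9f8799c8d5e9f2f7fb559aa13f9b48215067335d7eb84ca2d02782f148882e1286bd5dfecf2f65acc360ae971a14f64b198b425d2c85ea893e9045190c0582a0e45609f07779fced7eb70580bb5ca8943954962f157c31d88a25024922622f94ca02c14807abd1e3eff6fabd3682a14fa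14fa732b93c65dee66f25d12843f1cce264308641a0a7c3b9d4c461b057cb85aac55883409fcf876399c4de48208fc7436190b8580a0280bd9e5e971755a4ca616d365a7516572786411c2d55ead13e953d9d0c05a1d8d04019dcecf4fa3cc65f1985b7daebd5ba7532833a7c39dc6d569b1d862e148783a110700fe9eff3777318ec25faeb71b2d6e2f09823f1f0ec72a511a863e1d8da63300502008fa7c7d3e0d96bb4fa0aad32853f8ac2e02fc7c3a5ccb6562993a592892078170902fa1cfe4f135da9d2e8e9d4ba450a632b92c8df0f16ea59287f3d1e4e6602e0602a04fc7cb95bfdbec31980b257eaf4e92c862d0c7134d92a04d24d0e7337908763115817add3de6ef2792c5e26e16db458e6b328ec6de4f06cac960a95394ca049230582601f9f8b9dc9d569b2f7ebad7a9b4695caa24fd7c33d84b15325cf6772f144822f1306febdfe8f23699fc962ae959a7d1e691b87419dad15fac154903f1c8d0591e0c05017f278badd2d1e8b2f94bb5c289409b4c606fe6c35992a74ca590e773591476371481f69acd3e7b318fc25fee56db1d66ab49a1cf5e8e96e34596c55d0dc52250f84c2007fa79797beda69b1f81bbd9e99419a49e12fd7b3959cbd5ca98fc78331487a3512847e9e7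ec7136da8cd61ee764a9d0a67278b411d8e0672f9589c3d1bcc2541f0a8400ff3f83add0dbeab0d80bcda685409446e250e793bd8cbd532712c663116c983118033f1f5e06ef61abc5e22cd61a7d2a3f188a445bcda6bb4954a5479c0dc49210d86402dc6d3459ecce5b037c984b2532286c2a0d03582b94ea4462150035198783a1a0980f71b6d0e7f2791c561e71328fc621b0782c0166af54a91287f3e0b45428118602802f577bb3cfdcea7137cbcdae8f3c94c6e2b0b7a3ad8eba53a690e682e16c96371582fd9e8eb6fb57a4cae06d568a8cfa592888bf9dee46b2fd60a53e9c8ca5a1e8bc4c1bf7fa39dc5d9e773381b7d9e9b459ac762eff75b9598c75ba78f66b329388a370f84fb5cee3ef72b92c5deaa34fa34f22b0880bfda4cc622fd2e884096c98441f858240cf377bb5cfd2e773591b2562af4a934622f087bbb188bb5babd06793711c743915827e5e9edf035fa6cde02eb58a5d0a671884c01f2de67b19729d471bcc6581d0b04615f8faf7bbcd6eab057abc5d691429ccca0b047abc990c25b2d10471368fc7c2d16013d7e0e9f1f6fa8c960aef60a64ea61208b419e8e865b05589a481c4be5b230cc4a0eecf5385baca6371386b85a6c9619c4ce43187abc9c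2d855aa146542591c84180a813cfdde9f43519fcae4ecb5ca953e4b1988c31e2ed622ed6a863e9d0e2491f0c45a09fafa7a3bbd7e832d8cb8d6ea548994961afa7839d96ba4d2490a712e160903214043e1e4e772b739dcbdfee55faa4f25b2687c09e8db683054088419acd24f208cc3c1af3f838dbfd96c33590bbdb2a94a9546604fd7237988bf5c2411c78379649e2611033f1f2e36eb4ba1cbe42ed6ba34fe47188ac3dc6d86bb3d5a833f9a0c459260e06005ea74b91bcd8eb3499eba5c2cd5c88c360afa6a33590bc582a13274381a8ba1408023379ac86371187c0df66b3497cba53288dc6172b756aad4aa44d85c2c12078301600fcfdfe1ebe471b7bbab2582bf5ca9d429f4a542853e954822d10391a0b4540a0280bf3ebeaf4771a9cbe4ae56faad3665318ac29cedb613014e813f99cbe4a1e09c3e0aec75b95c5ca63f037cbcdcec76297cb6431a7a3cdd0e2592ad385a2a91486110700fb7d5deeeb2590c561ed96ab458a733390469ecf26f36962ac53148984a2186c2e02f679799c9d9e8b2f81bcd66ab3c9748e1d0179b75a0c056a2508723314488370e867dfe4e6727719dcadfaf15ca84fa632284415e2e06b2f95e8c409b4d44e208d04019f4777add2da6b3197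cbbdc68f3a95476250c783b58ebd4c24d1a692e9549e331781fd1e6e772f69b1bfdfaed74a04fe532885c21f2f75faf1448e46198c651278e06e00fbfc78dc2d96b70b7db2d6eaf4b92c62290771b85a8cd4da451479379207c3615023d5e0e26ff51a0c2e06c759a2d064b1b81bf9c4dd63af536853e99cc2461e09c4407ed72f93bacd637157aa850a7f1087401fad067309829046200fe5b25928741a0682fc9e3e572745a1be5eed769a74e26f12883b1d6cf672e56e9449998c647228803c00ed73f8fc1daebf519faad0a7b329749236f975b95c09446214fc7536998be1309027ebe8edf1f61a0c7e02ef68a1cbe370b7fbddcad1622b1388d3e9d8c858248ac420ffcfaba7c4d4e772982bc592892d8ec31f6f27235988b14e220f6733216c942f11037f3f3e16eb73b2c15eabd5aaa482391589b79b6d769a753497491e4e6401d0e46404f7fbbd1e6cb656f97ba94f2772f9749a48d268aed74b3592a95272381a8d21409803e3e9ebf0b6b9ec6e22db66ab4ca390a803d9bccb642b942903f1e0c254230a84e17fc78babbbd9e833780bcd7aa3358d455fcf26c35580b64da44f6732e1687e3610857d9e1e86eb65a5cd61ad55da7cd24f1480bcdd0d561ab1368b3e9ccd05b210ac4411f7787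b1cad5e772b83bbd82953793c31feec6d34d86b14f25d0c763494880341303bd7e4e7f175ba8c9e26df64a74b6450781bcdb0d05f2dd36953f9d4c45b1f8c43a16f97afcbe3ecf5783babcdcebb5aa753284b95a26d348a44a150030150a04e180b80fe7e2ebef357a4ca60edb61a4ce635137dbd5b6d2602c94288421acd44e220d03e1bf8777b1c5d66773185ae55e89308f45a06f7723357cb85122cfa763293c763512847e7e5ebf0f67a6cce16b54b9f4c63d0a7f3e5ccd4642d94492429b4c0511e8a43e10f1f8ba9d2dceab197bbcd22772390c4e1ef574b1974a04ea45146330154a23814823dddee66ff6ba8cd622bf4f9e4de4510833c5ced761acd34893f9e4ce59240a83c12f679b99c8d8e872b7db2d2a8d348fc41faed71b3186b74c254f8703293c82350e86bd3e2edf476fb0c5dfedb47a04aa411587bc9d2c25e28d329044190ba57258c85805ebf5381bccce5afb7bbad7ab7389ac7e38f678385b4b95a279305a2a9007a1b0a00ee164ae55a93459ecca63258f45e0f047d9d4dc643095c9c491d8d8582310854200afafcb87c1d2e7f3191b750e83258f45212e66f34d96b856218f4672f964a4391502befebecf4b6da9cc64ec7449d49643047d3c9d2d566ad55896469a0c4431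e0a04205f8faf83bbdbed71386acd3e932591c5626e773355a89f4ca3d0e753a118883014813a7d0e26fb3591c55f2ef6eb14de59248dbc1dee26f2e55caa4d160a842200601a09f9fc387c0d8eb3077fb3d5a952a8e45e12e370b4d9ea34fa4d1e783591c763814823efeff577b6dadd467ae571ae4ca61268eb4598c45e24118823e15c9e481e0581e0bf477787bed3677077eac50e7b248cc09f6e26eb1976a04e210f4663011476261001ff1e8e8eff5fa2cde2eed4d9e4b23712813b5bad6622dd528c3f9b8b857208c4460dfa78797c8d56932b7eb654e77398cc3a02e97434582b54e22104762e93c862f12867e9eef1f87318fc65f2e96eaec5a17067d3c5dee6702590e853e9d0e466300641c07f97a7abbbdbe8b1f88b5d8aab419b46e0cf36cb398aac52258fe753092c842e14057cddfea74365aec55eaeb6ca34ee511888bc9dcc45e2a53091469a0b858280c85e0bf8793b1bcdc67b2984b7d82ad3a9c47608f66cb3984b151a54f8772e938862e1286bddece571773b3bedeebb5aabd4653228437db0d76a2a14a8b439c0d647220e06803f7f73afc4d76833787bada29b3e99491f6ea6f34988af4f2490c793394c7c361304b6bb1d7eb71789bddea53268e462210f86aa9509a4c24d208e450cc6230168301201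fc773abc1d4e972787b4d929f459bc6dfef37035976b252a1d0872339308a3410863e9e3ebf2771a6cb612e762aad227324803a9b6cb60acd3a893d1b4bc52200b83c0efa797a9c9d56871d7db5576973f99ca20aee6c3357cb652259007731968862e0e847eff5eff73b7d9e0ef66b328e4622f157e3e5eadf6e351a4bc5d0e470210f85c2801f878f97cad569b2983bc56aa14099c822cef7232590ae5423900782e95480331006fefeef577365b0d2682a34fa3cee270c7d3c9dee86d2d164a84d154a8461f05c1e0cf3f93b5d3dbed71783b2586ad509bcda04de6db3d92b1579fcf45f2f14c982d16013e3e7ed6f7639fc761ad966a9cfe691884bddb8cd62ab146903e1d4c450248b04a16fcf7ba7c2d668f2389b957ead3a92c3606ed71b298ab84ca40fe6e3414084321106bf3f8eff73a5d1e370e572a92c4e22fe7dbc9e0e16f32992c8630c05a271186c3001e873f83bbc9e3b017bb75aebb5b97c8630ee7637db4b3562753453260fc7c1207012e969b2d76a74fa14ee5d238c44211057e1d4e0632e15c96481f8c45628108641e05f778f97c8dce7b2d7fb8d8299478e441f8eb73b3184b44fa5cfc6d3514488330f867cddde1f0347a1c65eeed6eabd2e591186bc5dcd764ae15e92471a4b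c41200983c08f57738dbfdaeb7378db256a854098c5610f575b419ea04fa10f6793595ca22710033dfdde96f371a3cce16e563a95225b077dba9baca602d55291411dcca5a208bc3a10f77b391c3d66af1985afd66a9528cc5226e87132d94aa50a2912783a1007a351980fc7dcedf476da9c55faf171a14ee491285bc5d8c460a813497471a4be59260e45a05ec75f81bec7e3b0983b85bad1669b4ce3cf97bb81beaf5729548522711c8a1409803ebf2e3eff67afc45fecf59aa53253158538db8d0662893690459d4dc481d0d4560af2f7f8dbdd2e7f0f7eb2d62853e94405fae56eb117ca24da08f6653112878231082bb3cfe270b3391c260ae76fb1d6e65308f3d9d4e56e2d958a44d960a04a1d054220be3f1783bdc360f0580b3d92b55893c7a34e471385bca550a793649230f87a0c04807d3e7ef7736db5d86baed74b85ba4b1b8c3198abb5d251268f46964ae54298200e00f8f9f99c6d76931b87b55869f4695c3a0af26cb5980b54ca54fe773095c78361105bafcce1efb71abd1e8aad4da2d066f2b8fbc1dae76ca511e863f1d0e46a2f04c2007f4f8fc5dcebf579b3899cc65705823f1f4e77337db4d769b3d92361a0b8540802813f1edeb6df5797c959eb343a0caa35027fbcddad5652d5629544194c4491d894440af9fc7c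bdfea723753995c8e3f1484c01f8f674b8db8d5653098032170a038150802b99c6e1ed7639fce5dae55cacc2a0f0381351a4bf5dabd5aa5509b8d667328582601fafbbd1dce6f0f7f74b8d96b957a55167cb9572953c9347214fc351508c401407827ededf478b9bcae06cf57a6d165b1f8cbf9d8e0632e9689c411d8d45c240e0642006f5fab85b9cf6530b73afd26913191459f4e97434180b64ca2d00733092c902e12067b5c1dd64b2389c45bed767b04de691f8e3d1e6dc6dacd5aaa509489a47220682603f5f838daace65f0b6aad546892d8d44e02f1733257cb550224f473339307c341303bedeee3ed76183bfd9ab953a4c9a331684399bed265a813a92471d8da481f0e45808f377f87b4d7e672372b8d529b248e401fae36eb1d74b956a51147936164a2270f02fdfdce96b73993bdddacb51a34d6511282bc5ced463ad14e94429c8b8511e0c03a12f9783a3b4d365f1979b1552872c9042dfce96eb2982b851259007334160942f0e047e7ece36c75586bd586b150a5c8e331184391b0d0652893291441ccdc411d8c45806f3f877da5d0e2afd74b4d42953395c4612f776b599cb858a591a642e90876230e0179fcee4e6f337bbd5e6f15aac4b65928923e5eadb6c2bd5aa953934984a2286c3001f1f8775b7d4e5f2962afd1e753795c4e1cf474b4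d9ca64fa10f47836164a8271101fcfdcdee933983bf5a2b944a04aa3b047fb99c0c85fa993e863f190be461e0943e07ee76789b2d2e43016ead55e89339442dfcec70b4d8eb953234f66c301548a3813047efc5de6e75989c1582b752a4c9a4317863a1b8d56628d3091441d8e0491f8c85606f5f93c7b6dae7b3955a9d027f0f8741a0af57a381beb3592a14e4c2591086170b003bfd0e0ea74192c15e6c752a1ce6491380bc1cad563ad14c97431c8c04d1e8bc3e0efcf7bb990c6e2f154da551e8d389bc7638d76b2fd78af572a14e6c359a8d21b0d003dbdbe76d35f96c95e6d755a64d65f1287b95b8c260aa530823e18cc4431f8a03a0bfa783bbb6da67f396eb65a2c73097ca248cd65b218c8e4521504582a8f87a170a007edd7dded7459bbddc2c34ba44ba450782bbdc4c9632c94a89429d0c25a1f0c44018f0f5ba7b0d661b076eb651287219044e22f77a2fd76aa542210e693413498391c007e1cedeeb73990bedbeb54c9fcc2390a7ebb1becf5f2bd3c8e3e1b4be521d0a83c12f775f83b3d063f1173add268b2e93c51f8eb7134d74b94ea3d0879301508e2b12057e7cbdeecb498dbedd6cd4a9f4ce4f087e3d9c8cc5e2d9468b3d9d8c84e1d0d8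480ff478bb98bc1e02f778badc2d31788c3210f9783bdd6974923d0e6a32180b80903013cfd8eb6873993c85bad5419d4de690681b85b4cd64aa14a95499e0e846210c05403fcfc3b3d2dceb73378b8d5e9d3898c5e1ae36c30978a24c200f6632e10474230e017f3ece1eff4b9dcbd9eb550a74de59037ebc5dac75fa893e9743998be5b268cc6009fb783adbbd869f1976acd46792f94c3e0cee743358ab54ca44fa703413c90310e85befeee2f07519ccc596b353a64d25f017fbd1d8c75da813e9345198c459278e0560ceb73b95c0c862f0177b5d9ebd36964a640f777391b0b758a8d305b28108741a0881be5e3e8f0f6ba2bfdd2bf509ecc6470d803e5b6d75d2b95487421b8d44b238e43818fbfc791bcd3e732572b651a752a8e44e1ee76d34996b559a18f8692f164a63216823b7dae772f0983c15deeb6db649a491d8e3d5e8ec75a99469d4e158aa54298301600fafa79bc0da69f2176b4536833595429fcf671b3578b852234f87732940783611843e1edf2f8fa5cde470f71b4d0e733197bf1c8d869329489a45218e0681f0e06c2803ebf5793c4ca637036fb557ab5379b49e44ef75b81b2b65a29d4c5b2b118881207013b5d0e4efb2b8ec3dd6d361ac4e65d278fbcdd4e56cadd62a94e1689c491f8541a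06eaf3795bfcbe430351a651e811285c19fed66730d7c9545a00f65b2790c78190781771a9d46773191be5cee360afd4a9d459ebcddae56eb459cc3608d456280e0641a0afc7b787c1d9ebef765ac54a9d238fc5e0ee76db499ea04f25d1279369047e341682bd5e0e9f476baebd5cadb489e4923313873c5dec85fa9d3292461a8bc56288cc5e07fa79b99bed767f3574b352e7d2e8cc5200ea6eb458ab852230fa6e30960903512043edf4f7fbbb1d7e6f334fa4cf6730b81be9e0ee6c35958aa512789848200f0200e00fb7839dc7d366f036db455681368d42a04ea723417cb64e231047730938942c1285bc9dde9f3f6d84be5e2e1489ec9a431686bdddcc560aa538964618cba58258c45806dc6a33995c961f033796c923b1287409fab4592853c9544a08fc331689c401b06833afd4e16ef5da7d1dbad563b145226fe7d35da8c05d2cd5aa7521c8d868338602e03f7f7bb1c4d1e4ef970add5e8b3891431f4ee6cb5986b752234fa702e16884361203fd3e3ecf53698ac25bad73f9d482390d84be5e0c86129d4c964a17cbc50268c05204d5e9f4196c96230377b6d8abd54a6d1e78f6753a1b2d16630d803217890441a0682fddeae5f1f3b9ac0dceb5549f4c2490b80bd1c0d15fab9428b421b0ce52250e43e17f8f97afc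1ce63b0f6fb1d5683358d41e08f570b3d8cad53250f4773114c8a2913857dbe3edf076f8fc1da6c1539ece64309823c1b4cb632c954933f1d0ba54248b45014fc7b3add0d1e26f761af51a793796c4e18e270b1d76b756a451e7935958a62611033ebeef377b65acd3ddedd66adcd261298e35198c75fa491e863e958a0461e84c2409f97839fc2dae6b0d6ead52e7f3694c5a06f4713418aad4ea28f478331588e290f047ededf2777adcee2ef363aace6571d83bd9d0da662f1589a441e8cc52250e84c1c06


/-! ### Kernel-friendly evaluation tools -/

/-- Evaluate `n` to a literal before passing it on. -/
def strict {α : Type} (n : Nat) (f : Nat → α) : α :=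
  Nat.rec (motive := fun _ => α) (f 0) (fun k _ => f (Nat.succ k)) n

@[simp] theorem strict_eq {α : Type} (n : Nat) (f : Nat → α) : strict n f = f n := by
  cases n <;> rfl

/-- Bounded universal quantifier. -/
def allN (n : Nat) (p : Nat → Bool) : Bool :=
  Nat.rec (motive := fun _ => Bool) true (fun k ih => p k && ih) n

theorem allN_spec {n : Nat} {p : Nat → Bool} (h : allN n p = true) :
    ∀ i, i < n → p i = true := by
  induction n with
  | zero => intro i hi; omega
  | succ n ih =>
    have h' : (p n && allN n p) = true := h
    rw [Bool.and_eq_true] at h'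
    intro i hi
    rcases Nat.lt_succ_iff_lt_or_eq.mp hi with h1 | h1
    · exact ih h'.2 i h1
    · rw [h1]; exact h'.1

/-- Bounded existential quantifier. -/
def exN (n : Nat) (p : Nat → Bool) : Bool :=
  Nat.rec (motive := fun _ => Bool) false (fun k ih => p k || ih) n

theorem exN_spec {n : Nat} {p : Nat → Bool} (h : exN n p = true) :
    ∃ i, i < n ∧ p i = true := by
  induction n with
  | zero => exact absurd h (by simp [exN])
  | succ n ih =>
    have h' : (p n || exN n p) = true := h
    rw [Bool.or_eq_true] at h'
    rcases h' with h' | h'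
    · exact ⟨n, by omega, h'⟩
    · obtain ⟨i, hi, hp⟩ := ih h'
      exact ⟨i, by omega, hp⟩

/-- Bounded sum. -/
def sumN (n : Nat) (p : Nat → Nat) : Nat :=
  Nat.rec (motive := fun _ => Nat) 0 (fun k ih => Nat.add (p k) ih) n

theorem sumN_eq (n : Nat) (p : Nat → Nat) : sumN n p = ∑ i ∈ Finset.range n, p i := by
  induction n with
  | zero => rfl
  | succ n ih =>
    rw [Finset.sum_range_succ, ← ih]; exact Nat.add_comm _ _

/-- The `k`-th binary digit. -/
def bit (u k : Nat) : Bool := Nat.beq (Nat.mod (Nat.shiftRight u k) 2) 1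

theorem bit_eq (u k : Nat) : bit u k = u.testBit k := by
  rw [Nat.testBit_eq_decide_div_mod_eq]
  have : Nat.mod (Nat.shiftRight u k) 2 = u / 2 ^ k % 2 := by
    rw [← Nat.shiftRight_eq_div_pow]; rfl
  unfold bit
  rw [this, Bool.eq_iff_iff, Nat.beq_eq, decide_eq_true_iff]

/-- Iterated exclusive or over the ten low binary digits of `u`. -/
def fold (f : Nat → Nat) (u : Nat) (n : Nat) : Nat :=
  Nat.rec (motive := fun _ => Nat) 0
    (fun k acc => cond (bit u k) (Nat.xor acc (f k)) acc) n

theorem fold_succ (f : Nat → Nat) (u n : Nat) :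
    fold f u (n + 1) = cond (u.testBit n) (fold f u n ^^^ f n) (fold f u n) := by
  rw [← bit_eq]; rfl

theorem fold_xor (f : Nat → Nat) (u v n : Nat) :
    fold f (u ^^^ v) n = fold f u n ^^^ fold f v n := by
  induction n with
  | zero => simp [fold]
  | succ n ih =>
    rw [fold_succ, fold_succ, fold_succ, Nat.testBit_xor, ih]
    cases u.testBit n <;> cases v.testBit n <;>
      simp [Nat.xor_comm, Nat.xor_left_comm]

theorem fold_zero (f : Nat → Nat) (n : Nat) : fold f 0 n = 0 := by
  induction n with
  | zero => rfl
  | succ n ih => rw [fold_succ, ih]; simp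

/-- Number of ones among the 513 low binary digits. -/
def m3 : Nat := 0x49249249249249249249249249249249249249249249249249249249249249249249249249249249249249249249249249249249249249249249249249249249
def m9 : Nat := 0x70381c0e070381c0e070381c0e070381c0e070381c0e070381c0e070381c0e070381c0e070381c0e070381c0e070381c0e070381c0e070381c0e070381c0e07

def popc (x : Nat) : Nat :=
  strict (Nat.add (Nat.add (Nat.land x m3) (Nat.land (Nat.shiftRight x 1) m3))
    (Nat.land (Nat.shiftRight x 2) m3)) fun y =>
  Nat.mod (Nat.add (Nat.add (Nat.land y m9) (Nat.land (Nat.shiftRight y 3) m9))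
    (Nat.land (Nat.shiftRight y 6) m9)) 511

/-! ### The points and the commuting graph -/

def sig (i : Nat) : Nat := Nat.mod (Nat.shiftRight SIGt (Nat.mul 512 i)) (Nat.pow 2 512)
def tr (O i : Nat) : Nat :=
  Nat.mod (Nat.shiftRight TRt (Nat.mul 10 (Nat.add (Nat.mul 23 O) i))) 1024
def ib (O k : Nat) : Nat :=
  Nat.mod (Nat.shiftRight IBt (Nat.mul 5 (Nat.add (Nat.mul 10 O) k))) 32
def bs (O : Nat) : Nat := Nat.mod (Nat.shiftRight BSt (Nat.mul 23 O)) 8388608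
def Mk (O : Nat) : Nat := Nat.mod (Nat.shiftRight MKt (Nat.mul 512 O)) (Nat.pow 2 512)
def S0 (O : Nat) : Nat := Nat.mod (Nat.shiftRight S0t (Nat.mul 512 O)) (Nat.pow 2 512)
def low (O : Nat) : Nat := Nat.mod (Nat.shiftRight LOWt (Nat.mul 3 O)) 8
def pb (O : Nat) : Nat := Nat.mod (Nat.shiftRight PBt (Nat.mul 11 O)) 2048

/-- Dimension of a block: monads, heptads, base points. -/
def dim (O : Nat) : Nat := cond (Nat.ble 276 O) 0 (cond (Nat.ble 23 O) 5 10)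

def blk (c : Nat) : Nat := Nat.div c 1024
def off (c : Nat) : Nat := Nat.mod c 1024
def mk (O u : Nat) : Nat := Nat.add (Nat.mul 1024 O) u

/-- Sign vector of a translate. -/
def lin (O u : Nat) : Nat := fold (fun k => sig (ib O k)) u 10
def Sg (O u : Nat) : Nat := Nat.xor (S0 O) (lin O u)

/-- Admissible numbers of sign disagreements (as a bit mask) given the number of common octads. -/
def tm (p : Nat) : Nat :=
  cond (Nat.beq p 30) (Nat.pow 2 10 + Nat.pow 2 16)
    (cond (Nat.beq p 15) 1 (cond (Nat.beq p 3) 1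
      (cond (Nat.beq p 210) (Nat.pow 2 90) (cond (Nat.beq p 330) (Nat.pow 2 160) 0))))

def adjS (m t s : Nat) : Bool := bit t (popc (Nat.land m s))

def adjM (M S M' S' : Nat) : Bool :=
  strict (Nat.land M M') fun m => strict (tm (popc m)) fun t =>
    cond (Nat.beq t 0) false (adjS m t (Nat.xor S S'))

/-- The commuting graph, on codes. -/
def adj (c d : Nat) : Bool :=
  strict (blk c) fun O => strict (blk d) fun P =>
  cond (Nat.ble 276 O)
    (cond (Nat.ble 276 P) (!(Nat.beq O P)) (bit (bs P) (Nat.sub O 276)))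
    (cond (Nat.ble 276 P) (bit (bs O) (Nat.sub P 276))
      (adjM (Mk O) (Sg O (off c)) (Mk P) (Sg P (off d))))

/-- Validity of codes. -/
def vld (c : Nat) : Bool :=
  strict (blk c) fun O => Nat.ble (Nat.succ O) 299 && Nat.ble (Nat.succ (off c)) (Nat.pow 2 (dim O))

/-- The base transpositions acting. -/
def ea (i c : Nat) : Nat := strict (blk c) fun O => mk O (Nat.xor (off c) (tr O i))

/-- The extra transposition. -/
def Ta (c : Nat) : Nat :=
  strict (blk c) fun O => strict (off c) fun u => strict (low O) fun l =>
  strict (Nat.mod (Nat.shiftRight TTt (Nat.mul 19 (Nat.add (pb O) (Nat.shiftRight u l)))) 524288)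
    fun g => strict (blk g) fun P =>
  mk P (Nat.xor (off g) (fold (fun k => tr P (ib O k)) (Nat.mod u (Nat.pow 2 l)) 10))

/-- A permutation of the points from a table. -/
def pnt (PI i : Nat) : Nat := Nat.mod (Nat.shiftRight PI (Nat.mul 5 i)) 32
def img (IM O : Nat) : Nat := Nat.mod (Nat.shiftRight IM (Nat.mul 19 O)) 524288
def pocT (PO k : Nat) : Nat := Nat.mod (Nat.shiftRight PO (Nat.mul 9 k)) 512

/-- The action of a monomial generator on codes. -/
def na (PI IM c : Nat) : Nat :=
  strict (blk c) fun O => strict (img IM O) fun g => strict (blk g) fun P =>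
  mk P (Nat.xor (off g) (fold (fun k => tr P (pnt PI (ib O k))) (off c) 10))

/-- piece representative number `p`, and its place in the search tree. -/
def pr (p : Nat) : Nat := Nat.mod (Nat.shiftRight PRt (Nat.mul 19 p)) 524288
def bfp (p : Nat) : Nat := Nat.mod (Nat.shiftRight BFPt (Nat.mul 5 p)) 32
/-- piece number of a code -/
def pn (c : Nat) : Nat :=
  strict (blk c) fun O => Nat.add (pb O) (Nat.shiftRight (off c) (low O))


/-! ### Finite checks -/

theorem chk_tr_lt : allN 299 (fun O => allN 23 fun i => Nat.ble (Nat.succ (tr O i)) (Nat.pow 2 (dim O))) = true := by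
  decide +kernel
theorem chk_ib : allN 299 (fun O => allN (dim O) fun k =>
    Nat.ble (Nat.succ (ib O k)) 23 && Nat.beq (tr O (ib O k)) (Nat.pow 2 k)) = true := by
  decide +kernel
theorem chk_lin : allN 276 (fun O => allN 23 fun i =>
    Nat.beq (Nat.land (Nat.xor (lin O (tr O i)) (sig i)) (Mk O)) 0) = true := by
  decide +kernel
/-- adjacency to base points is being fixed by the base transposition -/
theorem chk_fix : allN 276 (fun O => allN 23 fun i =>
    bit (bs O) i == Nat.beq (tr O i) 0) = true := by
  decide +kernel
theorem chk_mask : allN 276 (fun O =>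
    Nat.beq (Mk O) (Nat.xor (Nat.sub (Nat.pow 2 506) 1)
      (Nat.rec (motive := fun _ => Nat) 0 (fun i a => cond (bit (bs O) i) (Nat.lor a (sig i)) a) 23)))
    = true := by
  decide +kernel


/-- Bitwise or of a family. -/
def orN (n : Nat) (f : Nat → Nat) : Nat :=
  Nat.rec (motive := fun _ => Nat) 0 (fun k a => Nat.lor (f k) a) n

/-- All checks for a monomial generator. -/
def nchk1 (PI : Nat) : Bool :=
  allN 23 (fun i => Nat.ble (Nat.succ (pnt PI i)) 23) &&
  Nat.beq (orN 23 fun i => Nat.pow 2 (pnt PI i)) 8388607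
def nchk2 (PI PO : Nat) : Bool :=
  allN 506 (fun k => strict (pocT PO k) fun k' => Nat.ble (Nat.succ k') 506 &&
    allN 23 fun i => bit (sig (pnt PI i)) k' == bit (sig i) k) &&
  Nat.beq (orN 506 fun k => Nat.pow 2 (pocT PO k)) (Nat.sub (Nat.pow 2 506) 1)
def nchk3 (PI IM : Nat) : Bool :=
  allN 299 (fun O => strict (blk (img IM O)) fun P => strict (bs O) fun x => strict (bs P) fun y =>
    Nat.ble (Nat.succ P) 299 &&
    (Nat.beq (dim O) (dim P) && (vld (img IM O) &&
    (cond (Nat.ble 276 O) (Nat.beq P (Nat.add 276 (pnt PI (Nat.sub O 276))))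
      (allN 23 fun i => bit y (pnt PI i) == bit x i))))) &&
  Nat.beq (orN 299 fun O => Nat.pow 2 (blk (img IM O))) (Nat.sub (Nat.pow 2 299) 1)
/-- `t`-th octad disjoint from heptad `h`. -/
def hoc (h t : Nat) : Nat := Nat.mod (Nat.shiftRight HOt (Nat.mul 9 (Nat.add (Nat.mul 30 h) t))) 512
def nchk4 (IM PO EP : Nat) : Bool :=
  allN 276 fun O => strict (img IM O) fun g => strict (Sg (blk g) (off g)) fun s =>
    strict (Nat.xor (S0 O) EP) fun x => 
    cond (Nat.ble 23 O)
     (allN 30 fun t => strict (hoc (Nat.sub O 23) t) fun k => bit s (pocT PO k) == bit x k)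
     (strict (Mk O) fun m => allN 506 fun k => cond (bit m k) (bit s (pocT PO k) == bit x k) true)

theorem chk_hoc : allN 253 (fun h =>
    Nat.beq (Mk (Nat.add 23 h)) (orN 30 fun t => Nat.pow 2 (hoc h t))) = true := by
  decide +kernel
theorem nchkA : (nchk1 PIA && (nchk2 PIA POA && (nchk3 PIA IMA && nchk4 IMA POA EPA))) = true := by
  decide +kernel
theorem nchkB : (nchk1 PIB && (nchk2 PIB POB && (nchk3 PIB IMB && nchk4 IMB POB EPB))) = true := by
  decide +kernel
theorem nchkR : (nchk1 PIR && (nchk2 PIR POR && (nchk3 PIR IMR && nchk4 IMR POR EPR))) = true := by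
  decide +kernel

/-- Injectivity of the sign vectors: no nonzero translation of a block is trivial on its mask. -/
def tree (leaf : Nat → Nat → Bool) (f : Nat → Nat) (n : Nat) : Nat → Nat → Bool :=
  Nat.rec (motive := fun _ => Nat → Nat → Bool) (fun u s => leaf u s)
    (fun k ih u s => ih u s && strict (Nat.add u (Nat.pow 2 k)) fun u' =>
      strict (Nat.xor s (f k)) fun s' => ih u' s') n
theorem chk_inj : allN 276 (fun O => strict (Mk O) fun m =>
    tree (fun u s => cond (Nat.beq (Nat.land m s) 0) (Nat.beq u 0) true)
      (fun k => sig (ib O k)) (dim O) 0 0) = true := by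
  decide +kernel


/-- The seven points of the first heptad. -/
def hpm : Nat := 25512
theorem chk_pr : allN 299 (fun O => allN (Nat.pow 2 (Nat.sub (dim O) (low O))) fun v =>
    Nat.ble (Nat.succ (Nat.add (pb O) v)) 1207 && (Nat.ble (low O) (dim O) &&
    Nat.beq (pr (Nat.add (pb O) v)) (mk O (Nat.mul v (Nat.pow 2 (low O)))))) = true := by
  decide +kernel
theorem chk_low : allN 299 (fun O =>
    (allN 23 fun i => cond (bit hpm i) (Nat.ble (Nat.succ (tr O i)) (Nat.pow 2 (low O))) true) &&
    (allN (low O) fun k => bit hpm (ib O k))) = true := by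
  decide +kernel
theorem chk_T1 : allN 1207 (fun p => strict (pr p) fun c => strict (Ta c) fun d =>
    vld c && (vld d && (Nat.beq (Ta d) c && (Nat.beq (Ta (na PIA IMA c)) (na PIA IMA d) &&
    Nat.beq (Ta (na PIB IMB c)) (na PIB IMB d))))) = true := by
  decide +kernel
theorem chk_Tlin : allN 1207 (fun p => strict (pr p) fun c => strict (blk (Ta c)) fun P =>
    strict (blk c) fun O => allN 23 fun i => cond (bit hpm i)
      (Nat.beq (fold (fun k => tr P (ib O k)) (tr O i) 10) (tr P i)) true) = true := by
  decide +kernel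
theorem chk_Tb : allN 1207 (fun p => strict (pr p) fun c =>
    cond (adj 23552 c) (Nat.beq (Ta c) c) (!(Nat.beq (Ta c) c) || Nat.beq c 23552)) = true := by
  decide +kernel
theorem chk_Tbase : allN 23 (fun i => strict (mk (Nat.add 276 i) 0) fun y => strict (Ta y) fun y' =>
    allN 1207 fun p => strict (pr p) fun c => cond (adj y c) (adj y' (Ta c)) true) = true := by
  decide +kernel
theorem chk_T23 : (fun (f : Nat → Bool) => f 23552 && (f 23553 && f 23555)) (fun y =>
    strict (Ta y) fun y' =>
    allN 1207 fun p => strict (pr p) fun c => cond (adj y c) (adj y' (Ta c)) true) = true := by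
  decide +kernel
/-- The representatives of the pieces under the search tree. -/
def isRep (c : Nat) : Bool :=
  Nat.ble 282624 c || (Nat.beq c 23552 || (Nat.beq c 23553 || (Nat.beq c 23555 || (Nat.beq c 24576 ||
  (Nat.beq c 24592 || (Nat.beq c 29696 || (Nat.beq c 3072 || (Nat.beq c 3104 || (Nat.beq c 3168 ||
  (Nat.beq c 0 || Nat.beq c 704))))))))))
theorem chk_bfp : allN 1207 (fun p => strict (bfp p) fun x => strict (pr p) fun c =>
    isRep c || Nat.ble (Nat.succ (Nat.div (bfp (pn (cond (Nat.beq (Nat.mod x 2) 0)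
      (na PIA IMA c) (na PIB IMB c)))) 2)) (Nat.div x 2)) = true := by
  decide +kernel

/-- Full check of one row of the graph against `T`, on the blocks `lo, ..., lo+n-1`. -/
def scanT (y lo n skip : Nat) : Bool :=
  strict (blk y) fun Oy => strict (Mk Oy) fun my => strict (Sg Oy (off y)) fun sy =>
  strict (Ta y) fun y' =>
  allN n fun j => strict (Nat.add lo j) fun O => bit skip O ||
    (strict (Nat.land my (Mk O)) fun m => strict (tm (popc m)) fun t =>
      cond (Nat.beq t 0) true
        (tree (fun u s => cond (adjS m t s) (adj y' (Ta (mk O u))) true)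
          (fun k => sig (ib O k)) (dim O) 0 (Nat.xor sy (S0 O))))
theorem scan_24576 : scanT 24576 24 252 0 = true := by decide +kernel
theorem scan_24592 : scanT 24592 24 252 0 = true := by decide +kernel
theorem scan_29696 : scanT 29696 24 252 0 = true := by decide +kernel
theorem scan_3072 : scanT 3072 0 276 0 = true := by decide +kernel
theorem scan_3104 : scanT 3104 0 276 0 = true := by decide +kernel
theorem scan_3168 : scanT 3168 0 276 0 = true := by decide +kernel
theorem scan_0 : scanT 0 0 276 hpm = true := by decide +kernel
theorem scan_704 : scanT 704 0 276 hpm = true := by decide +kernel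


/-! ### The population count -/

theorem land_split (a c x m : Nat) (ha : a < 512) (hc : c < 512) :
    (a + 512 * x) &&& (c + 512 * m) = (a &&& c) + 512 * (x &&& m) := by
  have e : ∀ y z : Nat, y < 512 → y + 512 * z = 2 ^ 9 * z + y := by intros; omega
  have hac : a &&& c < 512 := lt_of_le_of_lt Nat.and_le_left ha
  rw [e a x ha, e c m hc, e _ _ hac]
  apply Nat.eq_of_testBit_eq
  intro k
  rw [Nat.testBit_and, Nat.testBit_two_pow_mul_add _ (by simpa using ha),
    Nat.testBit_two_pow_mul_add _ (by simpa using hc),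
    Nat.testBit_two_pow_mul_add _ (by simpa using hac)]
  split <;> simp

theorem shift_split (a x s : Nat) (hs : s ≤ 9) :
    (a + 512 * x) >>> s = (a >>> s + 2 ^ (9 - s) * (x % 2 ^ s)) + 512 * (x >>> s) := by
  rw [Nat.shiftRight_eq_div_pow, Nat.shiftRight_eq_div_pow, Nat.shiftRight_eq_div_pow]
  have h1 : 512 = 2 ^ s * 2 ^ (9 - s) := by rw [← pow_add]; norm_num [Nat.add_sub_cancel' hs]
  rw [h1, Nat.mul_assoc, Nat.add_mul_div_left _ _ (by positivity)]
  conv_lhs => rw [← Nat.mod_add_div x (2 ^ s)]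
  ring

def pop9 (a : Nat) : Nat := ∑ k ∈ Finset.range 9, (a.testBit k).toNat

def ypop (m x : Nat) : Nat := (x &&& m) + ((x >>> 1) &&& m) + ((x >>> 2) &&& m)
def zpop (m y : Nat) : Nat := (y &&& m) + ((y >>> 3) &&& m) + ((y >>> 6) &&& m)

theorem small_land (m b r : Nat) (hm : m < 2 ^ b) (a : Nat) (ha : a < 2 ^ b) :
    (a + 2 ^ b * r) &&& m = a &&& m := by
  apply Nat.eq_of_testBit_eq
  intro k
  rw [Nat.testBit_and, Nat.testBit_and, Nat.add_comm, Nat.testBit_two_pow_mul_add _ ha]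
  split
  · rfl
  · rename_i h
    rw [Nat.testBit_lt_two_pow (lt_of_lt_of_le hm (Nat.pow_le_pow_right (by norm_num) (by omega)))]
    simp

theorem part_split (c s a x m : Nat) (ha : a < 512) (hc : c < 512) (hs : s ≤ 9) (hcb : c < 2 ^ (9 - s)) :
    ((a + 512 * x) >>> s) &&& (c + 512 * m) = ((a >>> s) &&& c) + 512 * ((x >>> s) &&& m) := by
  have h2 : a >>> s < 2 ^ (9 - s) := by
    rw [Nat.shiftRight_eq_div_pow]
    apply Nat.div_lt_of_lt_mul
    rw [← pow_add]; norm_num [Nat.add_sub_cancel' hs]; exact ha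
  have h3 : x % 2 ^ s < 2 ^ s := Nat.mod_lt _ (by positivity)
  have h4 : a >>> s + 2 ^ (9 - s) * (x % 2 ^ s) < 512 := by
    have h5 : 2 ^ (9 - s) * (x % 2 ^ s) + 2 ^ (9 - s) ≤ 512 := by
      have : 2 ^ (9 - s) * (x % 2 ^ s + 1) ≤ 2 ^ (9 - s) * 2 ^ s := Nat.mul_le_mul_left _ h3
      rw [← pow_add, Nat.sub_add_cancel hs] at this
      linarith
    omega
  rw [shift_split _ _ _ hs, land_split _ _ _ _ h4 hc, small_land _ _ _ hcb _ h2]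

theorem ypop_split (a x m : Nat) (ha : a < 512) :
    ypop (73 + 512 * m) (a + 512 * x) = ypop 73 a + 512 * ypop m x := by
  unfold ypop
  rw [land_split _ _ _ _ ha (by norm_num), part_split 73 1 a x m ha (by norm_num) (by norm_num) (by norm_num),
    part_split 73 2 a x m ha (by norm_num) (by norm_num) (by norm_num)]
  ring

theorem zpop_split (a x m : Nat) (ha : a < 512) :
    zpop (7 + 512 * m) (a + 512 * x) = zpop 7 a + 512 * zpop m x := by
  unfold zpop
  rw [land_split _ _ _ _ ha (by norm_num), part_split 7 3 a x m ha (by norm_num) (by norm_num) (by norm_num),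
    part_split 7 6 a x m ha (by norm_num) (by norm_num) (by norm_num)]
  ring

theorem digit_pop : ∀ a : Fin 512, ypop 73 a < 512 ∧ zpop 7 (ypop 73 a) = pop9 a := by
  decide +kernel

def M3 : Nat → Nat
  | 0 => 0
  | n + 1 => 73 + 512 * M3 n
def M9 : Nat → Nat
  | 0 => 0
  | n + 1 => 7 + 512 * M9 n

theorem m3_eq : m3 = M3 57 := by decide +kernel
theorem m9_eq : m9 = M9 57 := by decide +kernel

theorem sum_bits (n x : Nat) : ∑ k ∈ Finset.range (9 * (n + 1)), (x.testBit k).toNat =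
    pop9 (x % 512) + ∑ k ∈ Finset.range (9 * n), ((x / 512).testBit k).toNat := by
  rw [show 9 * (n + 1) = 9 + 9 * n by ring, Finset.sum_range_add]
  congr 1
  · apply Finset.sum_congr rfl
    intro k hk
    rw [show 512 = 2 ^ 9 by norm_num, Nat.testBit_mod_two_pow]
    simp at hk; simp [hk]
  · apply Finset.sum_congr rfl
    intro k _
    rw [show 512 = 2 ^ 9 by norm_num, Nat.testBit_div_two_pow, Nat.add_comm]

theorem pop_rec (n x : Nat) : zpop (M9 n) (ypop (M3 n) x) ≡
    ∑ k ∈ Finset.range (9 * n), (x.testBit k).toNat [MOD 511] := by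
  induction n generalizing x with
  | zero => simp [M9, M3, zpop, ypop]; rfl
  | succ n ih =>
    have h := digit_pop ⟨x % 512, Nat.mod_lt _ (by norm_num)⟩
    rw [sum_bits]
    conv_lhs => rw [← Nat.mod_add_div x 512]
    rw [M3, M9, ypop_split _ _ _ (Nat.mod_lt _ (by norm_num)), zpop_split _ _ _ h.1, h.2]
    apply Nat.ModEq.add_left
    have := (ih (x / 512))
    calc _ ≡ 1 * zpop (M9 n) (ypop (M3 n) (x / 512)) [MOD 511] :=
          Nat.ModEq.mul_right _ (by decide)
      _ ≡ _ [MOD 511] := by rw [one_mul]; exact this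

theorem popc_eq (x : Nat) (hx : x < 2 ^ 506) :
    popc x = ∑ k ∈ Finset.range 506, (x.testBit k).toNat := by
  have h := pop_rec 57 x
  have e : popc x = zpop (M9 57) (ypop (M3 57) x) % 511 := by
    rw [← m3_eq, ← m9_eq]; unfold popc; rw [strict_eq]; rfl
  have e2 : ∑ k ∈ Finset.range (9 * 57), (x.testBit k).toNat =
      ∑ k ∈ Finset.range 506, (x.testBit k).toNat := by
    rw [show 9 * 57 = 506 + 7 by norm_num, Finset.sum_range_add]
    rw [Finset.sum_eq_zero (s := Finset.range 7)]
    · simp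
    · intro k _
      rw [Nat.testBit_lt_two_pow (lt_of_lt_of_le hx (Nat.pow_le_pow_right (by norm_num) (by omega)))]
      rfl
  rw [e, ← e2]
  rw [h, e2]
  apply Nat.mod_eq_of_lt
  calc _ ≤ ∑ k ∈ Finset.range 506, 1 := Finset.sum_le_sum (fun k _ => by cases x.testBit k <;> simp)
    _ < 511 := by simp

/-- Population counts are invariant under permutations of the digits. -/
theorem popc_perm (x y : Nat) (hx : x < 2 ^ 506) (hy : y < 2 ^ 506) (f : Nat → Nat)
    (hf : ∀ k, k < 506 → f k < 506) (hs : ∀ k, k < 506 → ∃ j, j < 506 ∧ f j = k)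
    (h : ∀ k, k < 506 → y.testBit (f k) = x.testBit k) : popc y = popc x := by
  rw [popc_eq x hx, popc_eq y hy]
  have hinj : Set.InjOn f (Finset.range 506 : Set ℕ) := by
    have him : Finset.image f (Finset.range 506) = Finset.range 506 := by
      ext k
      simp only [Finset.mem_image, Finset.mem_range]
      constructor
      · rintro ⟨j, hj, rfl⟩; exact hf j hj
      · intro hk; exact hs k hk
    apply Finset.card_image_iff.mp
    rw [him]
  symm
  apply Finset.sum_bij (fun k _ => f k)
  · intro k hk; simp at hk ⊢; exact hf k hk
  · intro a ha b hb hab; exact hinj ha hb hab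
  · intro b hb; simp at hb; obtain ⟨j, hj, e⟩ := hs b hb; exact ⟨j, by simpa using hj, e⟩
  · intro k hk; simp at hk; rw [h k hk]



/-! ### Codes -/

theorem chk_mklt : allN 276 (fun O => Nat.ble (Nat.succ (Mk O)) (Nat.pow 2 506)) = true := by
  decide +kernel

theorem chk_img506 : allN 23 (fun i => Nat.ble (Nat.succ (sig i)) (Nat.pow 2 506)) = true := by
  decide +kernel

theorem Mk_lt {O : Nat} (h : O < 276) : Mk O < 2 ^ 506 :=
  Nat.le_of_ble_eq_true (allN_spec chk_mklt O h)

theorem dim_le (O : Nat) : dim O ≤ 10 := by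
  unfold dim
  cases Nat.ble 276 O <;> cases Nat.ble 23 O <;> simp

theorem pow_dim_le (O : Nat) : 2 ^ dim O ≤ 1024 :=
  le_trans (Nat.pow_le_pow_right (by norm_num) (dim_le O)) (by norm_num)

theorem dim_base {O : Nat} (h : 276 ≤ O) : dim O = 0 := by
  unfold dim
  rw [Nat.ble_eq_true_of_le h]; rfl

theorem dim_hept {O : Nat} (h : 23 ≤ O) (h' : O < 276) : dim O = 5 := by
  unfold dim
  rw [Nat.ble_eq_true_of_le h, show Nat.ble 276 O = false by
    rw [Bool.eq_false_iff]; intro e; have := Nat.le_of_ble_eq_true e; omega]; rfl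

theorem dim_monad {O : Nat} (h : O < 23) : dim O = 10 := by
  unfold dim
  rw [show Nat.ble 276 O = false by
    rw [Bool.eq_false_iff]; intro e; have := Nat.le_of_ble_eq_true e; omega,
    show Nat.ble 23 O = false by
    rw [Bool.eq_false_iff]; intro e; have := Nat.le_of_ble_eq_true e; omega]; rfl

theorem mk_def (O u : Nat) : mk O u = 1024 * O + u := rfl
theorem blk_def (c : Nat) : blk c = c / 1024 := rfl
theorem off_def (c : Nat) : off c = c % 1024 := rfl

theorem blk_mk {O u : Nat} (h : u < 1024) : blk (mk O u) = O := by
  rw [blk_def, mk_def]; omega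
theorem off_mk {O u : Nat} (h : u < 1024) : off (mk O u) = u := by
  rw [off_def, mk_def]; omega
theorem mk_blk_off (c : Nat) : mk (blk c) (off c) = c := by
  rw [blk_def, mk_def, off_def]; omega
theorem off_lt (c : Nat) : off c < 1024 := by rw [off_def]; omega
theorem code_ext {c d : Nat} (h : blk c = blk d) (h' : off c = off d) : c = d := by
  rw [← mk_blk_off c, ← mk_blk_off d, h, h']

theorem vld_iff (c : Nat) : vld c = true ↔ blk c < 299 ∧ off c < 2 ^ dim (blk c) := by
  unfold vld
  rw [strict_eq, Bool.and_eq_true]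
  constructor
  · rintro ⟨h, h'⟩
    exact ⟨Nat.le_of_ble_eq_true h, Nat.le_of_ble_eq_true h'⟩
  · rintro ⟨h, h'⟩
    exact ⟨Nat.ble_eq_true_of_le h, Nat.ble_eq_true_of_le h'⟩

theorem vld_mk {O u : Nat} (h : O < 299) (h' : u < 2 ^ dim O) : vld (mk O u) = true := by
  have : u < 1024 := lt_of_lt_of_le h' (pow_dim_le O)
  rw [vld_iff, blk_mk this, off_mk this]; exact ⟨h, h'⟩

theorem tr_lt {O i : Nat} (h : O < 299) (hi : i < 23) : tr O i < 2 ^ dim O :=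
  Nat.le_of_ble_eq_true (allN_spec (allN_spec chk_tr_lt O h) i hi)

theorem ib_lt {O k : Nat} (h : O < 299) (hk : k < dim O) : ib O k < 23 := by
  have := allN_spec (allN_spec chk_ib O h) k hk
  rw [Bool.and_eq_true] at this
  exact Nat.le_of_ble_eq_true this.1

theorem tr_ib {O k : Nat} (h : O < 299) (hk : k < dim O) : tr O (ib O k) = 2 ^ k := by
  have := allN_spec (allN_spec chk_ib O h) k hk
  rw [Bool.and_eq_true] at this
  exact Nat.eq_of_beq_eq_true this.2

theorem lin_xor (O u v : Nat) : lin O (u ^^^ v) = lin O u ^^^ lin O v := fold_xor _ _ _ _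

theorem lin_zero (O : Nat) : lin O 0 = 0 := fold_zero _ _

theorem lin_tr {O i : Nat} (h : O < 276) (hi : i < 23) :
    (lin O (tr O i) ^^^ sig i) &&& Mk O = 0 :=
  Nat.eq_of_beq_eq_true (allN_spec (allN_spec chk_lin O h) i hi)

theorem Sg_xor (O u v : Nat) : Sg O (u ^^^ v) = Sg O u ^^^ lin O v := by
  have : ∀ w, Sg O w = S0 O ^^^ lin O w := fun w => rfl
  rw [this, this, lin_xor, Nat.xor_assoc]

theorem bs_tr {O i : Nat} (h : O < 276) (hi : i < 23) :
    (bs O).testBit i = decide (tr O i = 0) := by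
  have := allN_spec (allN_spec chk_fix O h) i hi
  rw [bit_eq] at this
  rw [eq_of_beq this, Bool.eq_iff_iff, Nat.beq_eq, decide_eq_true_iff]

/-! ### Adjacency -/

theorem bit_zero (k : Nat) : bit 0 k = false := by rw [bit_eq]; simp

theorem adjM_eq (M S M' S' : Nat) : adjM M S M' S' =
    (tm (popc (M &&& M'))).testBit (popc ((M &&& M') &&& (S ^^^ S'))) := by
  unfold adjM
  rw [strict_eq, strict_eq]
  unfold adjS
  have e : Nat.land M M' = M &&& M' := rfl
  rw [e]
  cases h : Nat.beq (tm (popc (M &&& M'))) 0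
  · simp only [cond_false]; rw [bit_eq]; rfl
  · rw [Nat.eq_of_beq_eq_true h]; simp

theorem ble_false {a b : Nat} (h : b < a) : Nat.ble a b = false := by
  rw [Bool.eq_false_iff]; intro e; have := Nat.le_of_ble_eq_true e; omega

theorem adj_nn {c d : Nat} (hc : blk c < 276) (hd : blk d < 276) :
    adj c d = adjM (Mk (blk c)) (Sg (blk c) (off c)) (Mk (blk d)) (Sg (blk d) (off d)) := by
  unfold adj
  rw [strict_eq, strict_eq, ble_false hc, ble_false hd]; rfl

theorem adj_nb {c d : Nat} (hc : blk c < 276) (hd : 276 ≤ blk d) :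
    adj c d = (bs (blk c)).testBit (blk d - 276) := by
  unfold adj
  rw [strict_eq, strict_eq, ble_false hc, Nat.ble_eq_true_of_le hd]
  simp only [cond_true, cond_false]
  exact bit_eq _ _

theorem adj_bn {c d : Nat} (hc : 276 ≤ blk c) (hd : blk d < 276) :
    adj c d = (bs (blk d)).testBit (blk c - 276) := by
  unfold adj
  rw [strict_eq, strict_eq, ble_false hd, Nat.ble_eq_true_of_le hc]
  simp only [cond_true, cond_false]
  exact bit_eq _ _

theorem adj_bb {c d : Nat} (hc : 276 ≤ blk c) (hd : 276 ≤ blk d) :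
    adj c d = !(decide (blk c = blk d)) := by
  unfold adj
  rw [strict_eq, strict_eq, Nat.ble_eq_true_of_le hd, Nat.ble_eq_true_of_le hc]
  simp only [cond_true]
  congr 1
  rw [Bool.eq_iff_iff, Nat.beq_eq, decide_eq_true_iff]

theorem adj_symm (c d : Nat) : adj c d = adj d c := by
  rcases lt_or_ge (blk c) 276 with hc | hc <;> rcases lt_or_ge (blk d) 276 with hd | hd
  · rw [adj_nn hc hd, adj_nn hd hc, adjM_eq, adjM_eq, Nat.land_comm (Mk (blk c)), Nat.xor_comm (Sg (blk c) _)]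
  · rw [adj_nb hc hd, adj_bn hd hc]
  · rw [adj_nb hd hc, adj_bn hc hd]
  · rw [adj_bb hc hd, adj_bb hd hc]; congr 2; exact propext eq_comm

theorem chk_irr : allN 276 (fun O => !(bit (tm (popc (Mk O))) 0)) = true := by decide +kernel

theorem popc_zero : popc 0 = 0 := by decide +kernel

theorem adj_irrefl (c : Nat) : adj c c = false := by
  rcases lt_or_ge (blk c) 276 with hc | hc
  · rw [adj_nn hc hc, adjM_eq, Nat.xor_self, Nat.and_zero, Nat.and_self, popc_zero]
    have := allN_spec chk_irr _ hc
    rw [bit_eq] at this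
    simpa using this
  · rw [adj_bb hc hc]; simp

/-! ### The base transpositions -/

theorem ea_eq (i c : Nat) : ea i c = mk (blk c) (off c ^^^ tr (blk c) i) := by
  unfold ea; rw [strict_eq]; rfl

theorem tr_lt' (O i : Nat) : tr O i < 1024 := Nat.mod_lt _ (by norm_num)

theorem blk_ea (i c : Nat) : blk (ea i c) = blk c := by
  rw [ea_eq, blk_mk (Nat.xor_lt_two_pow (n := 10) (off_lt c) (tr_lt' _ _))]
theorem off_ea (i c : Nat) : off (ea i c) = off c ^^^ tr (blk c) i := by
  rw [ea_eq, off_mk (Nat.xor_lt_two_pow (n := 10) (off_lt c) (tr_lt' _ _))]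

theorem vld_ea {i c : Nat} (hi : i < 23) (h : vld c = true) : vld (ea i c) = true := by
  rw [vld_iff] at h
  rw [vld_iff, blk_ea, off_ea]
  exact ⟨h.1, Nat.xor_lt_two_pow h.2 (tr_lt h.1 hi)⟩

theorem ea_ea (i c : Nat) : ea i (ea i c) = c := by
  apply code_ext
  · rw [blk_ea, blk_ea]
  · rw [off_ea, off_ea, blk_ea, Nat.xor_xor_cancel_right]

theorem ea_comm (i j c : Nat) : ea i (ea j c) = ea j (ea i c) := by
  apply code_ext
  · rw [blk_ea, blk_ea, blk_ea, blk_ea]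
  · simp only [off_ea, blk_ea, Nat.xor_assoc]; rw [Nat.xor_comm (tr _ j)]

theorem land_aux {m m' a a' b s s' : Nat} (h : (a ^^^ b) &&& m = 0) (h' : (a' ^^^ b) &&& m' = 0) :
    (m &&& m') &&& ((s ^^^ a) ^^^ (s' ^^^ a')) = (m &&& m') &&& (s ^^^ s') := by
  apply Nat.eq_of_testBit_eq
  intro k
  have e := congrArg (fun x => Nat.testBit x k) h
  have e' := congrArg (fun x => Nat.testBit x k) h'
  simp only [Nat.testBit_and, Nat.testBit_xor, Nat.zero_testBit] at e e' ⊢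
  revert e e'
  cases m.testBit k <;> cases m'.testBit k <;> cases a.testBit k <;> cases a'.testBit k <;>
    cases b.testBit k <;> cases s.testBit k <;> cases s'.testBit k <;> decide

theorem adj_ea {i : Nat} (hi : i < 23) (c d : Nat) : adj (ea i c) (ea i d) = adj c d := by
  rcases lt_or_ge (blk c) 276 with hc | hc <;> rcases lt_or_ge (blk d) 276 with hd | hd
  · rw [adj_nn (by rwa [blk_ea]) (by rwa [blk_ea]), adj_nn hc hd, adjM_eq, adjM_eq, blk_ea, blk_ea,
      off_ea, off_ea, Sg_xor, Sg_xor, land_aux (lin_tr hc hi) (lin_tr hd hi)]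
  · rw [adj_nb (by rwa [blk_ea]) (by rwa [blk_ea]), adj_nb hc hd, blk_ea, blk_ea]
  · rw [adj_bn (by rwa [blk_ea]) (by rwa [blk_ea]), adj_bn hc hd, blk_ea, blk_ea]
  · rw [adj_bb (by rwa [blk_ea]) (by rwa [blk_ea]), adj_bb hc hd, blk_ea, blk_ea]

/-- The base transposition `i` fixes exactly the neighbours of the base point `i` (and itself). -/
theorem ea_fix {i c : Nat} (hi : i < 23) (h : vld c = true) :
    ea i c = c ↔ (adj (mk (276 + i) 0) c = true ∨ c = mk (276 + i) 0) := by
  have h0 := (vld_iff c).mp h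
  have hb : blk (mk (276 + i) 0) = 276 + i := blk_mk (by norm_num)
  have hfix : ea i c = c ↔ tr (blk c) i = 0 := by
    constructor
    · intro e
      have := congrArg off e
      rw [off_ea] at this
      have h2 : off c ^^^ (off c ^^^ tr (blk c) i) = off c ^^^ off c := by rw [this]
      simpa [← Nat.xor_assoc] using h2
    · intro e
      apply code_ext
      · rw [blk_ea]
      · rw [off_ea, e]; simp
  rw [hfix]
  rcases lt_or_ge (blk c) 276 with hc | hc
  · rw [adj_bn (by rw [hb]; omega) hc, hb, show 276 + i - 276 = i by omega, bs_tr hc hi]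
    simp only [decide_eq_true_eq]
    constructor
    · exact Or.inl
    · rintro (e | e)
      · exact e
      · rw [e, hb] at hc; omega
  · have h1 := tr_lt h0.1 hi
    rw [dim_base hc] at h1
    rw [adj_bb (by rw [hb]; omega) hc, hb]
    have h2 := h0.2
    rw [dim_base hc] at h2
    constructor
    · intro _
      by_cases e : 276 + i = blk c
      · right; apply code_ext
        · rw [hb, e]
        · rw [off_mk (by norm_num)]; omega
      · left; simp [e]
    · intro _; omega

/-- Induction along the base transpositions. -/
theorem ea_ind (S : Nat → Prop) (Q : Nat → Prop) {O : Nat} (hO : O < 299)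
    (hQ : ∀ i c, S i → i < 23 → vld c = true → Q c → Q (ea i c)) (n : Nat) (hn : n ≤ dim O)
    (hS : ∀ k, k < n → S (ib O k)) :
    ∀ u v, u < 2 ^ n → v < 2 ^ dim O → Q (mk O v) → Q (mk O (v ^^^ u)) := by
  induction n with
  | zero =>
    intro u v hu _ hv
    have : u = 0 := by simpa using hu
    rw [this]; simpa using hv
  | succ n ih =>
    intro u v hu hvv hv
    have ih' := ih (by omega) (fun k hk => hS k (by omega))
    by_cases hlt : u < 2 ^ n
    · exact ih' u v hlt hvv hv
    · have h1 : u ^^^ 2 ^ n < 2 ^ n := by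
        apply Nat.lt_pow_two_of_testBit
        intro i hi
        rw [Nat.testBit_xor, Nat.testBit_two_pow]
        rcases Nat.lt_or_ge n i with h | h
        · rw [Nat.testBit_lt_two_pow (lt_of_lt_of_le hu (Nat.pow_le_pow_right (by norm_num) h))]
          simp; omega
        · have : i = n := by omega
          subst this
          have hb : u.testBit i = true := by
            rw [Nat.testBit_eq_decide_div_mod_eq]
            have : u / 2 ^ i = 1 := by
              apply Nat.div_eq_of_lt_le <;> [omega; (rw [pow_succ] at hu; omega)]
            rw [this]; rfl
          rw [hb]; simp
      have h2 := ih' (u ^^^ 2 ^ n) v h1 hvv hv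
      have h3 : v ^^^ (u ^^^ 2 ^ n) < 2 ^ dim O :=
        Nat.xor_lt_two_pow hvv (lt_of_lt_of_le h1 (Nat.pow_le_pow_right (by norm_num) (by omega)))
      have h4 : v ^^^ (u ^^^ 2 ^ n) < 1024 := lt_of_lt_of_le h3 (pow_dim_le O)
      have h5 := hQ (ib O n) _ (hS n (by omega)) (ib_lt hO (by omega)) (vld_mk hO h3) h2
      rw [ea_eq, blk_mk h4, off_mk h4, tr_ib hO (by omega)] at h5
      rw [Nat.xor_assoc, Nat.xor_xor_cancel_right] at h5
      exact h5

/-- A property invariant under all base transpositions holds everywhere if it holds at the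
block origins. -/
theorem ea_ind_all (Q : Nat → Prop) (hQ : ∀ i c, i < 23 → vld c = true → Q c → Q (ea i c))
    (h0 : ∀ O, O < 299 → Q (mk O 0)) : ∀ c, vld c = true → Q c := by
  intro c hc
  have h := (vld_iff c).mp hc
  have := ea_ind (fun _ => True) Q h.1 (fun i c _ => hQ i c) (dim (blk c)) le_rfl (fun _ _ => trivial)
    (off c) 0 h.2 (by positivity) (h0 _ h.1)
  rwa [Nat.zero_xor, mk_blk_off] at this



/-! ### Trees, folds and surjectivity certificates -/

theorem fold_congr (f g : Nat → Nat) (u v n : Nat) (h : ∀ k, k < n → u.testBit k = v.testBit k)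
    (hf : ∀ k, k < n → u.testBit k = true → f k = g k) :
    fold f u n = fold g v n := by
  induction n with
  | zero => rfl
  | succ n ih =>
    rw [fold_succ, fold_succ, ih (fun k hk => h k (by omega)) (fun k hk => hf k (by omega)),
      ← h n (by omega)]
    cases e : u.testBit n
    · rfl
    · rw [hf n (by omega) e]

theorem fold_stable (f : Nat → Nat) (u n d : Nat) (h : u < 2 ^ n) : fold f u (n + d) = fold f u n := by
  induction d with
  | zero => rfl
  | succ d ih =>
    rw [← Nat.add_assoc, fold_succ, ih, Nat.testBit_lt_two_pow
      (lt_of_lt_of_le h (Nat.pow_le_pow_right (by norm_num) (by omega)))]; rfl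

theorem tree_succ (leaf : Nat → Nat → Bool) (f : Nat → Nat) (n u s : Nat) :
    tree leaf f (n + 1) u s = (tree leaf f n u s && tree leaf f n (u + 2 ^ n) (s ^^^ f n)) := by
  have : tree leaf f (n + 1) u s = (tree leaf f n u s && strict (Nat.add u (Nat.pow 2 n)) fun u' =>
      strict (Nat.xor s (f n)) fun s' => tree leaf f n u' s') := rfl
  rw [this, strict_eq, strict_eq]; rfl

theorem tree_spec (leaf : Nat → Nat → Bool) (f : Nat → Nat) (n : Nat) : ∀ u s,
    tree leaf f n u s = true → ∀ w, w < 2 ^ n → leaf (u + w) (s ^^^ fold f w n) = true := by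
  induction n with
  | zero =>
    intro u s h w hw
    have : w = 0 := by simpa using hw
    subst this
    have e : fold f 0 0 = 0 := rfl
    rw [e, Nat.xor_zero, Nat.add_zero]; exact h
  | succ n ih =>
    intro u s h w hw
    rw [tree_succ, Bool.and_eq_true] at h
    by_cases hlt : w < 2 ^ n
    · rw [fold_stable f w n 1 hlt]; exact ih u s h.1 w hlt
    · obtain ⟨w', rfl⟩ : ∃ w', w = 2 ^ n + w' := ⟨w - 2 ^ n, by omega⟩
      have hw' : w' < 2 ^ n := by rw [pow_succ] at hw; omega
      have := ih _ _ h.2 w' hw'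
      have e1 : (2 ^ n + w').testBit n = true := by
        rw [Nat.testBit_two_pow_add_eq]
        rw [Nat.testBit_lt_two_pow hw']; rfl
      have e2 : fold f (2 ^ n + w') n = fold f w' n := by
        apply fold_congr
        · intro k hk; exact Nat.testBit_two_pow_add_gt hk w'
        · intros; rfl
      rw [fold_succ, e1, e2]
      rw [← Nat.add_assoc]
      rw [Nat.xor_assoc, Nat.xor_comm (f n)] at this
      exact this

theorem orN_succ (n : Nat) (f : Nat → Nat) : orN (n + 1) f = f n ||| orN n f := rfl

theorem orN_testBit (n : Nat) (f : Nat → Nat) (j : Nat) :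
    (orN n f).testBit j = true ↔ ∃ k, k < n ∧ (f k).testBit j = true := by
  induction n with
  | zero =>
    have : orN 0 f = 0 := rfl
    rw [this]; simp
  | succ n ih =>
    rw [orN_succ, Nat.testBit_or, Bool.or_eq_true, ih]
    constructor
    · rintro (h | ⟨k, hk, h⟩)
      · exact ⟨n, by omega, h⟩
      · exact ⟨k, by omega, h⟩
    · rintro ⟨k, hk, h⟩
      rcases Nat.lt_succ_iff_lt_or_eq.mp hk with h1 | h1
      · exact Or.inr ⟨k, h1, h⟩
      · subst h1; exact Or.inl h

theorem sub_pow_one (n : Nat) : Nat.sub (Nat.pow 2 n) 1 = 2 ^ n - 1 := rfl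

theorem orN_full {n m : Nat} {f : Nat → Nat} (h : orN n (fun k => Nat.pow 2 (f k)) = 2 ^ m - 1)
    {j : Nat} (hj : j < m) : ∃ k, k < n ∧ f k = j := by
  have : (orN n (fun k => Nat.pow 2 (f k))).testBit j = true := by
    rw [h, Nat.testBit_two_pow_sub_one]; simpa using hj
  obtain ⟨k, hk, e⟩ := (orN_testBit _ _ _).mp this
  refine ⟨k, hk, ?_⟩
  have e' : (2 ^ f k).testBit j = true := e
  rw [Nat.testBit_two_pow] at e'
  simpa using e'

theorem inj_of_surj {n : Nat} {f : Nat → Nat} (hf : ∀ k, k < n → f k < n)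
    (hs : ∀ j, j < n → ∃ k, k < n ∧ f k = j) {a b : Nat} (ha : a < n) (hb : b < n)
    (hab : f a = f b) : a = b := by
  have him : Finset.image f (Finset.range n) = Finset.range n := by
    ext k
    simp only [Finset.mem_image, Finset.mem_range]
    constructor
    · rintro ⟨j, hj, rfl⟩; exact hf j hj
    · intro hk; exact hs k hk
  have : Set.InjOn f (Finset.range n : Set ℕ) := by
    apply Finset.card_image_iff.mp
    rw [him]
  exact this (by simpa using ha) (by simpa using hb) hab

/-- Sign vectors separate the points of a block. -/
theorem lin_inj {O u v : Nat} (hO : O < 276) (hu : u < 2 ^ dim O) (hv : v < 2 ^ dim O)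
    (h : ∀ k, k < 506 → (Mk O).testBit k = true → (Sg O u).testBit k = (Sg O v).testBit k) : u = v := by
  have hw : u ^^^ v < 2 ^ dim O := Nat.xor_lt_two_pow hu hv
  have h1 := allN_spec chk_inj O hO
  rw [strict_eq] at h1
  have h2 := tree_spec _ _ _ _ _ h1 (u ^^^ v) hw
  have e : fold (fun k => sig (ib O k)) (u ^^^ v) (dim O) = lin O (u ^^^ v) := by
    unfold lin
    conv_rhs => rw [show 10 = dim O + (10 - dim O) by have := dim_le O; omega]
    rw [fold_stable _ _ _ _ hw]
  rw [e, Nat.zero_xor, Nat.zero_add] at h2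
  have h3 : Nat.land (Mk O) (lin O (u ^^^ v)) = 0 := by
    apply Nat.eq_of_testBit_eq
    intro k
    have e4 : (Nat.land (Mk O) (lin O (u ^^^ v))).testBit k =
      ((Mk O).testBit k && (lin O (u ^^^ v)).testBit k) := Nat.testBit_and _ _ _
    rw [e4, Nat.zero_testBit]
    cases hm : (Mk O).testBit k
    · rfl
    · have hk : k < 506 := by
        by_contra hcon
        rw [Nat.testBit_lt_two_pow (lt_of_lt_of_le (Mk_lt hO)
          (Nat.pow_le_pow_right (by norm_num) (by omega)))] at hm
        cases hm
      have h5 := h k hk hm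
      have e6 : ∀ w, Sg O w = S0 O ^^^ lin O w := fun w => rfl
      rw [e6, e6, Nat.testBit_xor, Nat.testBit_xor] at h5
      rw [lin_xor, Nat.testBit_xor]
      revert h5
      cases (S0 O).testBit k <;> cases (lin O u).testBit k <;> cases (lin O v).testBit k <;> decide
  rw [h3] at h2
  have h7 : u ^^^ v = 0 := Nat.eq_of_beq_eq_true h2
  exact Nat.xor_eq_zero_iff.mp h7

theorem mask_bit {O k : Nat} (hO : O < 276) (hk : k < 506) :
    (Mk O).testBit k = true ↔ ∀ i, i < 23 → (bs O).testBit i = true → (sig i).testBit k = false := by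
  have h := Nat.eq_of_beq_eq_true (allN_spec chk_mask O hO)
  have aux : ∀ n, (Nat.rec (motive := fun _ => Nat) 0
      (fun i a => cond (bit (bs O) i) (Nat.lor a (sig i)) a) n : Nat).testBit k = true ↔
      ∃ i, i < n ∧ (bs O).testBit i = true ∧ (sig i).testBit k = true := by
    intro n
    induction n with
    | zero => simp
    | succ n ih =>
      simp only []
      rw [bit_eq]
      cases hb : (bs O).testBit n
      · simp only [cond_false]
        rw [ih]
        constructor
        · rintro ⟨i, hi, h1⟩; exact ⟨i, by omega, h1⟩
        · rintro ⟨i, hi, h1, h2⟩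
          refine ⟨i, ?_, h1, h2⟩
          rcases Nat.lt_succ_iff_lt_or_eq.mp hi with h3 | h3
          · exact h3
          · subst h3; rw [hb] at h1; cases h1
      · simp only [cond_true]
        have e : ∀ a b : Nat, (Nat.lor a b).testBit k = (a.testBit k || b.testBit k) :=
          fun a b => Nat.testBit_or _ _ _
        rw [e, Bool.or_eq_true, ih]
        constructor
        · rintro (⟨i, hi, h1⟩ | h1)
          · exact ⟨i, by omega, h1⟩
          · exact ⟨n, by omega, hb, h1⟩
        · rintro ⟨i, hi, h1, h2⟩
          rcases Nat.lt_succ_iff_lt_or_eq.mp hi with h3 | h3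
          · exact Or.inl ⟨i, h3, h1, h2⟩
          · subst h3; exact Or.inr h2
  have e : ∀ a b : Nat, (Nat.xor a b).testBit k = (a.testBit k ^^ b.testBit k) :=
    fun a b => Nat.testBit_xor _ _ _
  have e2 : (Nat.sub (Nat.pow 2 506) 1).testBit k = true := by
    rw [sub_pow_one, Nat.testBit_two_pow_sub_one]; simpa using hk
  rw [h, e, e2, Bool.true_xor, Bool.not_eq_true', ← Bool.not_eq_true, aux]
  push Not
  simp only [ne_eq, Bool.not_eq_true]

/-! ### Monomial generators -/

/-- All tests for a monomial generator. -/
def ngood (PI IM PO EP : Nat) : Bool :=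
  nchk1 PI && (nchk2 PI PO && (nchk3 PI IM && nchk4 IM PO EP))

section monomial
variable {PI IM PO EP : Nat}

theorem pnt_lt (h : ngood PI IM PO EP = true) {i : Nat} (hi : i < 23) : pnt PI i < 23 := by
  unfold ngood nchk1 at h
  simp only [Bool.and_eq_true] at h
  exact Nat.le_of_ble_eq_true (allN_spec h.1.1 i hi)

theorem pnt_surj (h : ngood PI IM PO EP = true) {j : Nat} (hj : j < 23) :
    ∃ i, i < 23 ∧ pnt PI i = j := by
  unfold ngood nchk1 at h
  simp only [Bool.and_eq_true] at h
  exact orN_full (m := 23) (Nat.eq_of_beq_eq_true h.1.2) hj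

theorem pnt_inj (h : ngood PI IM PO EP = true) {a b : Nat} (ha : a < 23) (hb : b < 23)
    (hab : pnt PI a = pnt PI b) : a = b :=
  inj_of_surj (fun _ hk => pnt_lt h hk) (fun _ hj => pnt_surj h hj) ha hb hab

theorem poc_lt (h : ngood PI IM PO EP = true) {k : Nat} (hk : k < 506) : pocT PO k < 506 := by
  unfold ngood nchk2 at h
  simp only [Bool.and_eq_true] at h
  have := allN_spec h.2.1.1 k hk
  rw [strict_eq, Bool.and_eq_true] at this
  exact Nat.le_of_ble_eq_true this.1

theorem poc_sig (h : ngood PI IM PO EP = true) {k i : Nat} (hk : k < 506) (hi : i < 23) :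
    (sig (pnt PI i)).testBit (pocT PO k) = (sig i).testBit k := by
  unfold ngood nchk2 at h
  simp only [Bool.and_eq_true] at h
  have := allN_spec h.2.1.1 k hk
  rw [strict_eq, Bool.and_eq_true] at this
  have := allN_spec this.2 i hi
  rw [bit_eq, bit_eq] at this
  exact eq_of_beq this

theorem poc_surj (h : ngood PI IM PO EP = true) {j : Nat} (hj : j < 506) :
    ∃ k, k < 506 ∧ pocT PO k = j := by
  unfold ngood nchk2 at h
  simp only [Bool.and_eq_true] at h
  exact orN_full (m := 506) (by rw [Nat.eq_of_beq_eq_true h.2.1.2, sub_pow_one]) hj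

theorem img_props (h : ngood PI IM PO EP = true) {O : Nat} (hO : O < 299) :
    blk (img IM O) < 299 ∧ dim O = dim (blk (img IM O)) ∧ vld (img IM O) = true ∧
    (276 ≤ O → blk (img IM O) = 276 + pnt PI (O - 276)) ∧
    (O < 276 → ∀ i, i < 23 → (bs (blk (img IM O))).testBit (pnt PI i) = (bs O).testBit i) := by
  unfold ngood nchk3 at h
  simp only [Bool.and_eq_true] at h
  have := allN_spec h.2.2.1.1 O hO
  simp only [strict_eq, Bool.and_eq_true] at this
  obtain ⟨h1, h2, h3, h4⟩ := this
  refine ⟨Nat.le_of_ble_eq_true h1, Nat.eq_of_beq_eq_true h2, h3, ?_, ?_⟩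
  · intro h5
    rw [Nat.ble_eq_true_of_le h5] at h4
    exact Nat.eq_of_beq_eq_true h4
  · intro h5 i hi
    rw [ble_false h5, cond_false] at h4
    have := allN_spec h4 i hi
    rw [bit_eq, bit_eq] at this
    exact eq_of_beq this

theorem blkimg_inj (h : ngood PI IM PO EP = true) {O P : Nat} (hO : O < 299) (hP : P < 299)
    (e : blk (img IM O) = blk (img IM P)) : O = P := by
  have h' := h
  unfold ngood nchk3 at h
  simp only [Bool.and_eq_true] at h
  exact inj_of_surj (f := fun O => blk (img IM O)) (fun _ hk => (img_props h' hk).1)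
    (fun _ hj => orN_full (m := 299) ((Nat.eq_of_beq_eq_true h.2.2.1.2).trans (sub_pow_one 299)) hj) hO hP e

theorem blkimg_lt (h : ngood PI IM PO EP = true) {O : Nat} (hO : O < 276) :
    blk (img IM O) < 276 := by
  have h1 := img_props h (O := O) (by omega)
  by_contra hcon
  have : dim O ≠ 0 := by
    rcases lt_or_ge O 23 with h2 | h2
    · rw [dim_monad h2]; norm_num
    · rw [dim_hept h2 hO]; norm_num
  apply this
  rw [h1.2.1, dim_base (by omega)]

theorem hoc_mask {O k : Nat} (h1 : 23 ≤ O) (h2 : O < 276) (hk : (Mk O).testBit k = true) :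
    ∃ t, t < 30 ∧ hoc (O - 23) t = k := by
  have := Nat.eq_of_beq_eq_true (allN_spec chk_hoc (O - 23) (by omega))
  rw [show Nat.add 23 (O - 23) = O by show 23 + (O - 23) = O; omega] at this
  rw [this] at hk
  obtain ⟨t, ht, e⟩ := (orN_testBit _ _ _).mp hk
  refine ⟨t, ht, ?_⟩
  have e' : (2 ^ hoc (O - 23) t).testBit k = true := e
  rw [Nat.testBit_two_pow] at e'
  simpa using e'

theorem img_sign (h : ngood PI IM PO EP = true) {O k : Nat} (hO : O < 276) (hk : k < 506)
    (hm : (Mk O).testBit k = true) :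
    (Sg (blk (img IM O)) (off (img IM O))).testBit (pocT PO k) = (S0 O ^^^ EP).testBit k := by
  unfold ngood nchk4 at h
  simp only [Bool.and_eq_true] at h
  have := allN_spec h.2.2.2 O hO
  simp only [strict_eq] at this
  rcases lt_or_ge O 23 with h2 | h2
  · rw [ble_false h2, cond_false] at this
    have := allN_spec this k hk
    rw [bit_eq, hm, bit_eq, bit_eq] at this
    exact eq_of_beq this
  · rw [Nat.ble_eq_true_of_le h2, cond_true] at this
    obtain ⟨t, ht, rfl⟩ := hoc_mask h2 hO hm
    have := allN_spec this t ht
    rw [bit_eq, bit_eq] at this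
    exact eq_of_beq this

theorem na_eq (PI IM c : Nat) : na PI IM c = mk (blk (img IM (blk c))) (off (img IM (blk c)) ^^^
    fold (fun k => tr (blk (img IM (blk c))) (pnt PI (ib (blk c) k))) (off c) 10) := by
  unfold na; simp only [strict_eq]; rfl

theorem fold_lt (f : Nat → Nat) (u n d : Nat) (hf : ∀ k, k < n → u.testBit k = true → f k < 2 ^ d) :
    fold f u n < 2 ^ d := by
  induction n with
  | zero => have : fold f u 0 = 0 := rfl
            rw [this]; positivity
  | succ n ih =>
    have ih' := ih (fun k hk => hf k (by omega))
    rw [fold_succ]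
    cases e : u.testBit n
    · exact ih'
    · exact Nat.xor_lt_two_pow ih' (hf n (by omega) e)

theorem testBit_dim {u d k : Nat} (hu : u < 2 ^ d) (hk : u.testBit k = true) : k < d := by
  by_contra hcon
  rw [Nat.testBit_lt_two_pow (lt_of_lt_of_le hu (Nat.pow_le_pow_right (by norm_num) (by omega)))] at hk
  cases hk

theorem blk_na (PI IM c : Nat) : blk (na PI IM c) = blk (img IM (blk c)) := by
  rw [na_eq, blk_mk]
  exact Nat.xor_lt_two_pow (n := 10) (off_lt _) (fold_lt _ _ _ _ (fun _ _ _ => tr_lt' _ _))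

theorem off_na (PI IM c : Nat) : off (na PI IM c) = off (img IM (blk c)) ^^^
    fold (fun k => tr (blk (img IM (blk c))) (pnt PI (ib (blk c) k))) (off c) 10 := by
  rw [na_eq, off_mk]
  exact Nat.xor_lt_two_pow (n := 10) (off_lt _) (fold_lt _ _ _ _ (fun _ _ _ => tr_lt' _ _))

theorem vld_na (h : ngood PI IM PO EP = true) {c : Nat} (hc : vld c = true) :
    vld (na PI IM c) = true := by
  have h0 := (vld_iff c).mp hc
  have h1 := img_props h h0.1
  rw [vld_iff, blk_na, off_na]
  refine ⟨h1.1, Nat.xor_lt_two_pow ((vld_iff _).mp h1.2.2.1).2 (fold_lt _ _ _ _ ?_)⟩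
  intro k _ hk
  exact tr_lt h1.1 (pnt_lt h (ib_lt h0.1 (testBit_dim h0.2 hk)))

theorem lin_fold (h : ngood PI IM PO EP = true) {O P : Nat} (hO : O < 276) (hP : P < 276) {j : Nat}
    (hj : j < 506) (hm : (Mk P).testBit (pocT PO j) = true) (u : Nat) (hu : u < 2 ^ dim O) (n : Nat) :
    (lin P (fold (fun k => tr P (pnt PI (ib O k))) u n)).testBit (pocT PO j) =
    (fold (fun k => sig (ib O k)) u n).testBit j := by
  induction n with
  | zero =>
    have : ∀ f, fold f u 0 = 0 := fun f => rfl
    rw [this, this, lin_zero]; simp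
  | succ n ih =>
    rw [fold_succ, fold_succ]
    cases e : u.testBit n
    · exact ih
    · simp only [cond_true]
      have hi := ib_lt (by omega : O < 299) (testBit_dim hu e)
      rw [lin_xor, Nat.testBit_xor, Nat.testBit_xor, ih, ← poc_sig h hj hi]
      congr 1
      have := congrArg (fun x => Nat.testBit x (pocT PO j)) (lin_tr hP (pnt_lt h hi))
      simp only [Nat.testBit_and, Nat.testBit_xor, hm, Nat.zero_testBit, Bool.and_true] at this
      simpa using this

theorem mask_na (h : ngood PI IM PO EP = true) {O k : Nat} (hO : O < 276) (hk : k < 506) :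
    (Mk (blk (img IM O))).testBit (pocT PO k) = (Mk O).testBit k := by
  rw [Bool.eq_iff_iff, mask_bit (blkimg_lt h hO) (poc_lt h hk), mask_bit hO hk]
  have h1 := (img_props h (by omega : O < 299)).2.2.2.2 hO
  constructor
  · intro h2 i hi hb
    rw [← poc_sig h hk hi]
    exact h2 _ (pnt_lt h hi) (by rw [h1 i hi, hb])
  · intro h2 i hi hb
    obtain ⟨i, hi', rfl⟩ := pnt_surj h hi
    rw [poc_sig h hk hi']
    exact h2 i hi' (by rw [← h1 i hi', hb])

/-- The sign identity. -/
theorem sign_na (h : ngood PI IM PO EP = true) {c k : Nat} (hc : vld c = true) (hO : blk c < 276)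
    (hk : k < 506) (hm : (Mk (blk c)).testBit k = true) :
    (Sg (blk (na PI IM c)) (off (na PI IM c))).testBit (pocT PO k) =
      (Sg (blk c) (off c) ^^^ EP).testBit k := by
  rw [blk_na, off_na, Sg_xor, Nat.testBit_xor, img_sign h hO hk hm,
    lin_fold h hO (blkimg_lt h hO) hk (by rw [mask_na h hO hk, hm]) _ ((vld_iff c).mp hc).2]
  have e : Sg (blk c) (off c) = S0 (blk c) ^^^ fold (fun k => sig (ib (blk c) k)) (off c) 10 := rfl
  rw [e]
  simp only [Nat.testBit_xor]
  cases (S0 (blk c)).testBit k <;> cases EP.testBit k <;> simp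

theorem adj_na (h : ngood PI IM PO EP = true) {c d : Nat} (hc : vld c = true) (hd : vld d = true) :
    adj (na PI IM c) (na PI IM d) = adj c d := by
  have vc := (vld_iff c).mp hc
  have vd := (vld_iff d).mp hd
  have base : ∀ {c}, 276 ≤ blk c → vld c = true → blk (na PI IM c) = 276 + pnt PI (blk c - 276) := by
    intro c h1 h2
    rw [blk_na, (img_props h ((vld_iff c).mp h2).1).2.2.2.1 h1]
  have nbase : ∀ {c}, blk c < 276 → blk (na PI IM c) < 276 := by
    intro c h1; rw [blk_na]; exact blkimg_lt h h1
  rcases lt_or_ge (blk c) 276 with h1 | h1 <;> rcases lt_or_ge (blk d) 276 with h2 | h2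
  · rw [adj_nn (nbase h1) (nbase h2), adj_nn h1 h2, adjM_eq, adjM_eq]
    have key1 : popc (Mk (blk (na PI IM c)) &&& Mk (blk (na PI IM d))) =
        popc (Mk (blk c) &&& Mk (blk d)) := by
      apply popc_perm _ _ (lt_of_le_of_lt Nat.and_le_left (Mk_lt h1))
        (lt_of_le_of_lt Nat.and_le_left (Mk_lt (nbase h1))) (pocT PO) (fun k hk => poc_lt h hk)
        (fun k hk => poc_surj h hk)
      intro k hk
      rw [Nat.testBit_and, Nat.testBit_and, blk_na, blk_na, mask_na h h1 hk, mask_na h h2 hk]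
    have key2 : popc (Mk (blk (na PI IM c)) &&& Mk (blk (na PI IM d)) &&&
          (Sg (blk (na PI IM c)) (off (na PI IM c)) ^^^ Sg (blk (na PI IM d)) (off (na PI IM d)))) =
        popc (Mk (blk c) &&& Mk (blk d) &&& (Sg (blk c) (off c) ^^^ Sg (blk d) (off d))) := by
      apply popc_perm _ _ (lt_of_le_of_lt Nat.and_le_left (lt_of_le_of_lt Nat.and_le_left (Mk_lt h1)))
        (lt_of_le_of_lt Nat.and_le_left (lt_of_le_of_lt Nat.and_le_left (Mk_lt (nbase h1)))) (pocT PO)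
        (fun k hk => poc_lt h hk) (fun k hk => poc_surj h hk)
      intro k hk
      have m1 : (Mk (blk (na PI IM c))).testBit (pocT PO k) = (Mk (blk c)).testBit k := by
        rw [blk_na, mask_na h h1 hk]
      have m2 : (Mk (blk (na PI IM d))).testBit (pocT PO k) = (Mk (blk d)).testBit k := by
        rw [blk_na, mask_na h h2 hk]
      simp only [Nat.testBit_and, Nat.testBit_xor, m1, m2]
      cases e1 : (Mk (blk c)).testBit k
      · rfl
      cases e2 : (Mk (blk d)).testBit k
      · rfl
      rw [sign_na h hc h1 hk e1, sign_na h hd h2 hk e2]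
      simp only [Nat.testBit_xor]
      cases EP.testBit k <;> simp
    rw [key1, key2]
  · rw [adj_nb (nbase h1) (by rw [base h2 hd]; omega), adj_nb h1 h2, base h2 hd, blk_na,
      show 276 + pnt PI (blk d - 276) - 276 = pnt PI (blk d - 276) by omega,
      (img_props h vc.1).2.2.2.2 h1 _ (by omega)]
  · rw [adj_bn (by rw [base h1 hc]; omega) (nbase h2), adj_bn h1 h2, base h1 hc, blk_na,
      show 276 + pnt PI (blk c - 276) - 276 = pnt PI (blk c - 276) by omega,
      (img_props h vd.1).2.2.2.2 h2 _ (by omega)]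
  · rw [adj_bb (by rw [base h1 hc]; omega) (by rw [base h2 hd]; omega), adj_bb h1 h2, blk_na, blk_na]
    congr 1
    rw [Bool.eq_iff_iff, decide_eq_true_iff, decide_eq_true_iff]
    exact ⟨fun e => blkimg_inj h vc.1 vd.1 e, fun e => by rw [e]⟩

theorem na_inj (h : ngood PI IM PO EP = true) {c d : Nat} (hc : vld c = true) (hd : vld d = true)
    (e : na PI IM c = na PI IM d) : c = d := by
  have vc := (vld_iff c).mp hc
  have vd := (vld_iff d).mp hd
  have hb : blk c = blk d := by
    have := congrArg blk e
    rw [blk_na, blk_na] at this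
    exact blkimg_inj h vc.1 vd.1 this
  apply code_ext hb
  rcases lt_or_ge (blk c) 276 with h1 | h1
  · apply lin_inj h1 vc.2 (by rw [hb]; exact vd.2)
    intro k hk hm
    have e1 := sign_na h hc h1 hk hm
    have e2 := sign_na h hd (by rwa [← hb]) hk (by rwa [← hb])
    rw [← e, e1, ← hb] at e2
    simp only [Nat.testBit_xor] at e2
    simpa using e2
  · have a1 := vc.2
    have a2 := vd.2
    rw [dim_base h1] at a1
    rw [dim_base (by rwa [← hb])] at a2
    omega

/-- Equivariance with respect to the base transpositions. -/
theorem na_ea (h : ngood PI IM PO EP = true) {c i : Nat} (hc : vld c = true) (hi : i < 23) :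
    na PI IM (ea i c) = ea (pnt PI i) (na PI IM c) := by
  have vc := (vld_iff c).mp hc
  have hb : blk (na PI IM (ea i c)) = blk (ea (pnt PI i) (na PI IM c)) := by
    rw [blk_na, blk_ea, blk_ea, blk_na]
  have v1 := (vld_iff _).mp (vld_na h (vld_ea hi hc))
  have v2 := (vld_iff _).mp (vld_ea (pnt_lt h hi) (vld_na h hc))
  apply code_ext hb
  rcases lt_or_ge (blk c) 276 with h1 | h1
  · have h3 : blk (na PI IM (ea i c)) < 276 := by rw [blk_na, blk_ea]; exact blkimg_lt h h1
    apply lin_inj h3 v1.2 (by rw [hb]; exact v2.2)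
    intro k hk hm
    obtain ⟨j, hj, rfl⟩ := poc_surj h hk
    have hm' : (Mk (blk c)).testBit j = true := by
      rw [← mask_na h h1 hj]; rw [blk_na, blk_ea] at hm; exact hm
    rw [sign_na h (vld_ea hi hc) (by rwa [blk_ea]) hj (by rwa [blk_ea]), hb, off_ea, Sg_xor, blk_ea,
      blk_ea, off_ea, Sg_xor]
    have h4 := sign_na h hc h1 hj hm'
    rw [Nat.testBit_xor _ (lin _ _), h4]
    have h5 : blk (na PI IM c) < 276 := by rw [blk_na]; exact blkimg_lt h h1
    have e1 := congrArg (fun x => Nat.testBit x (pocT PO j)) (lin_tr h5 (pnt_lt h hi))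
    have e2 := congrArg (fun x => Nat.testBit x j) (lin_tr h1 hi)
    have hm'' : (Mk (blk (na PI IM c))).testBit (pocT PO j) = true := by
      rw [hb, blk_ea] at hm; exact hm
    simp only [Nat.testBit_and, Nat.testBit_xor, hm', hm'', Nat.zero_testBit, Bool.and_true,
      poc_sig h hj hi] at e1 e2
    simp only [Nat.testBit_xor]
    revert e1 e2
    cases (lin (blk (na PI IM c)) (tr (blk (na PI IM c)) (pnt PI i))).testBit (pocT PO j) <;>
    cases (lin (blk c) (tr (blk c) i)).testBit j <;> cases (sig i).testBit j <;>
    cases EP.testBit j <;> simp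
  · have a1 := v1.2
    have a2 := v2.2
    have h6 : 276 ≤ blk (na PI IM (ea i c)) := by
      rw [blk_na, blk_ea, (img_props h vc.1).2.2.2.1 h1]; omega
    rw [dim_base h6] at a1
    rw [dim_base (by rwa [← hb])] at a2
    omega

theorem na_base (h : ngood PI IM PO EP = true) {i : Nat} (hi : i < 23) :
    na PI IM (mk (276 + i) 0) = mk (276 + pnt PI i) 0 := by
  have hv : vld (mk (276 + i) 0) = true := vld_mk (by omega) (by positivity)
  have hb : blk (mk (276 + i) 0) = 276 + i := blk_mk (by norm_num)
  have v := (vld_iff _).mp (vld_na h hv)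
  have e : blk (na PI IM (mk (276 + i) 0)) = 276 + pnt PI i := by
    rw [blk_na, hb, (img_props h (by omega)).2.2.2.1 (by omega), show 276 + i - 276 = i by omega]
  apply code_ext
  · rw [e, blk_mk (by norm_num)]
  · rw [e, dim_base (by omega)] at v
    rw [off_mk (by norm_num)]; omega

end monomial



/-! ### The extra transposition -/

theorem goodA : ngood PIA IMA POA EPA = true := nchkA
theorem goodB : ngood PIB IMB POB EPB = true := nchkB
theorem goodR : ngood PIR IMR POR EPR = true := nchkR

/-- Membership in the first heptad. -/
def hp (i : Nat) : Prop := hpm.testBit i = true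

theorem chk_hpAB : allN 23 (fun i => cond (bit hpm i)
    (bit hpm (pnt PIA i) && (bit hpm (pnt PIB i) && Nat.beq (tr 23 i) 0)) true) = true := by
  decide +kernel

/-- Classes of blocks. -/
def cls (O : Nat) : Nat := cond (Nat.ble 276 O) 0 (cond (Nat.beq O 23) 1 (cond (Nat.ble 23 O) 2
  (cond (bit hpm O) 3 4)))

theorem chk_cls : allN 299 (fun O => Nat.beq (cls (blk (img IMA O))) (cls O) &&
    Nat.beq (cls (blk (img IMB O))) (cls O)) = true := by
  decide +kernel

theorem low_le {O : Nat} (h : O < 299) : low O ≤ dim O := by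
  have := allN_spec (allN_spec chk_pr O h) 0 (Nat.pow_pos (by norm_num))
  simp only [Bool.and_eq_true] at this
  exact Nat.le_of_ble_eq_true this.2.1

theorem pr_spec {O v : Nat} (h : O < 299) (hv : v < 2 ^ (dim O - low O)) :
    pb O + v < 1207 ∧ pr (pb O + v) = mk O (v * 2 ^ low O) := by
  have := allN_spec (allN_spec chk_pr O h) v hv
  simp only [Bool.and_eq_true] at this
  exact ⟨Nat.le_of_ble_eq_true this.1, Nat.eq_of_beq_eq_true this.2.2⟩

theorem tr_low {O i : Nat} (h : O < 299) (hi : i < 23) (hh : hp i) : tr O i < 2 ^ low O := by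
  have := allN_spec chk_low O h
  simp only [Bool.and_eq_true] at this
  have := allN_spec this.1 i hi
  rw [bit_eq, hh] at this
  exact Nat.le_of_ble_eq_true this

theorem ib_low {O k : Nat} (h : O < 299) (hk : k < low O) : hp (ib O k) := by
  have := allN_spec chk_low O h
  simp only [Bool.and_eq_true] at this
  have := allN_spec this.2 k hk
  rw [bit_eq] at this
  exact this

theorem pn_eq (c : Nat) : pn c = pb (blk c) + off c >>> low (blk c) := by
  unfold pn; rw [strict_eq]; rfl

theorem hi_lt {O u : Nat} (hO : O < 299) (hu : u < 2 ^ dim O) : u >>> low O < 2 ^ (dim O - low O) := by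
  rw [Nat.shiftRight_eq_div_pow]
  apply Nat.div_lt_of_lt_mul
  rw [← pow_add, Nat.add_sub_cancel' (low_le hO)]; exact hu

theorem split_low (u l : Nat) : (u >>> l * 2 ^ l) ^^^ (u % 2 ^ l) = u := by
  rw [Nat.shiftRight_eq_div_pow]
  have h : u % 2 ^ l < 2 ^ l := Nat.mod_lt _ (by positivity)
  apply Nat.eq_of_testBit_eq
  intro k
  rw [Nat.testBit_xor, Nat.testBit_mul_two_pow, Nat.testBit_mod_two_pow, Nat.testBit_div_two_pow]
  rcases Nat.lt_or_ge k l with h1 | h1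
  · simp [h1, Nat.not_le.mpr h1]
  · simp [h1, Nat.not_lt.mpr h1]

theorem pn_lt {c : Nat} (hc : vld c = true) : pn c < 1207 := by
  have h := (vld_iff c).mp hc
  rw [pn_eq]
  exact (pr_spec h.1 (hi_lt h.1 h.2)).1

theorem pr_pn {c : Nat} (hc : vld c = true) :
    pr (pn c) = mk (blk c) (off c >>> low (blk c) * 2 ^ low (blk c)) := by
  have h := (vld_iff c).mp hc
  rw [pn_eq]
  exact (pr_spec h.1 (hi_lt h.1 h.2)).2

/-- Spreading a property over a piece. -/
theorem piece_ind (Q : Nat → Prop) (hQ : ∀ i c, hp i → i < 23 → vld c = true → Q c → Q (ea i c))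
    {c : Nat} (hc : vld c = true) (h0 : Q (pr (pn c))) : Q c := by
  have h := (vld_iff c).mp hc
  rw [pr_pn hc] at h0
  have hl : off c >>> low (blk c) * 2 ^ low (blk c) < 2 ^ dim (blk c) := by
    refine lt_of_le_of_lt ?_ h.2
    rw [Nat.shiftRight_eq_div_pow]; exact Nat.div_mul_le_self _ _
  have := ea_ind hp Q h.1 hQ (low (blk c)) (low_le h.1) (fun k hk => ib_low h.1 hk)
    (off c % 2 ^ low (blk c)) _ (Nat.mod_lt _ (by positivity)) hl h0
  rwa [split_low, mk_blk_off] at this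

/-- Image of a piece representative. -/
def tt (n : Nat) : Nat := Nat.mod (Nat.shiftRight TTt (Nat.mul 19 n)) 524288

theorem Ta_eq (c : Nat) : Ta c = mk (blk (tt (pn c))) (off (tt (pn c)) ^^^
    fold (fun k => tr (blk (tt (pn c))) (ib (blk c) k)) (off c % 2 ^ low (blk c)) 10) := by
  unfold Ta; simp only [strict_eq]; rw [pn_eq]; rfl

theorem blk_Ta (c : Nat) : blk (Ta c) = blk (tt (pn c)) := by
  rw [Ta_eq, blk_mk]
  exact Nat.xor_lt_two_pow (n := 10) (off_lt _) (fold_lt _ _ _ _ (fun _ _ _ => tr_lt' _ _))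

theorem off_Ta (c : Nat) : off (Ta c) = off (tt (pn c)) ^^^
    fold (fun k => tr (blk (tt (pn c))) (ib (blk c) k)) (off c % 2 ^ low (blk c)) 10 := by
  rw [Ta_eq, off_mk]
  exact Nat.xor_lt_two_pow (n := 10) (off_lt _) (fold_lt _ _ _ _ (fun _ _ _ => tr_lt' _ _))

theorem xor_shift {u t l : Nat} (h : t < 2 ^ l) : (u ^^^ t) >>> l = u >>> l := by
  apply Nat.eq_of_testBit_eq
  intro k
  rw [Nat.testBit_shiftRight, Nat.testBit_shiftRight, Nat.testBit_xor,
    Nat.testBit_lt_two_pow (x := t) (lt_of_lt_of_le h (Nat.pow_le_pow_right (by norm_num) (by omega)))]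
  simp

theorem xor_mod_pow {u t l : Nat} (h : t < 2 ^ l) : (u ^^^ t) % 2 ^ l = (u % 2 ^ l) ^^^ t := by
  rw [Nat.xor_mod_two_pow, Nat.mod_eq_of_lt h]

theorem pn_ea {c i : Nat} (hc : vld c = true) (hi : i < 23) (hh : hp i) : pn (ea i c) = pn c := by
  have h := (vld_iff c).mp hc
  rw [pn_eq, pn_eq, blk_ea, off_ea, xor_shift (tr_low h.1 hi hh)]

theorem pr_vld {p : Nat} (hp : p < 1207) : vld (pr p) = true := by
  have := allN_spec chk_T1 p hp
  simp only [strict_eq, Bool.and_eq_true] at this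
  exact this.1

theorem low10 (O : Nat) {u : Nat} (hu : u < 1024) :
    off (mk O (u >>> low O * 2 ^ low O)) = u >>> low O * 2 ^ low O := by
  apply off_mk
  refine lt_of_le_of_lt ?_ hu
  rw [Nat.shiftRight_eq_div_pow]; exact Nat.div_mul_le_self _ _

theorem blk_pr_pn {c : Nat} (hc : vld c = true) : blk (pr (pn c)) = blk c := by
  rw [pr_pn hc, blk_mk]
  refine lt_of_le_of_lt ?_ (off_lt c)
  rw [Nat.shiftRight_eq_div_pow]; exact Nat.div_mul_le_self _ _

theorem pn_pr_pn {c : Nat} (hc : vld c = true) : pn (pr (pn c)) = pn c := by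
  have h := (vld_iff c).mp hc
  rw [pn_eq (pr (pn c)), blk_pr_pn hc, pn_eq c]
  congr 1
  rw [← pn_eq c, pr_pn hc, low10 _ (off_lt c), Nat.shiftRight_eq_div_pow (_ * _),
    Nat.mul_div_cancel _ (by positivity)]

theorem Ta_ea {c i : Nat} (hc : vld c = true) (hi : i < 23) (hh : hp i) :
    Ta (ea i c) = ea i (Ta c) := by
  have h := (vld_iff c).mp hc
  have hl := tr_low h.1 hi hh
  apply code_ext
  · rw [blk_Ta, blk_ea, blk_Ta, pn_ea hc hi hh]
  · rw [off_Ta, off_ea i (Ta c), off_Ta, pn_ea hc hi hh, blk_Ta, blk_ea, off_ea, xor_mod_pow hl,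
      fold_xor, Nat.xor_assoc]
    congr 2
    have := allN_spec chk_Tlin (pn c) (pn_lt hc)
    simp only [strict_eq] at this
    have := allN_spec this i hi
    rw [bit_eq, hh, blk_Ta, blk_pr_pn hc, pn_pr_pn hc] at this
    exact Nat.eq_of_beq_eq_true this

theorem T1 {p : Nat} (h : p < 1207) : vld (Ta (pr p)) = true ∧ Ta (Ta (pr p)) = pr p ∧
    Ta (na PIA IMA (pr p)) = na PIA IMA (Ta (pr p)) ∧
    Ta (na PIB IMB (pr p)) = na PIB IMB (Ta (pr p)) := by
  have := allN_spec chk_T1 p h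
  simp only [strict_eq, Bool.and_eq_true] at this
  obtain ⟨_, h2, h3, h4, h5⟩ := this
  exact ⟨h2, Nat.eq_of_beq_eq_true h3, Nat.eq_of_beq_eq_true h4, Nat.eq_of_beq_eq_true h5⟩

theorem vld_Ta {c : Nat} (hc : vld c = true) : vld (Ta c) = true := by
  apply piece_ind (fun c => vld (Ta c) = true) _ hc (T1 (pn_lt hc)).1
  intro i c hh hi hc h
  rw [Ta_ea hc hi hh]; exact vld_ea hi h

theorem Ta_Ta {c : Nat} (hc : vld c = true) : Ta (Ta c) = c := by
  apply piece_ind (fun c => Ta (Ta c) = c) _ hc (T1 (pn_lt hc)).2.1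
  intro i c hh hi hc h
  rw [Ta_ea hc hi hh, Ta_ea (vld_Ta hc) hi hh, h]

theorem hpAB {i : Nat} (hi : i < 23) (hh : hp i) : hp (pnt PIA i) ∧ hp (pnt PIB i) ∧ tr 23 i = 0 := by
  have := allN_spec chk_hpAB i hi
  rw [bit_eq, hh, cond_true, Bool.and_eq_true, Bool.and_eq_true, bit_eq, bit_eq] at this
  exact ⟨this.1, this.2.1, Nat.eq_of_beq_eq_true this.2.2⟩

theorem Ta_A {c : Nat} (hc : vld c = true) : Ta (na PIA IMA c) = na PIA IMA (Ta c) := by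
  apply piece_ind (fun c => Ta (na PIA IMA c) = na PIA IMA (Ta c)) _ hc (T1 (pn_lt hc)).2.2.1
  intro i c hh hi hc h
  rw [Ta_ea hc hi hh, na_ea goodA (vld_Ta hc) hi, na_ea goodA hc hi,
    Ta_ea (vld_na goodA hc) (pnt_lt goodA hi) (hpAB hi hh).1, h]

theorem Ta_B {c : Nat} (hc : vld c = true) : Ta (na PIB IMB c) = na PIB IMB (Ta c) := by
  apply piece_ind (fun c => Ta (na PIB IMB c) = na PIB IMB (Ta c)) _ hc (T1 (pn_lt hc)).2.2.2
  intro i c hh hi hc h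
  rw [Ta_ea hc hi hh, na_ea goodB (vld_Ta hc) hi, na_ea goodB hc hi,
    Ta_ea (vld_na goodB hc) (pnt_lt goodB hi) (hpAB hi hh).2.1, h]

/-- `T` preserves the adjacency of `y` and `z`. -/
def Rel (y z : Nat) : Prop := adj y z = true → adj (Ta y) (Ta z) = true

theorem Rel.symm {y z : Nat} (h : Rel y z) : Rel z y := by
  intro e; rw [adj_symm] at e ⊢; exact h e

theorem Rel_ea {y z i : Nat} (hy : vld y = true) (hz : vld z = true) (hi : i < 23) (hh : hp i)
    (h : Rel y z) : Rel (ea i y) (ea i z) := by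
  intro e
  rw [adj_ea hi] at e
  rw [Ta_ea hy hi hh, Ta_ea hz hi hh, adj_ea hi]
  exact h e

theorem Rel_of_A {y z : Nat} (hy : vld y = true) (hz : vld z = true)
    (h : Rel (na PIA IMA y) (na PIA IMA z)) : Rel y z := by
  intro e
  rw [← adj_na goodA hy hz] at e
  have := h e
  rwa [Ta_A hy, Ta_A hz, adj_na goodA (vld_Ta hy) (vld_Ta hz)] at this

theorem Rel_of_B {y z : Nat} (hy : vld y = true) (hz : vld z = true)
    (h : Rel (na PIB IMB y) (na PIB IMB z)) : Rel y z := by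
  intro e
  rw [← adj_na goodB hy hz] at e
  have := h e
  rwa [Ta_B hy, Ta_B hz, adj_na goodB (vld_Ta hy) (vld_Ta hz)] at this

/-- Points fixed by the first heptad group. -/
theorem Rel_fixed {y : Nat} (hy : vld y = true) (hf : ∀ i, i < 23 → hp i → ea i y = y)
    (h : allN 1207 (fun p => strict (pr p) fun c => cond (adj y c) (adj (Ta y) (Ta c)) true) = true)
    {z : Nat} (hz : vld z = true) : Rel y z := by
  apply piece_ind (fun z => Rel y z) _ hz
  · have := allN_spec h (pn z) (pn_lt hz)
    rw [strict_eq] at this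
    intro e
    rw [e] at this
    exact this
  · intro i z hh hi hz h
    have := Rel_ea hy hz hi hh h
    rwa [hf i hi hh] at this

theorem Rel_scan {y lo n skip z : Nat} (h : scanT y lo n skip = true) (hy : blk y < 276)
    (hz : vld z = true) (hz' : blk z < 276) (h1 : lo ≤ blk z) (h2 : blk z < lo + n)
    (h3 : skip.testBit (blk z) = false) : Rel y z := by
  intro e
  unfold scanT at h
  simp only [strict_eq] at h
  have h4 := allN_spec h (blk z - lo) (by omega)
  rw [show Nat.add lo (blk z - lo) = blk z by show lo + (blk z - lo) = blk z; omega] at h4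
  rw [bit_eq, h3, Bool.false_or] at h4
  have v := (vld_iff z).mp hz
  rw [adj_nn hy hz', adjM_eq] at e
  change (cond (Nat.beq (tm (popc (Mk (blk y) &&& Mk (blk z)))) 0) true _) = true at h4
  cases h5 : Nat.beq (tm (popc (Mk (blk y) &&& Mk (blk z)))) 0
  · rw [h5, cond_false] at h4
    have h6 := tree_spec _ _ _ _ _ h4 (off z) v.2
    rw [Nat.zero_add, mk_blk_off] at h6
    have h7 : fold (fun k => sig (ib (blk z) k)) (off z) (dim (blk z)) = lin (blk z) (off z) := by
      unfold lin
      conv_rhs => rw [show 10 = dim (blk z) + (10 - dim (blk z)) by have := dim_le (blk z); omega]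
      rw [fold_stable _ _ _ _ v.2]
    have h8 : adjS (Nat.land (Mk (blk y)) (Mk (blk z))) (tm (popc (Nat.land (Mk (blk y)) (Mk (blk z)))))
        ((Nat.xor (Sg (blk y) (off y)) (S0 (blk z))) ^^^ fold (fun k => sig (ib (blk z) k)) (off z) (dim (blk z)))
        = true := by
      rw [h7]
      unfold adjS
      rw [bit_eq, ← e]
      congr 2
      have : (Sg (blk y) (off y) ^^^ S0 (blk z)) ^^^ lin (blk z) (off z) =
        Sg (blk y) (off y) ^^^ Sg (blk z) (off z) := Nat.xor_assoc _ _ _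
      rw [← this]; rfl
    rw [h8] at h6
    exact h6
  · rw [Nat.eq_of_beq_eq_true h5] at e
    simp at e

/-- Which pairs of classes are covered directly. -/
def okc (a b : Nat) : Prop := a = 0 ∨ a = 1 ∨ (a = 2 ∧ b = 2) ∨ (a = 3 ∧ 2 ≤ b) ∨ (a = 4 ∧ (b = 2 ∨ b = 4))

theorem cls_lt {O : Nat} : cls O < 5 := by
  unfold cls
  cases Nat.ble 276 O <;> cases Nat.beq O 23 <;> cases Nat.ble 23 O <;> cases bit hpm O <;> simp

theorem cls_ge2 {O : Nat} (h : 2 ≤ cls O) : O < 276 := by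
  by_contra hcon
  unfold cls at h
  rw [Nat.ble_eq_true_of_le (by omega)] at h
  simp at h

theorem cls_2 {O : Nat} (h : cls O = 2) : 24 ≤ O ∧ O < 276 := by
  refine ⟨?_, cls_ge2 (by omega)⟩
  unfold cls at h
  by_contra hcon
  rw [ble_false (cls_ge2 (O := O) (by unfold cls; omega))] at h
  cases h1 : Nat.beq O 23
  · have : O ≠ 23 := fun e => by rw [e] at h1; cases h1
    rw [h1, ble_false (show O < 23 by omega)] at h
    revert h; cases bit hpm O <;> simp
  · rw [h1] at h; simp at h

theorem cls_4 {O : Nat} (h : cls O = 4) : hpm.testBit O = false := by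
  unfold cls at h
  rw [← bit_eq]
  cases h1 : bit hpm O
  · rfl
  · rw [h1] at h
    revert h
    cases Nat.ble 276 O <;> cases Nat.beq O 23 <;> cases Nat.ble 23 O <;> simp

theorem chk_skip : Nat.ble (Nat.succ hpm) (Nat.pow 2 23) = true := by decide +kernel

theorem hpm_hept {O : Nat} (h : 23 ≤ O) : hpm.testBit O = false :=
  Nat.testBit_lt_two_pow (lt_of_lt_of_le (Nat.le_of_ble_eq_true chk_skip)
    (Nat.pow_le_pow_right (by norm_num) h))

def QT (y : Nat) : Prop := ∀ z, vld z = true → okc (cls (blk y)) (cls (blk z)) → Rel y z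

theorem QT_ea (i y : Nat) (hh : hp i) (hi : i < 23) (hy : vld y = true) (h : QT y) : QT (ea i y) := by
  intro z hz ho
  rw [blk_ea] at ho
  have := Rel_ea hy (vld_ea hi hz) hi hh (h (ea i z) (vld_ea hi hz) (by rwa [blk_ea]))
  rwa [ea_ea] at this

theorem cls_A {c : Nat} (hc : vld c = true) : cls (blk (na PIA IMA c)) = cls (blk c) := by
  have := allN_spec chk_cls _ ((vld_iff c).mp hc).1
  rw [Bool.and_eq_true] at this
  rw [blk_na]; exact Nat.eq_of_beq_eq_true this.1

theorem cls_B {c : Nat} (hc : vld c = true) : cls (blk (na PIB IMB c)) = cls (blk c) := by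
  have := allN_spec chk_cls _ ((vld_iff c).mp hc).1
  rw [Bool.and_eq_true] at this
  rw [blk_na]; exact Nat.eq_of_beq_eq_true this.2

theorem QT_rep {c : Nat} (hc : vld c = true) (h : isRep c = true) : QT c := by
  have v := (vld_iff c).mp hc
  unfold isRep at h
  simp only [Bool.or_eq_true, Nat.beq_eq] at h
  have c23 : ∀ y, (y = 23552 ∨ y = 23553 ∨ y = 23555) → ∀ i, i < 23 → hp i → ea i y = y := by
    intro y hy i hi hh
    have hb : blk y = 23 := by rcases hy with rfl | rfl | rfl <;> rfl
    apply code_ext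
    · rw [blk_ea]
    · rw [off_ea, hb, (hpAB hi hh).2.2]; simp
  have t23 := chk_T23
  simp only [strict_eq, Bool.and_eq_true] at t23
  rcases h with h | h | h | h | h | h | h | h | h | h | h | h
  · have hb : 276 ≤ blk c := by
      have := Nat.le_of_ble_eq_true h
      rw [blk_def]; omega
    have ho : off c = 0 := by have := v.2; rw [dim_base hb] at this; omega
    have hcc : c = mk (Nat.add 276 (blk c - 276)) 0 := by
      apply code_ext
      · rw [blk_mk (by norm_num)]; show blk c = 276 + (blk c - 276); omega
      · rw [off_mk (by norm_num), ho]
    intro z hz _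
    apply Rel_fixed hc _ _ hz
    · intro i hi _
      apply code_ext
      · rw [blk_ea]
      · have h1 := tr_lt v.1 hi
        rw [dim_base hb] at h1
        rw [off_ea, show tr (blk c) i = 0 by omega]; simp
    · have := allN_spec chk_Tbase (blk c - 276) (by omega)
      simp only [strict_eq] at this
      rw [← hcc] at this
      simp only [strict_eq]
      exact this
  · subst h
    intro z hz _
    exact Rel_fixed hc (c23 _ (by simp)) (by simp only [strict_eq]; exact t23.1) hz
  · subst h
    intro z hz _
    exact Rel_fixed hc (c23 _ (by simp)) (by simp only [strict_eq]; exact t23.2.1) hz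
  · subst h
    intro z hz _
    exact Rel_fixed hc (c23 _ (by simp)) (by simp only [strict_eq]; exact t23.2.2) hz
  all_goals subst h
  all_goals intro z hz ho
  all_goals have hv := (vld_iff z).mp hz
  · have e : cls (blk 24576) = 2 := by decide +kernel
    rw [e] at ho
    have ho : cls (blk z) = 2 := by unfold okc at ho; omega
    have := cls_2 ho
    exact Rel_scan scan_24576 (by decide +kernel) hz this.2 this.1 (by omega) (by simp)
  · have e : cls (blk 24592) = 2 := by decide +kernel
    rw [e] at ho
    have ho : cls (blk z) = 2 := by unfold okc at ho; omega
    have := cls_2 ho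
    exact Rel_scan scan_24592 (by decide +kernel) hz this.2 this.1 (by omega) (by simp)
  · have e : cls (blk 29696) = 2 := by decide +kernel
    rw [e] at ho
    have ho : cls (blk z) = 2 := by unfold okc at ho; omega
    have := cls_2 ho
    exact Rel_scan scan_29696 (by decide +kernel) hz this.2 this.1 (by omega) (by simp)
  · have e : cls (blk 3072) = 3 := by decide +kernel
    rw [e] at ho
    have ho := cls_ge2 (O := blk z) (by unfold okc at ho; omega)
    exact Rel_scan scan_3072 (by decide +kernel) hz ho (by omega) (by omega) (by simp)
  · have e : cls (blk 3104) = 3 := by decide +kernel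
    rw [e] at ho
    have ho := cls_ge2 (O := blk z) (by unfold okc at ho; omega)
    exact Rel_scan scan_3104 (by decide +kernel) hz ho (by omega) (by omega) (by simp)
  · have e : cls (blk 3168) = 3 := by decide +kernel
    rw [e] at ho
    have ho := cls_ge2 (O := blk z) (by unfold okc at ho; omega)
    exact Rel_scan scan_3168 (by decide +kernel) hz ho (by omega) (by omega) (by simp)
  · have e : cls (blk 0) = 4 := by decide +kernel
    rw [e] at ho
    have ho : cls (blk z) = 2 ∨ cls (blk z) = 4 := by unfold okc at ho; omega
    have h1 := cls_ge2 (O := blk z) (by omega)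
    have h2 : hpm.testBit (blk z) = false := by
      rcases ho with h | h
      · exact hpm_hept (by have := (cls_2 h).1; omega)
      · exact cls_4 h
    exact Rel_scan scan_0 (by decide +kernel) hz h1 (by omega) (by omega) h2
  · have e : cls (blk 704) = 4 := by decide +kernel
    rw [e] at ho
    have ho : cls (blk z) = 2 ∨ cls (blk z) = 4 := by unfold okc at ho; omega
    have h1 := cls_ge2 (O := blk z) (by omega)
    have h2 : hpm.testBit (blk z) = false := by
      rcases ho with h | h
      · exact hpm_hept (by have := (cls_2 h).1; omega)
      · exact cls_4 h
    exact Rel_scan scan_704 (by decide +kernel) hz h1 (by omega) (by omega) h2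

theorem QT_pr : ∀ n p, p < 1207 → bfp p / 2 ≤ n → QT (pr p) := by
  intro n
  induction n with
  | zero =>
    intro p h hn
    have := allN_spec chk_bfp p h
    simp only [strict_eq, Bool.or_eq_true] at this
    rcases this with h1 | h1
    · exact QT_rep (pr_vld h) h1
    · have := Nat.le_of_ble_eq_true h1
      have e : Nat.div (bfp p) 2 = bfp p / 2 := rfl
      rw [e] at this; omega
  | succ n ih =>
    intro p h hn
    have := allN_spec chk_bfp p h
    simp only [strict_eq, Bool.or_eq_true] at this
    rcases this with h1 | h1
    · exact QT_rep (pr_vld h) h1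
    · have h2 := Nat.le_of_ble_eq_true h1
      have e : ∀ x, Nat.div x 2 = x / 2 := fun _ => rfl
      rw [e, e] at h2
      have hv := pr_vld h
      cases hb : Nat.beq (Nat.mod (bfp p) 2) 0
      · rw [hb, cond_false] at h2
        have hv2 := vld_na goodB hv
        have h3 : QT (na PIB IMB (pr p)) :=
          piece_ind QT QT_ea hv2 (ih _ (pn_lt hv2) (by omega))
        intro z hz ho
        exact Rel_of_B hv hz (h3 _ (vld_na goodB hz) (by rwa [cls_B hv, cls_B hz]))
      · rw [hb, cond_true] at h2
        have hv2 := vld_na goodA hv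
        have h3 : QT (na PIA IMA (pr p)) :=
          piece_ind QT QT_ea hv2 (ih _ (pn_lt hv2) (by omega))
        intro z hz ho
        exact Rel_of_A hv hz (h3 _ (vld_na goodA hz) (by rwa [cls_A hv, cls_A hz]))

theorem QT_all {c : Nat} (hc : vld c = true) : QT c :=
  piece_ind QT QT_ea hc (QT_pr _ _ (pn_lt hc) le_rfl)

theorem Rel_all {y z : Nat} (hy : vld y = true) (hz : vld z = true) : Rel y z := by
  have h1 := cls_lt (O := blk y)
  have h2 := cls_lt (O := blk z)
  have : okc (cls (blk y)) (cls (blk z)) ∨ okc (cls (blk z)) (cls (blk y)) := by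
    unfold okc; omega
  rcases this with h | h
  · exact QT_all hy z hz h
  · exact (QT_all hz y hy h).symm

theorem adj_Ta {y z : Nat} (hy : vld y = true) (hz : vld z = true) : adj (Ta y) (Ta z) = adj y z := by
  rw [Bool.eq_iff_iff]
  constructor
  · intro h
    have := Rel_all (vld_Ta hy) (vld_Ta hz) h
    rwa [Ta_Ta hy, Ta_Ta hz] at this
  · exact Rel_all hy hz

/-- `T` fixes exactly the neighbours of its centre. -/
theorem Ta_fix {c : Nat} (hc : vld c = true) : Ta c = c ↔ (adj 23552 c = true ∨ c = 23552) := by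
  have hb : vld 23552 = true := by decide +kernel
  have hfix : ∀ i, i < 23 → hp i → ea i 23552 = 23552 := by
    intro i hi hh
    apply code_ext
    · rw [blk_ea]
    · rw [off_ea, show blk 23552 = 23 from rfl, (hpAB hi hh).2.2]; simp
  have hT : Ta 23552 = 23552 := by decide +kernel
  apply piece_ind (fun c => Ta c = c ↔ (adj 23552 c = true ∨ c = 23552)) _ hc
  · have := allN_spec chk_Tb (pn c) (pn_lt hc)
    rw [strict_eq] at this
    cases h : adj 23552 (pr (pn c))
    · rw [h, cond_false] at this
      constructor
      · intro h2
        right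
        rw [h2] at this
        simpa using this
      · rintro (h2 | h2)
        · cases h2
        · rw [h2, hT]
    · rw [h, cond_true] at this
      have := Nat.eq_of_beq_eq_true this
      simp [this]
  · intro i c hh hi hc h
    have e1 : Ta (ea i c) = ea i c ↔ Ta c = c := by
      rw [Ta_ea hc hi hh]
      constructor
      · intro h; rw [← ea_ea i (Ta c), h, ea_ea]
      · intro h; rw [h]
    have e2 : adj 23552 (ea i c) = adj 23552 c := by
      conv_lhs => rw [← hfix i hi hh]
      rw [adj_ea hi]
    have e3 : ea i c = 23552 ↔ c = 23552 := by
      constructor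
      · intro h; rw [← ea_ea i c, h, hfix i hi hh]
      · intro h; rw [h, hfix i hi hh]
    rw [e1, e2, e3, h]



/-! ### Checks for the permutation group -/

/-- Inclusion of bit masks. -/
def sub (F M : Nat) : Bool := Nat.beq (Nat.land F M) F

/-- Search tree on the nonincident pairs. -/
def bf2 (i O : Nat) : Nat := Nat.mod (Nat.shiftRight BF2t (Nat.mul 6 (Nat.add (Nat.mul 276 i) O))) 64
/-- Action of the four generators. -/
def gact (n c : Nat) : Nat := cond (Nat.beq n 0) (na PIA IMA c) (cond (Nat.beq n 1) (na PIB IMB c)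
  (cond (Nat.beq n 2) (na PIR IMR c) (Ta c)))
theorem chk_bf2 : allN 23 (fun i => allN 276 fun O => bit (bs O) i || ((Nat.beq i 0 && Nat.beq O 23) ||
    strict (bf2 i O) fun x => strict (gact (Nat.mod x 4) (mk (Nat.add 276 i) 0)) fun c =>
    strict (blk (gact (Nat.mod x 4) (mk O 0))) fun P => Nat.ble (Nat.succ P) 276 && (Nat.ble 276 (blk c) &&
      (!(bit (bs P) (Nat.sub (blk c) 276)) &&
      Nat.ble (Nat.succ (Nat.div (bf2 (Nat.sub (blk c) 276) P) 4)) (Nat.div x 4))))) = true := by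
  decide +kernel

theorem chk_nonbase : allN 276 (fun O => exN 23 fun i => !(bit (bs O) i)) = true := by
  decide +kernel
theorem chk_nonblk : allN 23 (fun i => exN 276 fun O => !(bit (bs O) i)) = true := by
  decide +kernel
theorem chk_bsinj : allN 276 (fun O => allN 276 fun P => Nat.beq O P || !(Nat.beq (bs O) (bs P))) = true := by
  decide +kernel
theorem chk_bslt : allN 276 (fun O => Nat.ble (Nat.succ (bs O)) (Nat.pow 2 23)) = true := by
  decide +kernel

/-- The line through the first base point and the centre of `T`. -/
theorem chk_line1 : (Nat.beq (bs 23) hpm && (adj 704 282624 && adj 704 23552)) = true := by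
  decide +kernel
theorem chk_line2 : allN 276 (fun O => cond (sub hpm (bs O)) (Nat.beq O 23) true) = true := by
  decide +kernel
theorem chk_line3 : (allN 23 (fun i => cond (adj 704 (mk (Nat.add 276 i) 0)) (Nat.beq i 0) true) &&
    allN 32 (fun u => cond (adj 704 (mk 23 u)) (Nat.ble u 1) true)) = true := by
  decide +kernel
theorem chk_line4 : (Nat.beq (ea 0 23552) 23553 && Nat.beq (Ta 282624) 23553) = true := by
  decide +kernel

/-- One level of the stabilizer chain. -/
def lev (F Fx a : Nat) : Bool :=
  allN 276 (fun O => cond (sub F (bs O)) (sub Fx (bs O) && exN 23 fun i => !(bit Fx i) && !(bit (bs O) i)) true) &&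
  (allN 23 (fun i => bit Fx i || exN 276 fun O => sub F (bs O) && (!(bit (bs O) i) && !(bit (bs O) a))) &&
  (!(bit Fx a) && (sub F Fx && Nat.ble (Nat.succ a) 23)))
def cnt (F Fx : Nat) : Nat := Nat.add
  (sumN 276 fun O => cond (sub F (bs O)) (Nat.pow 2 (dim O)) 0) (sumN 23 fun i => cond (bit Fx i) 0 1)

theorem chk_lev1 : (lev 0 0 5 && Nat.beq (cnt 0 0) 31671) = true := by decide +kernel
theorem chk_lev2 : (lev 32 32 8 && Nat.beq (cnt 32 32) 3510) = true := by decide +kernel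
theorem chk_lev3 : (lev 288 288 12 && Nat.beq (cnt 288 288) 693) = true := by decide +kernel
theorem chk_lev4 : (lev 4384 4384 14 && Nat.beq (cnt 4384 4384) 180) = true := by decide +kernel
theorem chk_lev5 : (lev 20768 (bs 226) 20 && Nat.beq (cnt 20768 (bs 226)) 48) = true := by decide +kernel

/-- Action of the three-cycle. -/
def tau (c : Nat) : Nat := Ta (ea 0 (ea 1 (Ta c)))
def nn (c : Nat) : Nat := na PIA IMA (na PIA IMA (na PIR IMR (na PIR IMR c)))
def cyc (q j q' : Nat) : Bool := Nat.beq (nn (mk (Nat.add 276 j) 0)) (mk (Nat.add 276 q) 0) &&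
  Nat.beq (tau (nn (tau (mk (Nat.add 276 j) 0)))) (mk (Nat.add 276 q') 0)
def cyc' (q q' : Nat) : Bool := exN 23 fun j => cyc q j q'
theorem chk_cyc : (cyc' 5 5 && (cyc' 8 8 && (cyc' 12 12 && (cyc' 14 14 && (cyc' 20 20 &&
    (cyc' 0 21 && (cyc' 21 6 && cyc' 6 0))))))) = true := by decide +kernel

/-- Central base points. -/
def cen (F H : Nat) : Bool := sub F (bs H) && (Nat.ble (Nat.succ H) 276 &&
  allN 276 fun O => cond (sub F (bs O)) (sub (bs H) (bs O) && exN 23 fun i => !(bit F i) && !(bit (bs O) i)) true)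
def step1 (F p : Nat) : List Nat → Bool
  | [] => true
  | H :: l => bit (bs H) p && (cen (Nat.land F (bs H)) H && step1 F p l)
def inter : List Nat → Nat
  | [] => 8388607
  | H :: l => Nat.land (bs H) (inter l)
def steps : List (Nat × Nat × List Nat) → Nat → Bool
  | [], F => Nat.beq F 8388607
  | (p, H, l) :: r, F => !(bit F p) && (step1 F p (H :: l) && (Nat.ble (Nat.succ p) 23 &&
      ((allN 23 fun q => bit F q || (Nat.beq q p || !(bit (inter (H :: l)) q))) &&
      steps r (Nat.lor F (Nat.pow 2 p)))))
def stepList : List (Nat × Nat × List Nat) := [(1,61,[27]),(2,222,[129]),(3,94,[81]),(4,82,[69]),(6,87,[49]),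
  (7,28,[27]),(9,24,[23]),(10,28,[24]),(11,244,[]),(13,219,[]),(15,217,[]),(16,248,[]),(17,255,[]),
  (18,274,[]),(19,268,[]),(21,275,[]),(22,273,[])]
theorem chk_steps : steps stepList 1069345 = true := by decide +kernel

/-- Translations of the heptads fixing the neighbours of a monad. -/
theorem chk_hm : allN 253 (fun h => strict (Nat.add 23 h) fun O => allN 32 fun s =>
    Nat.beq s 0 || (Nat.beq s (tr O 5) || exN 32 fun u =>
      !(adj 5120 (mk O u) == adj 5120 (mk O (Nat.xor u s))))) = true := by decide +kernel
theorem chk_hm24 : Nat.beq (tr 24 5) 2 = true := by decide +kernel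
def parT (k : Nat) : Nat := Nat.mod (Nat.shiftRight PARt (Nat.mul 16 k)) 65536
theorem chk_par : allN 175 (fun k => strict (Nat.add 23 (Nat.mod (parT k) 256)) fun P =>
    strict (Nat.add 23 (Nat.div (parT k) 256)) fun O => Nat.ble (Nat.succ P) 276 &&
     (Nat.ble (Nat.succ O) 276 && ((Nat.beq O 24 || exN k fun j => Nat.beq (Nat.add 23 (Nat.mod (parT j) 256)) O) &&
      exN 32 fun u => adj (mk O 0) (mk P u) && !(adj (mk O 0) (mk P (Nat.xor u (tr P 5))))))) = true := by
  decide +kernel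
theorem chk_parall : allN 253 (fun h => Nat.beq (tr (Nat.add 23 h) 5) 0 || (Nat.beq h 1 ||
    exN 175 fun k => Nat.beq (Nat.mod (parT k) 256) h)) = true := by
  decide +kernel
/-- Witnesses separating the points of a monad. -/
def monW : List (List Nat) :=
  [[172061,233487,113672],
  [69657,107525,61454],
  [44043,148491,270365],
  [115739,79876,75799],
  [114695,137233,98315],
  [258052,103428,196615],
  [239643,100353,149528],
  [146446,73737,92189],
  [114704,48135,211997],
  [197646,38931,124944],
  [240649,111625,157707],
  [196639,221205,100373],
  [200714,182275,164872],
  [123909,258050,40987],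
  [69647,177171,187423],
  [102406,208906,47122],
  [158750,222221,273426],
  [221207,279580,56329],
  [92165,238614,117786],
  [279568,215056,70673],
  [281618,75795,90139],
  [76810,221189,220185],
  [69659,206879,163865]]
def monEx (j s : Nat) : List Nat → Bool
  | [] => false
  | w :: l => !(adj (mk j s) w) || monEx j s l
def monOk (j : Nat) : List Nat → Bool
  | [] => true
  | w :: l => (adj (mk j 0) w && (vld w && (Nat.ble 23 (blk w) && Nat.ble (Nat.succ (blk w)) 276))) && monOk j l
def monAll : Nat → List (List Nat) → Bool
  | _, [] => true
  | j, l :: r => (monOk j l && allN 1024 fun s => Nat.beq s 0 || monEx j s l) && monAll (Nat.succ j) r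
theorem chk_mon : (Nat.beq monW.length 23 && monAll 0 monW) = true := by
  decide +kernel
/-- Common neighbours. -/
theorem chk_mu : Nat.beq (sumN 299 fun O => cond (adj 282624 (mk O 0))
    (sumN (Nat.pow 2 (dim O)) fun u => cond (adj 23552 (mk O u)) 1 0) 0) 351 = true := by
  decide +kernel
theorem chk_hep : allN 276 (fun O => Nat.beq (Nat.xor (tr O 3) (Nat.xor (tr O 5) (Nat.xor (tr O 7)
    (Nat.xor (tr O 8) (Nat.xor (tr O 9) (Nat.xor (tr O 13) (tr O 14))))))) 0) = true := by
  decide +kernel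


/-! ### The graph and its automorphism group -/

/-- The points. -/
abbrev X : Type := {c : Nat // vld c = true}

/-- Adjacency. -/
def Ad (x y : X) : Prop := adj x.1 y.1 = true

theorem Ad.symm {x y : X} (h : Ad x y) : Ad y x := by unfold Ad at *; rw [adj_symm]; exact h
theorem Ad_comm (x y : X) : Ad x y ↔ Ad y x := ⟨Ad.symm, Ad.symm⟩
theorem Ad_irrefl (x : X) : ¬ Ad x x := by unfold Ad; rw [adj_irrefl]; simp
theorem Ad.ne {x y : X} (h : Ad x y) : x ≠ y := by rintro rfl; exact Ad_irrefl _ h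

theorem vld_lt {c : Nat} (h : vld c = true) : c < 306176 := by
  rw [vld_iff, blk_def] at h; omega

instance : Finite X := Finite.of_injective (fun x : X => (⟨x.1, vld_lt x.2⟩ : Fin 306176)) (by
  intro x y h; exact Subtype.ext (by simpa using h))

/-- The automorphism group of the graph. -/
def Au : Subgroup (Equiv.Perm X) where
  carrier := {g | ∀ x y, Ad (g x) (g y) ↔ Ad x y}
  one_mem' := fun _ _ => Iff.rfl
  mul_mem' := by
    intro g h hg hh x y
    rw [Equiv.Perm.mul_apply, Equiv.Perm.mul_apply, hg, hh]
  inv_mem' := by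
    intro g hg x y
    rw [← hg]; simp

abbrev G : Type := ↥Au

theorem smul_val (g : G) (x : X) : g • x = g.1 x := rfl

theorem Ad_smul (g : G) (x y : X) : Ad (g • x) (g • y) ↔ Ad x y := g.2 x y

theorem G_ext {g h : G} (H : ∀ x : X, g • x = h • x) : g = h :=
  Subtype.ext (Equiv.ext H)

/-- Automorphisms from maps on codes. -/
def mkG (f : Nat → Nat) (hv : ∀ c, vld c = true → vld (f c) = true)
    (hi : ∀ c d, vld c = true → vld d = true → f c = f d → c = d)
    (ha : ∀ c d, vld c = true → vld d = true → adj (f c) (f d) = adj c d) : G :=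
  ⟨Equiv.ofBijective (fun x : X => (⟨f x.1, hv _ x.2⟩ : X)) (Finite.injective_iff_bijective.mp (by
    intro x y h; exact Subtype.ext (hi _ _ x.2 y.2 (congrArg Subtype.val h)))), by
    intro x y
    show adj (f x.1) (f y.1) = true ↔ adj x.1 y.1 = true
    rw [ha _ _ x.2 y.2]⟩

theorem mkG_val (f : Nat → Nat) (hv hi ha) (x : X) : (mkG f hv hi ha • x).1 = f x.1 := rfl

/-- Base transpositions. -/
def eG (i : Fin 23) : G := mkG (ea i) (fun _ h => vld_ea i.2 h)
  (fun c d _ _ h => by rw [← ea_ea i c, h, ea_ea]) (fun c d _ _ => adj_ea i.2 c d)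
def TG : G := mkG Ta (fun _ h => vld_Ta h) (fun c d hc hd h => by rw [← Ta_Ta hc, h, Ta_Ta hd])
  (fun c d hc hd => adj_Ta hc hd)
def AG : G := mkG (na PIA IMA) (fun _ h => vld_na goodA h) (fun _ _ hc hd h => na_inj goodA hc hd h)
  (fun _ _ hc hd => adj_na goodA hc hd)
def BG : G := mkG (na PIB IMB) (fun _ h => vld_na goodB h) (fun _ _ hc hd h => na_inj goodB hc hd h)
  (fun _ _ hc hd => adj_na goodB hc hd)
def RG : G := mkG (na PIR IMR) (fun _ h => vld_na goodR h) (fun _ _ hc hd h => na_inj goodR hc hd h)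
  (fun _ _ hc hd => adj_na goodR hc hd)

theorem eG_val (i : Fin 23) (x : X) : (eG i • x).1 = ea i x.1 := rfl
theorem TG_val (x : X) : (TG • x).1 = Ta x.1 := rfl
theorem AG_val (x : X) : (AG • x).1 = na PIA IMA x.1 := rfl
theorem BG_val (x : X) : (BG • x).1 = na PIB IMB x.1 := rfl
theorem RG_val (x : X) : (RG • x).1 = na PIR IMR x.1 := rfl

/-- Base points. -/
def bp (i : Fin 23) : X := ⟨mk (276 + i) 0, vld_mk (by omega) (by positivity)⟩
theorem bp_val (i : Fin 23) : (bp i).1 = mk (276 + i) 0 := rfl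
theorem bp_mk_val (n : Nat) (h : n < 23) : (bp ⟨n, h⟩).1 = mk (276 + n) 0 := rfl
/-- The centre of `T`. -/
def bb : X := ⟨23552, by decide +kernel⟩

/-- `t` is a transposition with centre `x`. -/
def IsTr (x : X) (t : G) : Prop := ∀ y, t • y = y ↔ (Ad x y ∨ y = x)

theorem isTr_e (i : Fin 23) : IsTr (bp i) (eG i) := by
  intro y
  rw [Subtype.ext_iff, Subtype.ext_iff, eG_val, ea_fix i.2 y.2]; rfl

theorem isTr_T : IsTr bb TG := by
  intro y
  rw [Subtype.ext_iff, Subtype.ext_iff, TG_val, Ta_fix y.2]; rfl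

theorem IsTr.conj {x : X} {t : G} (h : IsTr x t) (g : G) : IsTr (g • x) (g * t * g⁻¹) := by
  intro y
  have := h (g⁻¹ • y)
  rw [mul_smul, mul_smul, ← eq_inv_smul_iff, this, ← Ad_smul g, smul_inv_smul, inv_smul_eq_iff]

theorem e_sq (i : Fin 23) : eG i * eG i = 1 := by
  apply G_ext; intro x
  rw [mul_smul, one_smul]; apply Subtype.ext; rw [eG_val, eG_val, ea_ea]

theorem T_sq : TG * TG = 1 := by
  apply G_ext; intro x
  rw [mul_smul, one_smul]; apply Subtype.ext; rw [TG_val, TG_val, Ta_Ta x.2]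

/-- Subgroup generated by transpositions. -/
def DD : Subgroup G := Subgroup.closure {t | ∃ x, IsTr x t}

instance : DD.Normal := by
  have : {t : G | ∃ x, IsTr x t} = Group.conjugatesOfSet {t : G | ∃ x, IsTr x t} := by
    apply Set.Subset.antisymm Group.subset_conjugatesOfSet
    intro t ht
    rw [Group.mem_conjugatesOfSet_iff] at ht
    obtain ⟨a, ⟨x, hx⟩, hc⟩ := ht
    obtain ⟨g, hg⟩ := isConj_iff.mp hc
    exact ⟨g • x, hg ▸ hx.conj g⟩
  unfold DD
  rw [this]
  exact Subgroup.normalClosure_normal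

theorem e_mem (i : Fin 23) : eG i ∈ DD := Subgroup.subset_closure ⟨_, isTr_e i⟩
theorem T_mem : TG ∈ DD := Subgroup.subset_closure ⟨_, isTr_T⟩

/-! ### Points: base or not -/

theorem X_cases (x : X) : (∃ i, x = bp i) ∨ blk x.1 < 276 := by
  rcases lt_or_ge (blk x.1) 276 with h | h
  · exact Or.inr h
  · left
    have hv := (vld_iff _).mp x.2
    rw [dim_base h] at hv
    refine ⟨⟨blk x.1 - 276, by omega⟩, Subtype.ext ?_⟩
    have h1 : off x.1 = 0 := by omega
    have h2 : 276 + (blk x.1 - 276) = blk x.1 := by omega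
    have h3 := mk_blk_off x.1
    rw [h1] at h3
    rw [bp_mk_val, h2, h3]

theorem blk_bp (i : Fin 23) : blk (bp i).1 = 276 + i := by
  rw [bp_val, blk_mk (by norm_num)]

theorem Ad_bp_nb (i : Fin 23) {x : X} (h : blk x.1 < 276) : Ad (bp i) x ↔ (bs (blk x.1)).testBit i = true := by
  unfold Ad
  rw [adj_bn (by rw [blk_bp]; omega) h, blk_bp]; simp

theorem Ad_bp_bp (i j : Fin 23) : Ad (bp i) (bp j) ↔ i ≠ j := by
  unfold Ad
  rw [adj_bb (by rw [blk_bp]; omega) (by rw [blk_bp]; omega), blk_bp, blk_bp]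
  simp [Fin.ext_iff]

theorem bp_inj {i j : Fin 23} (h : bp i = bp j) : i = j := by
  by_contra hne
  have := (Ad_bp_bp i j).mpr hne
  rw [h] at this; exact Ad_irrefl _ this

theorem bp_ne_nb (i : Fin 23) {x : X} (h : blk x.1 < 276) : bp i ≠ x := by
  rintro rfl; rw [blk_bp] at h; omega

theorem e_bp (i j : Fin 23) : eG i • bp j = bp j := by
  rw [isTr_e i (bp j)]
  rcases eq_or_ne i j with h | h
  · right; rw [h]
  · left; exact (Ad_bp_bp _ _).mpr h

/-- Block origin. -/
def org (O : Nat) (h : O < 299) : X := ⟨mk O 0, vld_mk h (by positivity)⟩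
theorem blk_org (O : Nat) (h : O < 299) : blk (org O h).1 = O := blk_mk (by norm_num)
theorem blk_X (x : X) : blk x.1 < 299 := ((vld_iff _).mp x.2).1

theorem E_trans0 (x : X) :
    ∃ g ∈ DD, (∀ i, g • bp i = bp i) ∧ g • org (blk x.1) (blk_X x) = x := by
  have key := ea_ind_all (fun c => ∀ hc : vld c = true, ∃ g ∈ DD, (∀ i, g • bp i = bp i) ∧
    (g • org (blk c) (blk_X ⟨c, hc⟩)).1 = c) (by
      intro i c hi hc hQ hc'
      obtain ⟨g, hg, hb, h1⟩ := hQ hc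
      refine ⟨eG ⟨i, hi⟩ * g, DD.mul_mem (e_mem _) hg, ?_, ?_⟩
      · intro j; rw [mul_smul, hb, e_bp]
      · simp only [blk_ea]
        rw [mul_smul, eG_val, h1]) (by
      intro O hO hc
      refine ⟨1, DD.one_mem, fun i => one_smul _ _, ?_⟩
      rw [one_smul]
      show mk (blk (mk O 0)) 0 = mk O 0
      rw [blk_mk (by norm_num)]) x.1 x.2 x.2
  obtain ⟨g, h1, h2, h3⟩ := key
  exact ⟨g, h1, h2, Subtype.ext h3⟩

/-- The group generated by the base transpositions is transitive on blocks. -/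
theorem E_trans {x y : X} (h : blk x.1 = blk y.1) :
    ∃ g ∈ DD, (∀ i, g • bp i = bp i) ∧ g • x = y := by
  obtain ⟨g, h1, h2, h3⟩ := E_trans0 x
  obtain ⟨k, h1', h2', h3'⟩ := E_trans0 y
  refine ⟨k * g⁻¹, DD.mul_mem h1' (DD.inv_mem h1), fun i => ?_, ?_⟩
  · rw [mul_smul, inv_smul_eq_iff.mpr (h2 i).symm, h2']
  · rw [mul_smul, inv_smul_eq_iff.mpr h3.symm]
    simp only [h, h3']


/-! ### Transitivity on pairs -/

def gG (n : Nat) : G := cond (Nat.beq n 0) AG (cond (Nat.beq n 1) BG (cond (Nat.beq n 2) RG TG))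

theorem gG_val (n : Nat) (x : X) : (gG n • x).1 = gact n x.1 := by
  unfold gG gact
  cases Nat.beq n 0 <;> cases Nat.beq n 1 <;> cases Nat.beq n 2 <;> rfl

theorem bf2_step {i O : Nat} (hi : i < 23) (hO : O < 276) (h : (bs O).testBit i = false) :
    (i = 0 ∧ O = 23) ∨ ∃ n, blk (gact n (mk O 0)) < 276 ∧ 276 ≤ blk (gact n (mk (276 + i) 0)) ∧
      (bs (blk (gact n (mk O 0)))).testBit (blk (gact n (mk (276 + i) 0)) - 276) = false ∧
      bf2 (blk (gact n (mk (276 + i) 0)) - 276) (blk (gact n (mk O 0))) / 4 < bf2 i O / 4 := by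
  have h1 := allN_spec (allN_spec chk_bf2 i hi) O hO
  simp only [strict_eq, Bool.or_eq_true, Bool.and_eq_true, Nat.beq_eq, Nat.ble_eq, Bool.not_eq_true', bit_eq, h,
    Bool.false_eq_true, false_or] at h1
  rcases h1 with h1 | ⟨h1, h2, h3, h4⟩
  · exact Or.inl h1
  · exact Or.inr ⟨_, h1, h2, h3, h4⟩

theorem rank3_aux : ∀ n i O, (hi : i < 23) → (hO : O < 276) → (bs O).testBit i = false → bf2 i O / 4 ≤ n →
    ∀ x : X, blk x.1 = O → ∃ g : G, g • bp ⟨i, hi⟩ = bp 0 ∧ g • x = bb := by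
  intro n
  induction n using Nat.strong_induction_on with
  | _ n ih =>
    intro i O hi hO h hn x hx
    rcases bf2_step hi hO h with ⟨h1, h2⟩ | ⟨m, h1, h2, h3, h4⟩
    · subst h1; subst h2
      obtain ⟨g, _, hg, hgx⟩ := E_trans (x := x) (y := bb) (by rw [hx]; decide +kernel)
      exact ⟨g, hg 0, hgx⟩
    · obtain ⟨g, _, hg, hgx⟩ := E_trans (x := x) (y := org O (by omega)) (by rw [hx, blk_org])
      have e1 : (gG m • org O (by omega)).1 = gact m (mk O 0) := gG_val _ _
      have e2 : (gG m • bp ⟨i, hi⟩).1 = gact m (mk (276 + i) 0) := gG_val _ _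
      rcases X_cases (gG m • bp ⟨i, hi⟩) with ⟨j, hj⟩ | hlt
      · have e3 : blk (gact m (mk (276 + i) 0)) - 276 = j.1 := by rw [← e2, hj, blk_bp]; omega
        rw [e3] at h3 h4
        obtain ⟨k, hk1, hk2⟩ := ih _ (lt_of_lt_of_le h4 hn) j.1 _ j.2 h1 h3 le_rfl
          (gG m • org O (by omega)) (by rw [e1])
        refine ⟨k * (gG m * g), ?_, ?_⟩
        · rw [mul_smul, mul_smul, hg, hj, ← hk1]
        · rw [mul_smul, mul_smul, hgx, hk2]
      · rw [e2] at hlt; omega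

theorem rank3_base (i : Fin 23) {x : X} (hx : blk x.1 < 276) (h : ¬ Ad (bp i) x) :
    ∃ g : G, g • bp i = bp 0 ∧ g • x = bb := by
  rw [Ad_bp_nb i hx, Bool.not_eq_true] at h
  exact rank3_aux _ i.1 _ i.2 hx h le_rfl x rfl

theorem bb_val : bb.1 = 23552 := rfl

theorem line4 : TG • bp 0 = eG 0 • bb := by
  apply Subtype.ext
  rw [TG_val, eG_val, bp_val]
  have h := chk_line4
  simp only [Bool.and_eq_true, Nat.beq_eq] at h
  have e : mk (276 + ((0 : Fin 23) : Nat)) 0 = 282624 := rfl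
  rw [e, h.2]; exact h.1.symm

/-- An element moving the first base point to the centre of `T`. -/
def d0 : G := eG 0 * TG
theorem d0_mem : d0 ∈ DD := DD.mul_mem (e_mem _) T_mem
theorem d0_bp : d0 • bp 0 = bb := by
  unfold d0
  rw [mul_smul, line4, ← mul_smul, e_sq, one_smul]
theorem d0_fix {w : X} (h1 : Ad (bp 0) w) (h2 : Ad bb w) : d0 • w = w := by
  unfold d0
  rw [mul_smul, (isTr_T w).mpr (Or.inl h2), (isTr_e 0 w).mpr (Or.inl h1)]

theorem trans0 (x : X) : ∃ g : G, g • x = bp 0 := by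
  rcases X_cases x with ⟨i, rfl⟩ | hx
  · obtain ⟨O, hO, h⟩ := exN_spec (allN_spec chk_nonblk i.1 i.2)
    obtain ⟨g, hg, _⟩ := rank3_base i (x := org O (by omega)) (by rw [blk_org]; exact hO) (by
      rw [Ad_bp_nb i (by rw [blk_org]; exact hO), blk_org, ← bit_eq]; simpa using h)
    exact ⟨g, hg⟩
  · obtain ⟨i, hi, h⟩ := exN_spec (allN_spec chk_nonbase _ hx)
    obtain ⟨g, _, hg⟩ := rank3_base ⟨i, hi⟩ hx (by
      rw [Ad_bp_nb _ hx, ← bit_eq]; simpa using h)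
    refine ⟨d0⁻¹ * g, ?_⟩
    rw [mul_smul, hg, inv_smul_eq_iff, d0_bp]

theorem trans (x y : X) : ∃ g : G, g • x = y := by
  obtain ⟨g, hg⟩ := trans0 x
  obtain ⟨k, hk⟩ := trans0 y
  exact ⟨k⁻¹ * g, by rw [mul_smul, hg, inv_smul_eq_iff, hk]⟩

theorem rank3 {x y : X} (hne : x ≠ y) (h : ¬ Ad x y) : ∃ g : G, g • x = bp 0 ∧ g • y = bb := by
  obtain ⟨g, hg⟩ := trans0 x
  have h1 : ¬ Ad (bp 0) (g • y) := by rw [← hg, Ad_smul]; exact h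
  rcases X_cases (g • y) with ⟨j, hj⟩ | hlt
  · rw [hj, Ad_bp_bp, not_not] at h1
    exact absurd (smul_left_cancel g (by rw [hg, hj, h1])) hne
  · obtain ⟨k, hk1, hk2⟩ := rank3_base 0 hlt h1
    exact ⟨k * g, by rw [mul_smul, hg, hk1], by rw [mul_smul, hk2]⟩

/-- Nonadjacent points are linked by an element fixing their common neighbours. -/
theorem link {x y : X} (h : ¬ Ad x y) :
    ∃ d ∈ DD, d • x = y ∧ ∀ w, Ad x w → Ad y w → d • w = w := by
  rcases eq_or_ne x y with rfl | hne
  · exact ⟨1, DD.one_mem, one_smul _ _, fun w _ _ => one_smul _ _⟩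
  obtain ⟨g, hx, hy⟩ := rank3 hne h
  refine ⟨g⁻¹ * d0 * g, ?_, ?_, ?_⟩
  · have := (inferInstance : DD.Normal).conj_mem _ d0_mem g⁻¹
    simpa using this
  · rw [mul_smul, mul_smul, hx, d0_bp, inv_smul_eq_iff, hy]
  · intro w h1 h2
    rw [mul_smul, mul_smul, inv_smul_eq_iff]
    apply d0_fix
    · rw [← hx, Ad_smul]; exact h1
    · rw [← hy, Ad_smul]; exact h2

/-! ### Uniqueness of transpositions -/

def w704 : X := ⟨704, by decide +kernel⟩

theorem Ad_bb (i : Fin 23) : Ad (bp i) bb ↔ hpm.testBit i = true := by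
  have h := chk_line1
  simp only [Bool.and_eq_true, Nat.beq_eq] at h
  rw [Ad_bp_nb i (by decide +kernel)]
  have : blk bb.1 = 23 := by decide +kernel
  rw [this, h.1]

theorem nAd_bb : ¬ Ad (bp 0) bb := by
  rw [Ad_bb]; decide

theorem line {z : X} (hz : ∀ w, Ad (bp 0) w → Ad bb w → Ad w z) : z = bp 0 ∨ z = bb ∨ z = eG 0 • bb := by
  have h := chk_line1
  simp only [Bool.and_eq_true, Nat.beq_eq] at h
  have h704 : Ad w704 z := hz _ (by unfold Ad; rw [adj_symm]; exact h.2.1) (by unfold Ad; rw [adj_symm]; exact h.2.2)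
  have h3 := chk_line3
  simp only [Bool.and_eq_true] at h3
  rcases X_cases z with ⟨i, rfl⟩ | hlt
  · left
    have := allN_spec h3.1 i.1 i.2
    have h4 : adj 704 (mk (Nat.add 276 i.1) 0) = true := h704
    rw [h4, cond_true, Nat.beq_eq] at this
    congr 1; exact Fin.ext this
  · right
    have hb : ∀ i : Fin 23, hpm.testBit i = true → (bs (blk z.1)).testBit i = true := by
      intro i hi
      rw [← Ad_bp_nb i hlt]
      have hi0 : i ≠ 0 := by rintro rfl; revert hi; decide
      exact hz _ ((Ad_bp_bp _ _).mpr hi0.symm) (((Ad_bb i).mpr hi).symm)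
    have hs : sub hpm (bs (blk z.1)) = true := by
      unfold sub
      rw [Nat.beq_eq]
      apply Nat.eq_of_testBit_eq
      intro k
      show (hpm &&& bs (blk z.1)).testBit k = _
      rw [Nat.testBit_and]
      rcases lt_or_ge k 23 with hk | hk
      · cases hh : hpm.testBit k
        · simp
        · rw [hb ⟨k, hk⟩ hh]; rfl
      · rw [hpm_hept hk]; rfl
    have h2 := allN_spec chk_line2 _ hlt
    rw [hs, cond_true, Nat.beq_eq] at h2
    have hv := (vld_iff _).mp z.2
    rw [h2, dim_hept (by norm_num) (by norm_num)] at hv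
    have e := mk_blk_off z.1
    rw [h2] at e
    have h5 := allN_spec h3.2 _ hv.2
    rw [e] at h5
    have h6 : adj 704 z.1 = true := h704
    rw [h6, cond_true, Nat.ble_eq] at h5
    have h7 := chk_line4
    simp only [Bool.and_eq_true, Nat.beq_eq] at h7
    rw [mk_def] at e
    rcases (show off z.1 = 0 ∨ off z.1 = 1 by omega) with h8 | h8
    · left; apply Subtype.ext; rw [bb_val]; omega
    · right; apply Subtype.ext; rw [eG_val, bb_val]
      have : ea ((0 : Fin 23) : Nat) 23552 = 23553 := h7.1
      rw [this]; omega

theorem tr_bb {t : G} (ht : IsTr (bp 0) t) : t • bb = eG 0 • bb := by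
  rcases line (z := t • bb) (by
    intro w h1 h2
    rw [← (ht w).mpr (Or.inl h1), Ad_smul]; exact h2.symm) with h | h | h
  · have : t • bp 0 = bp 0 := (ht _).mpr (Or.inr rfl)
    rw [← this] at h
    have h' := smul_left_cancel t h
    exact absurd h'.symm (bp_ne_nb 0 (by decide +kernel))
  · rw [ht] at h
    rcases h with h | h
    · exact absurd h nAd_bb
    · exact absurd h.symm (bp_ne_nb 0 (by decide +kernel))
  · exact h

theorem tr_unique0 {t : G} (ht : IsTr (bp 0) t) : t = eG 0 := by
  apply G_ext
  intro y
  by_cases h : Ad (bp 0) y ∨ y = bp 0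
  · rw [(ht y).mpr h, (isTr_e 0 y).mpr h]
  · push Not at h
    obtain ⟨g, h1, h2⟩ := rank3 h.2.symm h.1
    have a1 := ht.conj g
    have a2 := (isTr_e 0).conj g
    rw [h1] at a1 a2
    have a3 := (tr_bb a1).trans (tr_bb a2).symm
    simp only [mul_smul, ← h2, inv_smul_smul, smul_left_cancel_iff] at a3
    exact a3

theorem exists_tr (x : X) : ∃ t : G, IsTr x t ∧ t * t = 1 := by
  obtain ⟨g, hg⟩ := trans (bp 0) x
  refine ⟨g * eG 0 * g⁻¹, hg ▸ (isTr_e 0).conj g, ?_⟩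
  have : g * eG 0 * g⁻¹ * (g * eG 0 * g⁻¹) = g * (eG 0 * eG 0) * g⁻¹ := by group
  rw [this, e_sq]; group

/-- The transposition with centre `x`. -/
def ct (x : X) : G := (exists_tr x).choose
theorem ct_isTr (x : X) : IsTr x (ct x) := (exists_tr x).choose_spec.1
theorem ct_sq (x : X) : ct x * ct x = 1 := (exists_tr x).choose_spec.2

theorem tr_unique {x : X} {t s : G} (ht : IsTr x t) (hs : IsTr x s) : t = s := by
  obtain ⟨g, hg⟩ := trans x (bp 0)
  have a1 := tr_unique0 (hg ▸ ht.conj g)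
  have a2 := tr_unique0 (hg ▸ hs.conj g)
  rw [← a2] at a1
  simpa using a1

theorem ct_smul (g : G) (x : X) : ct (g • x) = g * ct x * g⁻¹ :=
  tr_unique (ct_isTr _) ((ct_isTr x).conj g)
theorem ct_bp (i : Fin 23) : ct (bp i) = eG i := tr_unique (ct_isTr _) (isTr_e i)
theorem ct_mem (x : X) : ct x ∈ DD := Subgroup.subset_closure ⟨x, ct_isTr x⟩


/-! ### The stabilizer chain: large levels -/

theorem sub_iff {F M : Nat} : sub F M = true ↔ ∀ k, F.testBit k = true → M.testBit k = true := by
  unfold sub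
  rw [Nat.beq_eq]
  constructor
  · intro h k hk
    have h' : F &&& M = F := h
    rw [← h', Nat.testBit_and, Bool.and_eq_true] at hk
    exact hk.2
  · intro h
    apply Nat.eq_of_testBit_eq
    intro k
    show (F &&& M).testBit k = _
    rw [Nat.testBit_and]
    cases hh : F.testBit k
    · rfl
    · rw [h k hh]; rfl

theorem lt23 {F k : Nat} (hF : F < 2 ^ 23) (hk : F.testBit k = true) : k < 23 := testBit_dim hF hk

theorem bs_lt (O : Nat) : bs O < 2 ^ 23 := Nat.mod_lt _ (by norm_num)

theorem sub_fin {F M : Nat} (hF : F < 2 ^ 23) (h : ∀ i : Fin 23, F.testBit i = true → M.testBit i = true) :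
    sub F M = true := sub_iff.mpr fun k hk => h ⟨k, lt23 hF hk⟩ hk

/-- Pointwise stabilizer of a set of base points. -/
def Fx (F : Nat) : Subgroup G where
  carrier := {g | ∀ i : Fin 23, F.testBit i = true → g • bp i = bp i}
  one_mem' := fun _ _ => one_smul _ _
  mul_mem' := by
    intro g h hg hh i hi
    rw [mul_smul, hh i hi, hg i hi]
  inv_mem' := by
    intro g hg i hi
    rw [inv_smul_eq_iff, hg i hi]

theorem mem_Fx {F : Nat} {g : G} : g ∈ Fx F ↔ ∀ i : Fin 23, F.testBit i = true → g • bp i = bp i := Iff.rfl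

/-- Common neighbours of base points. -/
def CN (F : Nat) (x : X) : Prop := ∀ i : Fin 23, F.testBit i = true → Ad (bp i) x

theorem CN_smul {F : Nat} {g : G} (hg : g ∈ Fx F) {x : X} (h : CN F x) : CN F (g • x) := by
  intro i hi
  rw [← hg i hi, Ad_smul]; exact h i hi

theorem CN_nb {F : Nat} (hF : F < 2 ^ 23) {x : X} (hx : blk x.1 < 276) :
    CN F x ↔ sub F (bs (blk x.1)) = true := by
  constructor
  · intro h; exact sub_fin hF fun i hi => (Ad_bp_nb i hx).mp (h i hi)
  · intro h i hi; exact (Ad_bp_nb i hx).mpr (sub_iff.mp h _ hi)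

theorem CN_bp {F : Nat} (j : Fin 23) : CN F (bp j) ↔ F.testBit j = false := by
  constructor
  · intro h
    by_contra hb
    rw [Bool.not_eq_false] at hb
    exact Ad_irrefl _ (h j hb)
  · intro h i hi
    rw [Ad_bp_bp]; rintro rfl; rw [h] at hi; cases hi

/-- The orbit at a large level. -/
def CL (F F' : Nat) : Set X := {x | (blk x.1 < 276 ∧ sub F (bs (blk x.1)) = true) ∨
  ∃ i : Fin 23, x = bp i ∧ F'.testBit i = false}

theorem lev_spec {F F' a : Nat} (h : lev F F' a = true) :
    (∀ O, O < 276 → sub F (bs O) = true → sub F' (bs O) = true ∧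
      ∃ i : Fin 23, F'.testBit i = false ∧ (bs O).testBit i = false) ∧
    (∀ i : Fin 23, F'.testBit i = false → ∃ O, O < 276 ∧ sub F (bs O) = true ∧ (bs O).testBit i = false ∧
      (bs O).testBit a = false) ∧ F'.testBit a = false ∧ sub F F' = true ∧ a < 23 := by
  unfold lev at h
  simp only [Bool.and_eq_true, Bool.not_eq_true', Nat.ble_eq, bit_eq] at h
  obtain ⟨h1, h2, h3, h4, h5⟩ := h
  refine ⟨?_, ?_, h3, h4, h5⟩
  · intro O hO hs
    have := allN_spec h1 O hO
    rw [hs, cond_true, Bool.and_eq_true] at this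
    obtain ⟨i, hi, hh⟩ := exN_spec this.2
    simp only [Bool.and_eq_true, Bool.not_eq_true'] at hh
    exact ⟨this.1, ⟨i, hi⟩, hh⟩
  · intro i hi
    have := allN_spec h2 i.1 i.2
    rw [hi, Bool.false_or] at this
    obtain ⟨O, hO, hh⟩ := exN_spec this
    simp only [Bool.and_eq_true, Bool.not_eq_true'] at hh
    exact ⟨O, hO, hh⟩

theorem CL_iff {F F' a : Nat} (h : lev F F' a = true) (hF : F < 2 ^ 23) (x : X) :
    x ∈ CL F F' ↔ CN F x ∧ ∃ y, CN F y ∧ ¬ Ad x y ∧ x ≠ y := by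
  obtain ⟨h1, h2, h3, h4, h5⟩ := lev_spec h
  have hsub : ∀ i : Fin 23, F'.testBit i = false → F.testBit i = false := by
    intro i hi
    by_contra hb
    rw [Bool.not_eq_false] at hb
    rw [sub_iff.mp h4 _ hb] at hi; cases hi
  constructor
  · rintro (⟨hx, hs⟩ | ⟨i, rfl, hi⟩)
    · refine ⟨(CN_nb hF hx).mpr hs, ?_⟩
      obtain ⟨_, i, hi, hb⟩ := h1 _ hx hs
      refine ⟨bp i, (CN_bp i).mpr (hsub i hi), ?_, (bp_ne_nb i hx).symm⟩
      rw [Ad_comm, Ad_bp_nb i hx, hb]; simp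
    · refine ⟨(CN_bp i).mpr (hsub i hi), ?_⟩
      obtain ⟨O, hO, hs, hb, _⟩ := h2 i hi
      have hO' : blk (org O (by omega)).1 < 276 := by rw [blk_org]; exact hO
      refine ⟨org O (by omega), (CN_nb hF hO').mpr (by rw [blk_org]; exact hs), ?_, bp_ne_nb i hO'⟩
      rw [Ad_bp_nb i hO', blk_org, hb]; simp
  · rintro ⟨hc, y, hy, hna, hne⟩
    rcases X_cases x with ⟨i, rfl⟩ | hx
    · right
      refine ⟨i, rfl, ?_⟩
      by_contra hb
      rw [Bool.not_eq_false] at hb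
      rcases X_cases y with ⟨j, rfl⟩ | hy'
      · rw [Ad_bp_bp, not_not] at hna
        exact hne (by rw [hna])
      · rw [Ad_bp_nb i hy'] at hna
        exact hna (sub_iff.mp (h1 _ hy' ((CN_nb hF hy').mp hy)).1 _ hb)
    · exact Or.inl ⟨hx, (CN_nb hF hx).mp hc⟩

theorem lev_orbit {F F' a : Nat} (h : lev F F' a = true) (hF : F < 2 ^ 23) (ha : a < 23) {g : G}
    (hg : g ∈ Fx F) : g • bp ⟨a, ha⟩ ∈ CL F F' := by
  have h0 : bp ⟨a, ha⟩ ∈ CL F F' := Or.inr ⟨_, rfl, (lev_spec h).2.2.1⟩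
  rw [CL_iff h hF] at h0 ⊢
  obtain ⟨h1, y, h2, h3, h4⟩ := h0
  exact ⟨CN_smul hg h1, g • y, CN_smul hg h2, by rwa [Ad_smul], fun e => h4 (smul_left_cancel g e)⟩

theorem link_F {F : Nat} {x y : X} (hx : CN F x) (hy : CN F y) (h : ¬ Ad x y) :
    ∃ d ∈ DD, d ∈ Fx F ∧ d • x = y := by
  obtain ⟨d, hd, hxy, hw⟩ := link h
  exact ⟨d, hd, fun i hi => hw _ (hx i hi).symm (hy i hi).symm, hxy⟩

theorem lev_trans {F F' a : Nat} (h : lev F F' a = true) (hF : F < 2 ^ 23) (ha : a < 23) {x : X}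
    (hx : x ∈ CL F F') : ∃ d ∈ DD, d ∈ Fx F ∧ d • bp ⟨a, ha⟩ = x := by
  have hb : ∀ i : Fin 23, F'.testBit i = false → ∃ d ∈ DD, d ∈ Fx F ∧ d • bp ⟨a, ha⟩ = bp i := by
    intro i hi
    obtain ⟨O, hO, hs, h1, h2⟩ := (lev_spec h).2.1 i hi
    have hO' : blk (org O (by omega)).1 < 276 := by rw [blk_org]; exact hO
    have c1 := ((CL_iff h hF _).mp (show bp ⟨a, ha⟩ ∈ CL F F' from Or.inr ⟨_, rfl, (lev_spec h).2.2.1⟩)).1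
    have c2 := ((CL_iff h hF _).mp (show bp i ∈ CL F F' from Or.inr ⟨_, rfl, hi⟩)).1
    have c3 : CN F (org O (by omega)) := (CN_nb hF hO').mpr (by rw [blk_org]; exact hs)
    obtain ⟨d, k1, k2, k3⟩ := link_F c1 c3 (by rw [Ad_bp_nb _ hO', blk_org]; simp [h2])
    obtain ⟨d', k1', k2', k3'⟩ := link_F c3 c2 (by rw [Ad_comm, Ad_bp_nb _ hO', blk_org]; simp [h1])
    exact ⟨d' * d, DD.mul_mem k1' k1, (Fx F).mul_mem k2' k2, by rw [mul_smul, k3, k3']⟩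
  rcases hx with ⟨hx, hs⟩ | ⟨i, rfl, hi⟩
  · obtain ⟨_, i, hi, hn⟩ := (lev_spec h).1 _ hx hs
    obtain ⟨d, k1, k2, k3⟩ := hb i hi
    have c2 := ((CL_iff h hF _).mp (show bp i ∈ CL F F' from Or.inr ⟨_, rfl, hi⟩)).1
    obtain ⟨d', k1', k2', k3'⟩ := link_F c2 ((CN_nb hF hx).mpr hs) (by rw [Ad_bp_nb _ hx]; simp [hn])
    exact ⟨d' * d, DD.mul_mem k1' k1, (Fx F).mul_mem k2' k2, by rw [mul_smul, k3, k3']⟩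
  · exact hb i hi

/-! ### Counting -/

theorem card_X (p : Nat → Bool) : Nat.card {x : X // p x.1 = true} =
    ∑ O ∈ Finset.range 299, ∑ u ∈ Finset.range (2 ^ dim O), if p (mk O u) = true then 1 else 0 := by
  classical
  obtain ⟨S, hSd⟩ : ∃ S : Finset (Σ _ : ℕ, ℕ), S = (Finset.range 299).sigma
    fun O => (Finset.range (2 ^ dim O)).filter fun u => p (mk O u) = true := ⟨_, rfl⟩
  have hS : ∀ a : Σ _ : ℕ, ℕ, a ∈ S ↔ a.1 < 299 ∧ a.2 < 2 ^ dim a.1 ∧ p (mk a.1 a.2) = true := by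
    intro a; rw [hSd]; simp
  have e : {x : X // p x.1 = true} ≃ S :=
    { toFun := fun x => ⟨⟨blk x.1.1, off x.1.1⟩, by
        rw [hS]; have := (vld_iff _).mp x.1.2
        exact ⟨this.1, this.2, by rw [mk_blk_off]; exact x.2⟩⟩
      invFun := fun a => ⟨⟨mk a.1.1 a.1.2, by
        have := (hS a.1).mp a.2
        exact vld_mk this.1 this.2.1⟩, ((hS a.1).mp a.2).2.2⟩
      left_inv := by intro x; apply Subtype.ext; apply Subtype.ext; exact mk_blk_off _
      right_inv := by
        intro a
        have h := (hS a.1).mp a.2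
        have h2 := lt_of_lt_of_le h.2.1 (pow_dim_le _)
        apply Subtype.ext
        show (⟨blk (mk a.1.1 a.1.2), off (mk a.1.1 a.1.2)⟩ : Σ _ : ℕ, ℕ) = a.1
        rw [blk_mk h2, off_mk h2] }
  rw [Nat.card_congr e, Nat.card_eq_fintype_card, Fintype.card_coe, hSd, Finset.card_sigma]
  apply Finset.sum_congr rfl
  intro O _
  rw [Finset.card_filter]

theorem card_blk (q : Nat → Bool) : Nat.card {x : X // q (blk x.1) = true} =
    ∑ O ∈ Finset.range 299, if q O = true then 2 ^ dim O else 0 := by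
  rw [card_X fun c => q (blk c)]
  apply Finset.sum_congr rfl
  intro O _
  have : ∀ u ∈ Finset.range (2 ^ dim O), (if q (blk (mk O u)) = true then 1 else 0) =
      if q O = true then 1 else 0 := by
    intro u hu
    rw [blk_mk (lt_of_lt_of_le (Finset.mem_range.mp hu) (pow_dim_le _))]
  rw [Finset.sum_congr rfl this]
  split_ifs <;> simp

theorem card_CL (F F' : Nat) : Nat.card (CL F F') = cnt F F' := by
  let q : Nat → Bool := fun O => if O < 276 then sub F (bs O) else !(F'.testBit (O - 276))
  have : CL F F' = {x : X | q (blk x.1) = true} := by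
    ext x
    simp only [CL, q, Set.mem_ofPred_eq]
    rcases X_cases x with ⟨i, rfl⟩ | hx
    · have h : ¬ (blk (bp i).1 < 276) := by rw [blk_bp]; omega
      have h2 : blk (bp i).1 - 276 = i.1 := by rw [blk_bp]; omega
      simp only [h, false_and, false_or, if_false, h2, Bool.not_eq_true']
      constructor
      · rintro ⟨j, hj, h⟩
        rw [bp_inj hj]; exact h
      · intro h; exact ⟨i, rfl, h⟩
    · simp only [hx, true_and, if_true]
      constructor
      · rintro (h | ⟨i, rfl, _⟩)
        · exact h
        · rw [blk_bp] at hx; omega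
      · exact Or.inl
  rw [this]
  have h2 := card_blk q
  refine h2.trans ?_
  unfold cnt
  rw [sumN_eq, sumN_eq, show (299 : ℕ) = 276 + 23 from rfl, Finset.sum_range_add]
  refine congrArg₂ (· + ·) ?_ ?_
  · apply Finset.sum_congr rfl
    intro O hO
    simp only [q, Finset.mem_range.mp hO, if_true]
    cases sub F (bs O) <;> rfl
  · apply Finset.sum_congr rfl
    intro i hi
    have h : ¬ (276 + i < 276) := by omega
    simp only [q, h, if_false, dim_base (show 276 ≤ 276 + i by omega), bit_eq, Nat.add_sub_cancel_left]
    cases F'.testBit i <;> rfl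

/-! ### Orbit counting -/

theorem card_step (H : Subgroup G) (a : X) (C : Set X) (h1 : ∀ g ∈ H, g • a ∈ C)
    (h2 : ∀ x ∈ C, ∃ d ∈ DD, d ∈ H ∧ d • a = x) :
    Nat.card H = Nat.card C * Nat.card ↥(H ⊓ MulAction.stabilizer G a) := by
  choose! d hd1 hd2 hd3 using h2
  let e : H ≃ C × ↥(H ⊓ MulAction.stabilizer G a) :=
    { toFun := fun g => (⟨g.1 • a, h1 _ g.2⟩, ⟨(d (g.1 • a))⁻¹ * g.1,
        H.mul_mem (H.inv_mem (hd2 _ (h1 _ g.2))) g.2, by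
          show ((d (g.1 • a))⁻¹ * g.1) • a = a
          rw [mul_smul, inv_smul_eq_iff, hd3 _ (h1 _ g.2)]⟩)
      invFun := fun p => ⟨d p.1.1 * p.2.1, H.mul_mem (hd2 _ p.1.2) p.2.2.1⟩
      left_inv := by intro g; apply Subtype.ext; simp
      right_inv := by
        rintro ⟨⟨x, hx⟩, ⟨k, hk⟩⟩
        have hk2 : k • a = a := hk.2
        have : (d x * k) • a = x := by rw [mul_smul, hk2, hd3 _ hx]
        apply Prod.ext
        · exact Subtype.ext this
        · apply Subtype.ext; simp [this] }
  rw [Nat.card_congr e, Nat.card_prod]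

theorem le_step (H : Subgroup G) (a : X) (C : Set X) (h1 : ∀ g ∈ H, g • a ∈ C)
    (h2 : ∀ x ∈ C, ∃ d ∈ DD, d ∈ H ∧ d • a = x) (h3 : H ⊓ MulAction.stabilizer G a ≤ DD) : H ≤ DD := by
  intro g hg
  obtain ⟨d, k1, k2, k3⟩ := h2 _ (h1 g hg)
  have : d⁻¹ * g ∈ DD := h3 ⟨H.mul_mem (H.inv_mem k2) hg, by
    show (d⁻¹ * g) • a = a
    rw [mul_smul, inv_smul_eq_iff, k3]⟩
  have h := DD.mul_mem k1 this
  rwa [mul_inv_cancel_left] at h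

theorem Fx_inf {F : Nat} {a : Nat} (ha : a < 23) :
    Fx F ⊓ MulAction.stabilizer G (bp ⟨a, ha⟩) = Fx (F ||| 2 ^ a) := by
  ext g
  rw [Subgroup.mem_inf, mem_Fx, mem_Fx, MulAction.mem_stabilizer_iff]
  constructor
  · rintro ⟨h1, h2⟩ i hi
    rw [Nat.testBit_or, Bool.or_eq_true, Nat.testBit_two_pow, decide_eq_true_iff] at hi
    rcases hi with hi | hi
    · exact h1 i hi
    · have : i = ⟨a, ha⟩ := Fin.ext hi.symm
      rw [this]; exact h2
  · intro h
    refine ⟨fun i hi => h i (by rw [Nat.testBit_or, hi]; rfl), h _ ?_⟩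
    rw [Nat.testBit_or, Nat.testBit_two_pow]; simp

theorem lev_card {F F' a n : Nat} (h : (lev F F' a && Nat.beq (cnt F F') n) = true) (hF : F < 2 ^ 23)
    : Nat.card (Fx F) = n * Nat.card (Fx (F ||| 2 ^ a)) ∧ (Fx (F ||| 2 ^ a) ≤ DD → Fx F ≤ DD) := by
  rw [Bool.and_eq_true, Nat.beq_eq] at h
  have ha := (lev_spec h.1).2.2.2.2
  rw [← Fx_inf ha, ← h.2, ← card_CL]
  exact ⟨card_step _ _ _ (fun g hg => lev_orbit h.1 hF ha hg) (fun x hx => lev_trans h.1 hF ha hx),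
    le_step _ _ _ (fun g hg => lev_orbit h.1 hF ha hg) (fun x hx => lev_trans h.1 hF ha hx)⟩


/-! ### The stabilizer chain: small levels -/

theorem cen_spec {F H : Nat} (h : cen F H = true) : sub F (bs H) = true ∧ H < 276 ∧
    ∀ O, O < 276 → sub F (bs O) = true → sub (bs H) (bs O) = true ∧
      ∃ i : Fin 23, F.testBit i = false ∧ (bs O).testBit i = false := by
  unfold cen at h
  simp only [Bool.and_eq_true, Nat.ble_eq] at h
  refine ⟨h.1, h.2.1, ?_⟩
  intro O hO hs
  have := allN_spec h.2.2 O hO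
  rw [hs, cond_true, Bool.and_eq_true] at this
  obtain ⟨i, hi, hh⟩ := exN_spec this.2
  simp only [Bool.and_eq_true, Bool.not_eq_true', bit_eq] at hh
  exact ⟨this.1, ⟨i, hi⟩, hh⟩

/-- Central points among common neighbours. -/
def Cen (F : Nat) (x : X) : Prop := CN F x ∧ ∀ y, CN F y → x ≠ y → Ad x y

theorem Cen_smul {F : Nat} {g : G} (hg : g ∈ Fx F) {x : X} (h : Cen F x) : Cen F (g • x) := by
  refine ⟨CN_smul hg h.1, fun y hy hne => ?_⟩
  have := h.2 (g⁻¹ • y) (CN_smul ((Fx F).inv_mem hg) hy) (by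
    intro e; exact hne (by rw [e, smul_inv_smul]))
  rw [← Ad_smul g, smul_inv_smul] at this
  exact this

theorem Cen_iff {F H : Nat} (h : cen F H = true) (x : X) :
    Cen F x ↔ ∃ q : Fin 23, x = bp q ∧ (bs H).testBit q = true ∧ F.testBit q = false := by
  obtain ⟨h1, h2, h3⟩ := cen_spec h
  have hF : F < 2 ^ 23 := by
    apply Nat.lt_pow_two_of_testBit
    intro k hk
    by_contra hb
    rw [Bool.not_eq_false] at hb
    have := lt23 (bs_lt H) (sub_iff.mp h1 k hb)
    omega
  have hO' : blk (org H (by omega)).1 < 276 := by rw [blk_org]; exact h2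
  constructor
  · rintro ⟨hc, hx⟩
    rcases X_cases x with ⟨q, rfl⟩ | hlt
    · refine ⟨q, rfl, ?_, (CN_bp q).mp hc⟩
      have := hx (org H (by omega)) ((CN_nb hF hO').mpr (by rw [blk_org]; exact h1)) (bp_ne_nb q hO')
      rwa [Ad_bp_nb q hO', blk_org] at this
    · exfalso
      obtain ⟨_, i, hi, hn⟩ := h3 _ hlt ((CN_nb hF hlt).mp hc)
      have := hx (bp i) ((CN_bp i).mpr hi) (bp_ne_nb i hlt).symm
      rw [Ad_comm, Ad_bp_nb i hlt, hn] at this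
      cases this
  · rintro ⟨q, rfl, hq, hqF⟩
    refine ⟨(CN_bp q).mpr hqF, fun y hy hne => ?_⟩
    rcases X_cases y with ⟨j, rfl⟩ | hlt
    · rw [Ad_bp_bp]; rintro rfl; exact hne rfl
    · rw [Ad_bp_nb q hlt]
      exact sub_iff.mp (h3 _ hlt ((CN_nb hF hlt).mp hy)).1 _ hq

theorem cen_move {F H : Nat} (h : cen F H = true) {g : G} (hg : g ∈ Fx F) {p : Fin 23}
    (hp : (bs H).testBit p = true) (hpF : F.testBit p = false) :
    ∃ q : Fin 23, g • bp p = bp q ∧ (bs H).testBit q = true ∧ F.testBit q = false :=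
  (Cen_iff h _).mp (Cen_smul hg ((Cen_iff h _).mpr ⟨p, rfl, hp, hpF⟩))

theorem Fx_mono {F F' : Nat} (h : sub F F' = true) : Fx F' ≤ Fx F :=
  fun _ hg i hi => hg i (sub_iff.mp h _ hi)

theorem sub_land (F M : Nat) : sub (Nat.land F M) F = true := by
  rw [sub_iff]; intro k hk
  have hk' : (F &&& M).testBit k = true := hk
  rw [Nat.testBit_and, Bool.and_eq_true] at hk'; exact hk'.1

theorem step1_spec {F : Nat} {p : Fin 23} (hp : F.testBit p = false) {g : G} (hg : g ∈ Fx F) {q : Fin 23}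
    (hq : g • bp p = bp q) : ∀ l, step1 F p l = true → (inter l).testBit q = true := by
  intro l
  induction l with
  | nil =>
    intro _
    have : ∀ q : Fin 23, (8388607 : Nat).testBit q = true := by decide
    exact this q
  | cons H l ih =>
    intro h
    unfold step1 at h
    simp only [Bool.and_eq_true, bit_eq] at h
    have hpF : (Nat.land F (bs H)).testBit p = false := by
      show (F &&& bs H).testBit p = false
      rw [Nat.testBit_and, hp]; rfl
    obtain ⟨q', h1, h2, h3⟩ := cen_move h.2.1 (Fx_mono (sub_land _ _) hg) h.1 hpF
    rw [hq] at h1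
    rw [← bp_inj h1] at h2
    show (bs H &&& inter l).testBit q = true
    rw [Nat.testBit_and, h2, ih h.2.2]; rfl

theorem step1_notF {F : Nat} {p : Fin 23} (hp : F.testBit p = false) {g : G} (hg : g ∈ Fx F) {q : Fin 23}
    (hq : g • bp p = bp q) : F.testBit q = false := by
  by_contra hb
  rw [Bool.not_eq_false] at hb
  have := hg q hb
  rw [← hq] at this
  have h2 := smul_left_cancel g this
  rw [hq] at h2
  rw [bp_inj h2, hp] at hb
  cases hb

theorem steps_spec : ∀ l F, steps l F = true → Fx F ≤ Fx 8388607 := by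
  intro l
  induction l with
  | nil =>
    intro F h
    unfold steps at h
    rw [Nat.beq_eq] at h
    rw [h]
  | cons a r ih =>
    obtain ⟨p, H, l⟩ := a
    intro F h
    unfold steps at h
    simp only [Bool.and_eq_true, Bool.not_eq_true', Nat.ble_eq, bit_eq] at h
    obtain ⟨h1, h2, h3, h4, h5⟩ := h
    refine le_trans ?_ (ih _ h5)
    have e : Nat.lor F (Nat.pow 2 p) = F ||| 2 ^ p := rfl
    rw [e, ← Fx_inf h3]
    intro g hg
    refine ⟨hg, ?_⟩
    show g • bp ⟨p, h3⟩ = bp ⟨p, h3⟩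
    have h2' := h2
    unfold step1 at h2'
    simp only [Bool.and_eq_true, bit_eq] at h2'
    have hpF : (Nat.land F (bs H)).testBit p = false := by
      show (F &&& bs H).testBit p = false
      rw [Nat.testBit_and, h1]; rfl
    obtain ⟨q, k1, _, _⟩ := cen_move h2'.2.1 (p := ⟨p, h3⟩) (Fx_mono (sub_land _ _) hg) h2'.1 hpF
    have k2 := step1_spec (p := ⟨p, h3⟩) h1 hg k1 _ h2
    have k3 := step1_notF (p := ⟨p, h3⟩) h1 hg k1
    have k4 := allN_spec h4 q.1 q.2
    rw [k3, k2] at k4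
    simp at k4
    rw [k1]; congr 1; exact Fin.ext k4

/-! Level six. -/

def tauG : G := TG * (eG 0 * (eG 1 * TG))
def nG : G := AG * (AG * (RG * RG))
def dG : G := tauG * (nG * tauG * nG⁻¹)

theorem tauG_mem : tauG ∈ DD := DD.mul_mem T_mem (DD.mul_mem (e_mem _) (DD.mul_mem (e_mem _) T_mem))
theorem dG_mem : dG ∈ DD := DD.mul_mem tauG_mem ((inferInstance : DD.Normal).conj_mem _ tauG_mem nG)

theorem tauG_val (x : X) : (tauG • x).1 = tau x.1 := by
  unfold tauG tau; simp only [mul_smul]; rfl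
theorem nG_val (x : X) : (nG • x).1 = nn x.1 := by
  unfold nG nn; simp only [mul_smul]; rfl

theorem cyc_spec {q q' : Nat} (hq : q < 23) (hq' : q' < 23) (h : cyc' q q' = true) :
    dG • bp ⟨q, hq⟩ = bp ⟨q', hq'⟩ := by
  obtain ⟨j, hj, h⟩ := exN_spec h
  unfold cyc at h
  rw [Bool.and_eq_true, Nat.beq_eq, Nat.beq_eq] at h
  have h1 : nG • bp ⟨j, hj⟩ = bp ⟨q, hq⟩ := Subtype.ext (by rw [nG_val]; exact h.1)
  have h2 : tauG • nG • tauG • bp ⟨j, hj⟩ = bp ⟨q', hq'⟩ :=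
    Subtype.ext (by rw [tauG_val, nG_val, tauG_val]; exact h.2)
  unfold dG
  rw [mul_smul, mul_smul, mul_smul, ← h1, inv_smul_smul, h2]

theorem chk_cen6 : cen 20768 226 = true := by decide +kernel
theorem chk_bs6 : allN 23 (fun q => cond (bit (bs 226) q && !(bit 1069344 q))
    (Nat.beq q 0 || (Nat.beq q 6 || Nat.beq q 21)) true) = true := by decide +kernel
theorem chk_bs6' : (bit (bs 226) 0) = true := by decide +kernel

theorem dG_spec : dG ∈ Fx 1069344 ∧ dG • bp 0 = bp 21 ∧ dG • bp 21 = bp 6 := by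
  have h := chk_cyc
  simp only [Bool.and_eq_true] at h
  obtain ⟨h1, h2, h3, h4, h5, h6, h7, h8⟩ := h
  refine ⟨?_, cyc_spec (by norm_num) (by norm_num) h6, cyc_spec (by norm_num) (by norm_num) h7⟩
  intro i hi
  have : ∀ i : Fin 23, (1069344 : Nat).testBit i = true → i = 5 ∨ i = 8 ∨ i = 12 ∨ i = 14 ∨ i = 20 := by decide
  rcases this i hi with rfl | rfl | rfl | rfl | rfl
  · exact cyc_spec (by norm_num) (by norm_num) h1
  · exact cyc_spec (by norm_num) (by norm_num) h2
  · exact cyc_spec (by norm_num) (by norm_num) h3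
  · exact cyc_spec (by norm_num) (by norm_num) h4
  · exact cyc_spec (by norm_num) (by norm_num) h5

def C6 : Set X := {bp 0, bp 21, bp 6}

theorem C6_orbit {g : G} (hg : g ∈ Fx 1069344) : g • bp 0 ∈ C6 := by
  obtain ⟨q, h1, h2, h3⟩ := cen_move chk_cen6 (g := g) (p := 0) (Fx_mono (by decide +kernel) hg)
    (by rw [← bit_eq]; exact chk_bs6') (by decide)
  have h4 := step1_notF (F := 1069344) (p := 0) (by decide) hg h1
  have h5 := allN_spec chk_bs6 q.1 q.2
  rw [bit_eq, bit_eq, h2, h4] at h5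
  simp at h5
  rw [h1]
  rcases h5 with h5 | h5 | h5
  · left; rw [h5]
  · right; right; rw [show q = 6 from Fin.ext h5]; rfl
  · right; left; rw [show q = 21 from Fin.ext h5]

theorem C6_trans {x : X} (hx : x ∈ C6) : ∃ d ∈ DD, d ∈ Fx 1069344 ∧ d • bp 0 = x := by
  obtain ⟨h1, h2, h3⟩ := dG_spec
  rcases hx with rfl | rfl | hx
  · exact ⟨1, DD.one_mem, Subgroup.one_mem _, one_smul _ _⟩
  · exact ⟨dG, dG_mem, h1, h2⟩
  · rw [Set.mem_singleton_iff] at hx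
    subst hx
    exact ⟨dG * dG, DD.mul_mem dG_mem dG_mem, Subgroup.mul_mem _ h1 h1, by rw [mul_smul, h2, h3]⟩

theorem bp_ne {i j : Fin 23} (h : i ≠ j) : bp i ≠ bp j := fun e => h (bp_inj e)

theorem card_C6 : Nat.card C6 = 3 := by
  rw [Nat.card_coe_set_eq]
  unfold C6
  rw [Set.ncard_insert_of_notMem, Set.ncard_pair (bp_ne (by decide))]
  rintro (h | h)
  · exact absurd (bp_inj h) (by decide)
  · exact absurd (bp_inj h) (by decide)

/-! Elements fixing all base points. -/

theorem fixall {g : G} (hg : g ∈ Fx 8388607) (i : Fin 23) : g • bp i = bp i := by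
  have : ∀ q : Fin 23, (8388607 : Nat).testBit q = true := by decide
  exact hg i (this i)

theorem fix_blk {g : G} (hg : g ∈ Fx 8388607) (x : X) : blk (g • x).1 = blk x.1 := by
  rcases X_cases x with ⟨i, rfl⟩ | hx
  · rw [fixall hg]
  rcases X_cases (g • x) with ⟨i, hi⟩ | hgx
  · rw [← fixall hg i] at hi
    rw [smul_left_cancel g hi, fixall hg]
  have hb : bs (blk (g • x).1) = bs (blk x.1) := by
    apply Nat.eq_of_testBit_eq
    intro k
    rcases lt_or_ge k 23 with hk | hk
    · rw [Bool.eq_iff_iff, ← Ad_bp_nb ⟨k, hk⟩ hgx, ← Ad_bp_nb ⟨k, hk⟩ hx]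
      conv_lhs => rw [← fixall hg ⟨k, hk⟩, Ad_smul]
    · rw [Nat.testBit_lt_two_pow (lt_of_lt_of_le (bs_lt _) (Nat.pow_le_pow_right (by norm_num) hk)),
        Nat.testBit_lt_two_pow (lt_of_lt_of_le (bs_lt _) (Nat.pow_le_pow_right (by norm_num) hk))]
  have := allN_spec (allN_spec chk_bsinj _ hgx) _ hx
  rw [Bool.or_eq_true, Nat.beq_eq] at this
  rcases this with h | h
  · exact h
  · rw [hb] at h; simp at h

theorem fix_comm {g : G} (hg : g ∈ Fx 8388607) (i : Fin 23) (x : X) : g • eG i • x = eG i • g • x := by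
  have h := ct_smul g (bp i)
  rw [fixall hg, ct_bp] at h
  conv_rhs => rw [h]
  rw [mul_smul, mul_smul, inv_smul_smul]

/-- Translation part of an element on a block. -/
def sh (g : G) (O : Nat) : Nat := if h : O < 299 then off (g • org O h).1 else 0

theorem sh_lt {g : G} (hg : g ∈ Fx 8388607) {O : Nat} (h : O < 299) : sh g O < 2 ^ dim O := by
  unfold sh
  rw [dif_pos h]
  have h1 := ((vld_iff _).mp (g • org O h).2).2
  rwa [fix_blk hg, blk_org] at h1

theorem fix_sh {g : G} (hg : g ∈ Fx 8388607) (x : X) :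
    (g • x).1 = mk (blk x.1) (off x.1 ^^^ sh g (blk x.1)) := by
  refine ea_ind_all (fun c => ∀ hc : vld c = true,
    (g • (⟨c, hc⟩ : X)).1 = mk (blk c) (off c ^^^ sh g (blk c))) ?_ ?_ x.1 x.2 x.2
  · intro i c hi hc hQ hc'
    have e : (⟨ea i c, hc'⟩ : X) = eG ⟨i, hi⟩ • (⟨c, hc⟩ : X) := rfl
    have hb := fix_blk hg ⟨c, hc⟩
    have hlt : off c ^^^ sh g (blk c) < 1024 := by
      have h := (vld_iff _).mp hc
      exact lt_of_lt_of_le (Nat.xor_lt_two_pow h.2 (sh_lt hg h.1)) (pow_dim_le _)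
    rw [e, fix_comm hg, eG_val, ea_eq, hQ hc, blk_ea, off_ea, blk_mk hlt, off_mk hlt, Nat.xor_assoc,
      Nat.xor_assoc, Nat.xor_comm (sh g (blk c))]
  · intro O hO hc
    rw [blk_mk (by norm_num), off_mk (by norm_num), Nat.zero_xor]
    have e : (⟨mk O 0, hc⟩ : X) = org O hO := rfl
    rw [e]
    have hb := fix_blk hg (org O hO)
    rw [blk_org] at hb
    have := mk_blk_off (g • org O hO).1
    rw [hb] at this
    rw [← this]
    unfold sh
    rw [dif_pos hO]

theorem fix_of_sh {g : G} (hg : g ∈ Fx 8388607) {x : X} (h : sh g (blk x.1) = 0) : g • x = x := by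
  apply Subtype.ext
  rw [fix_sh hg, h, Nat.xor_zero, mk_blk_off]

theorem sh_of_fix {g : G} (hg : g ∈ Fx 8388607) {x : X} (h : g • x = x) : sh g (blk x.1) = 0 := by
  have h1 := fix_sh hg x
  rw [h] at h1
  have h2 := (vld_iff _).mp x.2
  have hlt := lt_of_lt_of_le (Nat.xor_lt_two_pow h2.2 (sh_lt hg h2.1)) (pow_dim_le _)
  have h3 : off x.1 = off x.1 ^^^ sh g (blk x.1) := by
    conv_lhs => rw [h1, off_mk hlt]
  have h4 : off x.1 ^^^ off x.1 = off x.1 ^^^ (off x.1 ^^^ sh g (blk x.1)) := by rw [← h3]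
  rw [Nat.xor_self, ← Nat.xor_assoc, Nat.xor_self, Nat.zero_xor] at h4
  exact h4.symm

/-! Level seven. -/

def m0 : X := org 5 (by norm_num)

theorem card_C7 : Nat.card {x : X | blk x.1 = 5} = 1024 := by
  have h := card_blk fun O => decide (O = 5)
  simp only [decide_eq_true_eq] at h
  refine h.trans ?_
  rw [Finset.sum_ite_eq']
  rw [if_pos (by simp), dim_monad (by norm_num)]; norm_num

/-! Level eight. -/

theorem adj_sh {g : G} (hg : g ∈ Fx 8388607) {c d : Nat} (hc : vld c = true) (hd : vld d = true) :
    adj (mk (blk c) (off c ^^^ sh g (blk c))) (mk (blk d) (off d ^^^ sh g (blk d))) = adj c d := by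
  have h := Ad_smul g ⟨c, hc⟩ ⟨d, hd⟩
  unfold Ad at h
  rw [fix_sh hg, fix_sh hg] at h
  exact Bool.eq_iff_iff.mpr h

theorem adj_sh_mk {g : G} (hg : g ∈ Fx 8388607) {O P u v : Nat} (hO : O < 299) (hP : P < 299)
    (hu : u < 2 ^ dim O) (hv : v < 2 ^ dim P) :
    adj (mk O (u ^^^ sh g O)) (mk P (v ^^^ sh g P)) = adj (mk O u) (mk P v) := by
  have h := adj_sh hg (vld_mk hO hu) (vld_mk hP hv)
  rwa [blk_mk (lt_of_lt_of_le hu (pow_dim_le _)), off_mk (lt_of_lt_of_le hu (pow_dim_le _)),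
    blk_mk (lt_of_lt_of_le hv (pow_dim_le _)), off_mk (lt_of_lt_of_le hv (pow_dim_le _))] at h

theorem sh_hept {g : G} (hg : g ∈ Fx 8388607) (h5 : sh g 5 = 0) {O : Nat} (h1 : 23 ≤ O) (h2 : O < 276) :
    sh g O = 0 ∨ sh g O = tr O 5 := by
  have hd := dim_hept h1 h2
  have hs := sh_lt hg (show O < 299 by omega)
  rw [hd] at hs
  have h := allN_spec chk_hm (O - 23) (by omega)
  have e : Nat.add 23 (O - 23) = O := by show 23 + (O - 23) = O; omega
  rw [strict_eq, e] at h
  have h := allN_spec h _ hs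
  rw [Bool.or_eq_true, Bool.or_eq_true, Nat.beq_eq, Nat.beq_eq] at h
  rcases h with h | h | h
  · exact Or.inl h
  · exact Or.inr h
  · exfalso
    obtain ⟨u, hu, hh⟩ := exN_spec h
    have := adj_sh_mk hg (show 5 < 299 by norm_num) (show O < 299 by omega) (u := 0) (v := u)
      (by positivity) (by rw [hd]; exact hu)
    rw [h5, Nat.xor_zero] at this
    have e5 : mk 5 0 = 5120 := rfl
    rw [e5] at this
    have e6 : Nat.xor u (sh g O) = u ^^^ sh g O := rfl
    rw [e6, this] at hh
    simp at hh

def x1 : X := ⟨mk 24 17, vld_mk (by norm_num) (by rw [dim_hept (by norm_num) (by norm_num)]; norm_num)⟩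

theorem blk_x1 : blk x1.1 = 24 := blk_mk (by norm_num)
theorem blk_m0 : blk m0.1 = 5 := blk_org _ _

theorem e5_m0 : eG 5 • m0 = m0 := by
  rw [isTr_e, Ad_bp_nb 5 (by rw [blk_m0]; norm_num), blk_m0]
  left; rw [← bit_eq]; decide +kernel

theorem e5_x1 : eG 5 • x1 ≠ x1 := by
  rw [Ne, isTr_e, Ad_bp_nb 5 (by rw [blk_x1]; norm_num), blk_x1, bs_tr (by norm_num) (by norm_num)]
  have := chk_hm24
  rw [Nat.beq_eq] at this
  rintro (h | h)
  · have h' : tr 24 5 = 0 := by simpa using h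
    omega
  · exact bp_ne_nb 5 (by rw [blk_x1]; norm_num) h.symm

/-! Level nine. -/

theorem sh_par {g : G} (hg : g ∈ Fx 8388607) (h5 : sh g 5 = 0) (h24 : sh g 24 = 0) :
    ∀ k, k < 175 → sh g (23 + parT k % 256) = 0 := by
  intro k
  induction k using Nat.strong_induction_on with
  | _ k ih =>
    intro hk
    have h := allN_spec chk_par k hk
    rw [strict_eq, strict_eq] at h
    simp only [Bool.and_eq_true, Bool.or_eq_true, Nat.ble_eq, Nat.beq_eq] at h
    obtain ⟨hP, hO, h1, h2⟩ := h
    have eP : Nat.add 23 (Nat.mod (parT k) 256) = 23 + parT k % 256 := rfl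
    have eO : Nat.add 23 (Nat.div (parT k) 256) = 23 + parT k / 256 := rfl
    rw [eP] at hP h2
    rw [eO] at hO h1 h2
    obtain ⟨P, hPd⟩ : ∃ P, P = 23 + parT k % 256 := ⟨_, rfl⟩
    obtain ⟨O, hOd⟩ : ∃ O, O = 23 + parT k / 256 := ⟨_, rfl⟩
    rw [← hPd] at hP h2 ⊢
    rw [← hOd] at hO h1 h2
    have hPl : P < 276 := hP
    have hOl : O < 276 := hO
    have hsO : sh g O = 0 := by
      rcases h1 with h1 | h1
      · rw [h1]; exact h24
      · obtain ⟨j, hj, hh⟩ := exN_spec h1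
        rw [Nat.beq_eq] at hh
        have hh' : 23 + parT j % 256 = O := hh
        rw [← hh']
        exact ih j hj (by omega)
    rcases sh_hept hg h5 (show 23 ≤ P by omega) hPl with h3 | h3
    · exact h3
    · exfalso
      obtain ⟨u, hu, hh⟩ := exN_spec h2
      rw [Bool.and_eq_true, Bool.not_eq_true'] at hh
      have := adj_sh_mk hg (show O < 299 by omega) (show P < 299 by omega) (u := 0) (v := u)
        (by positivity) (by rw [dim_hept (by omega) hPl]; exact hu)
      rw [hsO, Nat.xor_zero, h3, hh.1] at this
      have e6 : Nat.xor u (tr P 5) = u ^^^ tr P 5 := rfl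
      rw [e6, this] at hh
      exact Bool.noConfusion hh.2

theorem sh_all {g : G} (hg : g ∈ Fx 8388607) (h5 : sh g 5 = 0) (h24 : sh g 24 = 0) {O : Nat} (h1 : 23 ≤ O)
    (h2 : O < 276) : sh g O = 0 := by
  have h := allN_spec chk_parall (O - 23) (by omega)
  have e : Nat.add 23 (O - 23) = O := by show 23 + (O - 23) = O; omega
  rw [e, Bool.or_eq_true, Bool.or_eq_true, Nat.beq_eq, Nat.beq_eq] at h
  rcases h with h | h | h
  · rcases sh_hept hg h5 h1 h2 with h3 | h3
    · exact h3
    · rw [h3, h]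
  · rw [show O = 24 by omega]; exact h24
  · obtain ⟨k, hk, hh⟩ := exN_spec h
    rw [Nat.beq_eq] at hh
    have h3 := sh_par hg h5 h24 k hk
    have hh' : parT k % 256 = O - 23 := hh
    rwa [hh', show 23 + (O - 23) = O by omega] at h3

theorem monAll_spec : ∀ (L : List (List Nat)) (j : Nat), monAll j L = true → ∀ k, k < L.length →
    ∃ l, monOk (j + k) l = true ∧ ∀ s, s < 1024 → s ≠ 0 → monEx (j + k) s l = true := by
  intro L
  induction L with
  | nil => intro j _ k hk; simp at hk
  | cons l r ih =>
    intro j h k hk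
    unfold monAll at h
    simp only [Bool.and_eq_true] at h
    cases k with
    | zero =>
      refine ⟨l, h.1.1, fun s hs hs0 => ?_⟩
      have := allN_spec h.1.2 s hs
      rw [Bool.or_eq_true, Nat.beq_eq] at this
      exact this.resolve_left hs0
    | succ k =>
      have := ih _ h.2 k (by simpa using hk)
      rw [show Nat.succ j + k = j + (k + 1) by omega] at this
      exact this

theorem mon_wit {j s : Nat} (l : List Nat) (h1 : monOk j l = true) (h2 : monEx j s l = true) :
    ∃ w, vld w = true ∧ 23 ≤ blk w ∧ blk w < 276 ∧ adj (mk j 0) w = true ∧ adj (mk j s) w = false := by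
  induction l with
  | nil => simp [monEx] at h2
  | cons w l ih =>
    unfold monOk at h1
    unfold monEx at h2
    simp only [Bool.and_eq_true, Bool.or_eq_true, Nat.ble_eq, Bool.not_eq_true'] at h1 h2
    rcases h2 with h2 | h2
    · exact ⟨w, h1.1.2.1, h1.1.2.2.1, h1.1.2.2.2, h1.1.1, h2⟩
    · exact ih h1.2 h2

theorem sh_mon {g : G} (hg : g ∈ Fx 8388607) (hh : ∀ O, 23 ≤ O → O < 276 → sh g O = 0) {j : Nat} (hj : j < 23) :
    sh g j = 0 := by
  by_contra hne
  have h := chk_mon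
  rw [Bool.and_eq_true, Nat.beq_eq] at h
  have hs := sh_lt hg (show j < 299 by omega)
  rw [dim_monad hj] at hs
  obtain ⟨l, h1, h2⟩ := monAll_spec _ _ h.2 j (by rw [h.1]; exact hj)
  rw [Nat.zero_add] at h1 h2
  obtain ⟨w, k1, k2, k3, k4, k5⟩ := mon_wit l h1 (h2 _ hs hne)
  have := adj_sh hg (vld_mk (show j < 299 by omega) (u := 0) (by positivity)) k1
  rw [hh _ k2 k3, blk_mk (by norm_num), off_mk (by norm_num), Nat.xor_zero, Nat.zero_xor, mk_blk_off,
    k4, k5] at this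
  cases this

theorem triv {g : G} (hg : g ∈ Fx 8388607) (h1 : g • m0 = m0) (h2 : g • x1 = x1) : g = 1 := by
  have h5 := sh_of_fix hg h1
  have h24 := sh_of_fix hg h2
  rw [blk_m0] at h5
  rw [blk_x1] at h24
  have hh : ∀ O, 23 ≤ O → O < 276 → sh g O = 0 := fun O a b => sh_all hg h5 h24 a b
  apply G_ext
  intro x
  rw [one_smul]
  rcases X_cases x with ⟨i, rfl⟩ | hx
  · exact fixall hg i
  · apply fix_of_sh hg
    rcases lt_or_ge (blk x.1) 23 with h | h
    · exact sh_mon hg hh h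
    · exact hh _ h hx


/-! ### The order of the group -/

theorem Fx_last : Fx 1069345 = Fx 8388607 :=
  le_antisymm (steps_spec _ _ chk_steps) (Fx_mono (by decide +kernel))

theorem lev6 : Nat.card (Fx 1069344) = 3 * Nat.card (Fx 8388607) ∧ (Fx 8388607 ≤ DD → Fx 1069344 ≤ DD) := by
  have e : Fx 1069344 ⊓ MulAction.stabilizer G (bp 0) = Fx 8388607 := by
    have := Fx_inf (F := 1069344) (a := 0) (by norm_num)
    rw [← Fx_last]; exact this
  rw [← e, ← card_C6]
  exact ⟨card_step _ _ _ (fun g hg => C6_orbit hg) (fun x hx => C6_trans hx),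
    le_step _ _ _ (fun g hg => C6_orbit hg) (fun x hx => C6_trans hx)⟩

theorem lev7_orbit {g : G} (hg : g ∈ Fx 8388607) : g • m0 ∈ {x : X | blk x.1 = 5} := by
  show blk (g • m0).1 = 5
  rw [fix_blk hg, blk_m0]

theorem lev7_trans {x : X} (hx : x ∈ {x : X | blk x.1 = 5}) : ∃ d ∈ DD, d ∈ Fx 8388607 ∧ d • m0 = x := by
  have hx' : blk x.1 = 5 := hx
  obtain ⟨d, h1, h2, h3⟩ := E_trans (x := m0) (y := x) (by rw [blk_m0, hx'])
  exact ⟨d, h1, fun i _ => h2 i, h3⟩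

def H7 : Subgroup G := Fx 8388607 ⊓ MulAction.stabilizer G m0

theorem lev8_orbit {g : G} (hg : g ∈ H7) : g • x1 ∈ ({x1, eG 5 • x1} : Set X) := by
  obtain ⟨h1, h2⟩ := hg
  have h5 := sh_of_fix h1 (show g • m0 = m0 from h2)
  rw [blk_m0] at h5
  rcases sh_hept h1 h5 (O := 24) (by norm_num) (by norm_num) with h | h
  · left; exact fix_of_sh h1 (by rw [blk_x1]; exact h)
  · right
    apply Subtype.ext
    rw [fix_sh h1, eG_val, ea_eq, blk_x1, h]; rfl

theorem lev8_trans {x : X} (hx : x ∈ ({x1, eG 5 • x1} : Set X)) : ∃ d ∈ DD, d ∈ H7 ∧ d • x1 = x := by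
  rcases hx with rfl | hx
  · exact ⟨1, DD.one_mem, Subgroup.one_mem _, one_smul _ _⟩
  · rw [Set.mem_singleton_iff] at hx
    exact ⟨eG 5, e_mem _, ⟨fun i _ => e_bp _ _, e5_m0⟩, hx.symm⟩

theorem H9 : H7 ⊓ MulAction.stabilizer G x1 = ⊥ := by
  rw [eq_bot_iff]
  rintro g ⟨⟨h1, h2⟩, h3⟩
  exact triv h1 h2 h3

theorem chain : Nat.card (Fx 0) = 4089470473293004800 ∧ Fx 0 ≤ DD := by
  obtain ⟨a1, b1⟩ := lev_card chk_lev1 (by norm_num)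
  obtain ⟨a2, b2⟩ := lev_card chk_lev2 (by norm_num)
  obtain ⟨a3, b3⟩ := lev_card chk_lev3 (by norm_num)
  obtain ⟨a4, b4⟩ := lev_card chk_lev4 (by norm_num)
  obtain ⟨a5, b5⟩ := lev_card chk_lev5 (by norm_num)
  obtain ⟨a6, b6⟩ := lev6
  have a7 := card_step _ _ _ (fun g hg => lev7_orbit hg) (fun x hx => lev7_trans hx)
  have b7 := le_step _ _ _ (fun g hg => lev7_orbit hg) (fun x hx => lev7_trans hx)
  have a8 := card_step _ _ _ (fun g hg => lev8_orbit hg) (fun x hx => lev8_trans hx)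
  have b8 := le_step _ _ _ (fun g hg => lev8_orbit hg) (fun x hx => lev8_trans hx)
  rw [H9] at a8 b8
  rw [card_C7] at a7
  rw [Nat.card_coe_set_eq, Set.ncard_pair e5_x1.symm, Subgroup.card_bot] at a8
  have a7' : Nat.card (Fx 8388607) = 1024 * Nat.card H7 := a7
  rw [a8] at a7'
  have e1 : 0 ||| 2 ^ 5 = 32 := by decide
  have e2 : 32 ||| 2 ^ 8 = 288 := by decide
  have e3 : 288 ||| 2 ^ 12 = 4384 := by decide
  have e4 : 4384 ||| 2 ^ 14 = 20768 := by decide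
  have e5 : 20768 ||| 2 ^ 20 = 1069344 := by decide
  rw [e1] at a1 b1
  rw [e2] at a2 b2
  rw [e3] at a3 b3
  rw [e4] at a4 b4
  rw [e5] at a5 b5
  refine ⟨?_, b1 (b2 (b3 (b4 (b5 (b6 (b7 (b8 bot_le)))))))⟩
  rw [a1, a2, a3, a4, a5, a6, a7']

theorem Fx_zero : Fx 0 = ⊤ := by
  rw [eq_top_iff]
  intro g _ i hi
  simp at hi

theorem card_G : Nat.card G = 4089470473293004800 := by
  have h := chain.1
  rw [Fx_zero] at h
  rw [← h]
  exact (Nat.card_congr Subgroup.topEquiv.toEquiv).symm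

theorem DD_top : DD = ⊤ := by
  rw [eq_top_iff, ← Fx_zero]; exact chain.2

/-! ### Simplicity -/

theorem adj_trans {x y : X} (h : Ad x y) : ∃ g : G, g • x = bp 5 ∧ g • y = bp 8 := by
  obtain ⟨g, hg⟩ := trans x (bp 5)
  have h1 : Ad (bp 5) (g • y) := by rw [← hg, Ad_smul]; exact h
  have hl := chk_lev2
  rw [Bool.and_eq_true] at hl
  have h2 : g • y ∈ CL 32 32 := by
    rcases X_cases (g • y) with ⟨i, hi⟩ | hlt
    · right
      refine ⟨i, hi, ?_⟩
      rw [hi, Ad_bp_bp] at h1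
      have : ∀ i : Fin 23, 5 ≠ i → (32 : Nat).testBit i = false := by decide
      exact this i h1
    · left
      refine ⟨hlt, sub_fin (by norm_num) ?_⟩
      intro i hi
      have : ∀ i : Fin 23, (32 : Nat).testBit i = true → i = 5 := by decide
      rw [this i hi]
      exact (Ad_bp_nb 5 hlt).mp h1
  obtain ⟨d, _, hd, hd2⟩ := lev_trans hl.1 (by norm_num) (by norm_num) h2
  refine ⟨d⁻¹ * g, ?_, ?_⟩
  · rw [mul_smul, hg, inv_smul_eq_iff, hd 5 (by decide)]
  · rw [mul_smul, inv_smul_eq_iff]; exact hd2.symm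

theorem chk_58 : exN 276 (fun O => !(bit (bs O) 5) && !(bit (bs O) 8)) = true := by decide +kernel

theorem common58 : ∃ y : X, blk y.1 < 276 ∧ ¬ Ad (bp 5) y ∧ ¬ Ad (bp 8) y := by
  obtain ⟨O, hO, h⟩ := exN_spec chk_58
  rw [Bool.and_eq_true, Bool.not_eq_true', Bool.not_eq_true', bit_eq, bit_eq] at h
  have hO' : blk (org O (by omega)).1 < 276 := by rw [blk_org]; exact hO
  refine ⟨org O (by omega), hO', ?_, ?_⟩
  · rw [Ad_bp_nb 5 hO', blk_org]; simpa using h.1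
  · rw [Ad_bp_nb 8 hO', blk_org]; simpa using h.2

theorem hep_one : eG 3 * (eG 5 * (eG 7 * (eG 8 * (eG 9 * (eG 13 * eG 14))))) = 1 := by
  apply G_ext
  intro x
  simp only [mul_smul, one_smul]
  rcases X_cases x with ⟨i, rfl⟩ | hx
  · simp only [e_bp]
  · apply Subtype.ext
    have h := allN_spec chk_hep _ hx
    rw [Nat.beq_eq] at h
    apply code_ext
    · simp only [eG_val, blk_ea]
    · simp only [eG_val, blk_ea, off_ea]
      have h' : tr (blk x.1) 3 ^^^ (tr (blk x.1) 5 ^^^ (tr (blk x.1) 7 ^^^ (tr (blk x.1) 8 ^^^ (tr (blk x.1) 9 ^^^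
        (tr (blk x.1) 13 ^^^ tr (blk x.1) 14))))) = 0 := h
      have e : ∀ a b c d e f g o : Nat, a ^^^ (b ^^^ (c ^^^ (d ^^^ (e ^^^ (f ^^^ g))))) = 0 →
          ((((((o ^^^ g) ^^^ f) ^^^ e) ^^^ d) ^^^ c) ^^^ b) ^^^ a = o := by
        intro a b c d e f g o h
        have : ((((((o ^^^ g) ^^^ f) ^^^ e) ^^^ d) ^^^ c) ^^^ b) ^^^ a =
            o ^^^ (a ^^^ (b ^^^ (c ^^^ (d ^^^ (e ^^^ (f ^^^ g)))))) := by
          simp only [Nat.xor_assoc, Nat.xor_comm, Nat.xor_left_comm]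
        rw [this, h, Nat.xor_zero]
      exact e _ _ _ _ _ _ _ _ h'

theorem nonadj_ne (i : Fin 23) {y : X} (hy : blk y.1 < 276) : bp i ≠ y := bp_ne_nb i hy

theorem all_eq {Q : Type} [Group Q] (π : G →* Q) {x y : X} (hne : x ≠ y) (h : π (ct x) = π (ct y)) :
    ∀ a b : X, π (ct a) = π (ct b) := by
  have move : ∀ (g : G) (a b : X), π (ct (g • a)) = π (ct (g • b)) → π (ct a) = π (ct b) := by
    intro g a b hab
    rw [ct_smul, ct_smul] at hab
    simpa using hab
  have move' : ∀ (g : G) (a b : X), π (ct a) = π (ct b) → π (ct (g • a)) = π (ct (g • b)) := by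
    intro g a b hab
    rw [ct_smul, ct_smul]
    simp [hab]
  have hA : π (ct (bp 5)) = π (ct (bp 8)) → ∀ a b : X, Ad a b → π (ct a) = π (ct b) := by
    intro h0 a b hab
    obtain ⟨g, h1, h2⟩ := adj_trans hab
    exact move g a b (by rw [h1, h2, h0])
  have hN : π (ct (bp 0)) = π (ct bb) → ∀ a b : X, ¬ Ad a b → π (ct a) = π (ct b) := by
    intro h0 a b hab
    rcases eq_or_ne a b with rfl | hne
    · rfl
    obtain ⟨g, h1, h2⟩ := rank3 hne hab
    exact move g a b (by rw [h1, h2, h0])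
  have hboth : π (ct (bp 5)) = π (ct (bp 8)) ∧ π (ct (bp 0)) = π (ct bb) := by
    by_cases hab : Ad x y
    · obtain ⟨g, h1, h2⟩ := adj_trans hab
      have h3 := move' g x y h
      rw [h1, h2] at h3
      refine ⟨h3, ?_⟩
      rw [hA h3 (bp 0) (bp 3) ((Ad_bp_bp _ _).mpr (by decide)), hA h3 (bp 3) bb ((Ad_bb 3).mpr (by decide))]
    · obtain ⟨g, h1, h2⟩ := rank3 hne hab
      have h3 := move' g x y h
      rw [h1, h2] at h3
      obtain ⟨z, hz, k1, k2⟩ := common58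
      refine ⟨?_, h3⟩
      rw [hN h3 _ _ k1, hN h3 _ _ k2]
  intro a b
  by_cases hab : Ad a b
  · exact hA hboth.1 a b hab
  · exact hN hboth.2 a b hab

theorem hom_trivial {Q : Type} [Group Q] (π : G →* Q) {x y : X} (hne : x ≠ y) (h : π (ct x) = π (ct y)) :
    ∀ g : G, π g = 1 := by
  have hall := all_eq π hne h
  have h7 := congrArg π hep_one
  simp only [map_mul, map_one, ← ct_bp] at h7
  have e : ∀ a, π (ct a) = 1 := by
    intro a
    have h2 : π (ct a) * π (ct a) = 1 := by rw [← map_mul, ct_sq, map_one]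
    rw [hall (bp 3) a, hall (bp 5) a, hall (bp 7) a, hall (bp 8) a, hall (bp 9) a, hall (bp 13) a,
      hall (bp 14) a] at h7
    simpa [h2] using h7
  have : DD ≤ π.ker := by
    unfold DD
    rw [Subgroup.closure_le]
    rintro t ⟨a, ha⟩
    rw [tr_unique ha (ct_isTr a)]
    exact e a
  rw [DD_top] at this
  intro g
  exact this (Subgroup.mem_top g)

instance simple_G : IsSimpleGroup G where
  exists_pair_ne := by
    have h1 : 1 < Nat.card G := by rw [card_G]; norm_num
    haveI : Finite G := Nat.finite_of_card_ne_zero (by omega)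
    exact (Finite.one_lt_card_iff_nontrivial.mp h1).exists_pair_ne
  eq_bot_or_eq_top_of_normal := by
    intro K hK
    by_cases hb : K = ⊥
    · exact Or.inl hb
    right
    obtain ⟨k, hk1⟩ := Subgroup.ne_bot_iff_exists_ne_one.mp hb
    have hk := k.2
    have : ∃ x : X, k.1 • x ≠ x := by
      by_contra hx
      push Not at hx
      exact hk1 (Subtype.ext (G_ext fun x => by rw [hx x, OneMemClass.coe_one, one_smul]))
    obtain ⟨x, hx⟩ := this
    have h := hom_trivial (QuotientGroup.mk' K) hx (by
      rw [ct_smul]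
      have h1 : QuotientGroup.mk' K k.1 = 1 := (QuotientGroup.eq_one_iff k.1).mpr hk
      simp [map_mul, h1])
    rw [eq_top_iff]
    intro g _
    exact (QuotientGroup.eq_one_iff g).mp (h g)

/-! ### The centralizer -/

theorem ct_inj {x y : X} (h : ct x = ct y) : x = y := by
  by_contra hne
  have := hom_trivial (MonoidHom.id G) hne h (eG 0)
  have h2 : eG 0 • bb = bb := by
    have : eG 0 = 1 := this
    rw [this, one_smul]
  rw [isTr_e] at h2
  rcases h2 with h2 | h2
  · exact nAd_bb h2
  · exact bp_ne_nb 0 (x := bb) (by decide +kernel) h2.symm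

theorem centralizer_eq : Subgroup.centralizer ({eG 0} : Set G) = MulAction.stabilizer G (bp 0) := by
  ext g
  rw [Subgroup.mem_centralizer_singleton_iff, MulAction.mem_stabilizer_iff]
  constructor
  · intro h
    apply ct_inj
    rw [ct_smul, ct_bp]
    rw [h, mul_inv_cancel_right]
  · intro h
    have h1 := ct_smul g (bp 0)
    rw [h, ct_bp] at h1
    conv_rhs => rw [h1]
    simp

theorem card_X_all : Nat.card X = 31671 := by
  have h := chk_lev1
  rw [Bool.and_eq_true, Nat.beq_eq] at h
  rw [← h.2, ← card_CL]
  have : CL 0 0 = Set.univ := by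
    rw [Set.eq_univ_iff_forall]
    intro x
    rcases X_cases x with ⟨i, rfl⟩ | hx
    · exact Or.inr ⟨i, rfl, by simp⟩
    · exact Or.inl ⟨hx, sub_iff.mpr fun k hk => by simp at hk⟩
  rw [this]; exact (Nat.card_congr (Equiv.Set.univ X)).symm

theorem index_centralizer : (Subgroup.centralizer ({eG 0} : Set G)).index = 31671 := by
  rw [centralizer_eq, MulAction.index_stabilizer, ← card_X_all]
  have : MulAction.orbit G (bp 0) = Set.univ := by
    rw [Set.eq_univ_iff_forall]
    intro x
    obtain ⟨g, hg⟩ := trans (bp 0) x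
    exact ⟨g, hg⟩
  rw [this, Set.ncard_univ]

theorem order_e0 : orderOf (eG 0) = 2 := by
  rw [orderOf_eq_prime_iff]
  refine ⟨by rw [pow_two, e_sq], ?_⟩
  intro h
  have h2 : eG 0 • bb = bb := by rw [h, one_smul]
  rw [isTr_e] at h2
  rcases h2 with h2 | h2
  · exact nAd_bb h2
  · exact bp_ne_nb 0 (x := bb) (by decide +kernel) h2.symm

/-! ### Parameters of the graph -/

theorem nb_CL {F : Nat} (hF : F < 2 ^ 23) (z : X) :
    z ∈ CL F F ↔ ∀ i : Fin 23, F.testBit i = true → Ad (bp i) z := by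
  constructor
  · rintro (⟨h, hs⟩ | ⟨j, rfl, hj⟩) i hi
    · exact (Ad_bp_nb i h).mpr (sub_iff.mp hs i hi)
    · rw [Ad_bp_bp]
      rintro rfl
      rw [hi] at hj
      exact absurd hj (by simp)
  · intro h
    rcases X_cases z with ⟨j, rfl⟩ | hz
    · right
      refine ⟨j, rfl, ?_⟩
      by_contra hj
      exact Ad_irrefl _ (h j (by simpa using hj))
    · left
      exact ⟨hz, sub_fin hF fun i hi => (Ad_bp_nb i hz).mp (h i hi)⟩

/-- The number of common neighbours. -/
def cm (x y : X) : Nat := Nat.card {z : X // Ad x z ∧ Ad y z}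

theorem cm_smul (g : G) (x y : X) : cm (g • x) (g • y) = cm x y := by
  unfold cm
  refine (Nat.card_congr ((MulAction.toPerm g).subtypeEquiv fun z => ?_)).symm
  rw [MulAction.toPerm_apply, Ad_smul, Ad_smul]

theorem cm_self (x : X) : cm x x = 3510 := by
  obtain ⟨g, hg⟩ := trans x (bp 5)
  rw [← cm_smul g, hg]
  have hl := chk_lev2
  rw [Bool.and_eq_true, Nat.beq_eq] at hl
  rw [← hl.2, ← card_CL]
  refine Nat.card_congr (Equiv.subtypeEquivRight fun z => ?_)
  rw [nb_CL (by norm_num), and_self]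
  have h32 : ∀ i : Fin 23, (32 : Nat).testBit i = true ↔ i = 5 := by decide
  simp only [h32, forall_eq]

theorem cm_adj {x y : X} (h : Ad x y) : cm x y = 693 := by
  obtain ⟨g, h1, h2⟩ := adj_trans h
  rw [← cm_smul g, h1, h2]
  have hl := chk_lev3
  rw [Bool.and_eq_true, Nat.beq_eq] at hl
  rw [← hl.2, ← card_CL]
  refine Nat.card_congr (Equiv.subtypeEquivRight fun z => ?_)
  rw [nb_CL (by norm_num)]
  have h32 : ∀ i : Fin 23, (288 : Nat).testBit i = true ↔ i = 5 ∨ i = 8 := by decide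
  simp only [h32, or_imp, forall_and, forall_eq]

theorem adj_bp0 {O u : Nat} (hu : u < 2 ^ dim O) : adj 282624 (mk O u) = adj 282624 (mk O 0) := by
  have h0 : blk 282624 = 276 := by decide
  have hd : dim O ≤ 10 := by
    unfold dim
    cases Nat.ble 276 O <;> cases Nat.ble 23 O <;> simp
  have hu' : u < 1024 := lt_of_lt_of_le hu (by
    calc 2 ^ dim O ≤ 2 ^ 10 := Nat.pow_le_pow_right (by norm_num) hd
      _ = 1024 := by norm_num)
  have e1 := blk_mk (O := O) hu'
  have e2 := blk_mk (O := O) (u := 0) (by norm_num)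
  rcases lt_or_ge O 276 with h | h
  · rw [adj_bn h0.ge (by rw [e1]; exact h), adj_bn h0.ge (by rw [e2]; exact h), e1, e2]
  · rw [adj_bb h0.ge (by rw [e1]; exact h), adj_bb h0.ge (by rw [e2]; exact h), e1, e2]

theorem cm_non {x y : X} (hne : x ≠ y) (h : ¬ Ad x y) : cm x y = 351 := by
  obtain ⟨g, h1, h2⟩ := rank3 hne h
  rw [← cm_smul g, h1, h2]
  have hm := chk_mu
  rw [Nat.beq_eq] at hm
  rw [← hm, sumN_eq]
  have e : cm (bp 0) bb = Nat.card {x : X // (fun c => adj 282624 c && adj 23552 c) x.1 = true} := by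
    refine Nat.card_congr (Equiv.subtypeEquivRight fun z => ?_)
    rw [Bool.and_eq_true]; rfl
  rw [e, card_X (fun c => adj 282624 c && adj 23552 c)]
  refine Finset.sum_congr rfl fun O _ => ?_

  rw [sumN_eq]
  have e2 : ∀ u ∈ Finset.range (2 ^ dim O), (if (adj 282624 (mk O u) && adj 23552 (mk O u)) = true then 1 else 0) =
      cond (adj 282624 (mk O 0)) (cond (adj 23552 (mk O u)) 1 0) 0 := by
    intro u hu
    rw [adj_bp0 (Finset.mem_range.mp hu)]
    cases adj 282624 (mk O 0) <;> cases adj 23552 (mk O u) <;> rfl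
  rw [Finset.sum_congr rfl e2]
  cases adj 282624 (mk O 0)
  · exact Finset.sum_const_zero
  · rfl

/-! ### The lattice of rank 782 -/

instance : Fintype X := Fintype.ofFinite X

open Classical in
def aa (x y : X) : ℤ := if Ad x y then 1 else 0
open Classical in
def dl (x y : X) : ℤ := if x = y then 1 else 0

/-- Entries of the Gram matrix. -/
def bm (x y : X) : ℤ := 9 * aa x y + 81 * dl x y - 1

theorem aa_smul (g : G) (x y : X) : aa (g • x) (g • y) = aa x y := by
  classical
  unfold aa; exact if_congr (Ad_smul g x y) rfl rfl
theorem dl_smul (g : G) (x y : X) : dl (g • x) (g • y) = dl x y := by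
  unfold dl; simp only [smul_left_cancel_iff]
theorem bm_smul (g : G) (x y : X) : bm (g • x) (g • y) = bm x y := by
  unfold bm; rw [aa_smul, dl_smul]

theorem aa_symm (x y : X) : aa x y = aa y x := by
  classical
  unfold aa; exact if_congr (Ad_comm x y) rfl rfl

theorem sum_aa_aa (x y : X) : ∑ z, aa x z * aa z y = cm x y := by
  classical
  unfold cm
  rw [Nat.card_eq_fintype_card, Fintype.card_subtype, Finset.card_filter, Nat.cast_sum]
  refine Finset.sum_congr rfl fun z _ => ?_
  rw [aa_symm z y]
  unfold aa
  by_cases h1 : Ad x z <;> by_cases h2 : Ad y z <;> simp [h1, h2]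

theorem aa_sq (x y : X) : aa x y * aa x y = aa x y := by
  unfold aa; split <;> rfl

theorem sum_aa (x : X) : ∑ z, aa x z = 3510 := by
  have h := sum_aa_aa x x
  rw [cm_self] at h
  rw [← Nat.cast_ofNat (n := 3510), ← h]
  refine Finset.sum_congr rfl fun z _ => ?_
  rw [aa_symm z x, aa_sq]

theorem sum_aa' (y : X) : ∑ z, aa z y = 3510 := by
  rw [← sum_aa y]; exact Finset.sum_congr rfl fun z _ => aa_symm z y

theorem sum_dl (x : X) (f : X → ℤ) : ∑ z, dl x z * f z = f x := by
  classical
  unfold dl; simp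
theorem sum_dl' (x : X) (f : X → ℤ) : ∑ z, f z * dl z x = f x := by
  classical
  unfold dl; simp

theorem sum_dl1 (x : X) : ∑ z, dl z x = 1 := by
  have := sum_dl' x (fun _ => 1)
  simpa only [one_mul] using this

theorem cm_eq (x y : X) : (cm x y : ℤ) = 3159 * dl x y + 342 * aa x y + 351 := by
  unfold aa dl
  by_cases h : x = y
  · subst h; rw [cm_self]; simp [Ad_irrefl]
  · by_cases h2 : Ad x y
    · rw [cm_adj h2]; simp [h, h2]
    · rw [cm_non h h2]; simp [h, h2]

theorem card_X_int : ∑ _z : X, (1 : ℤ) = 31671 := by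
  rw [Finset.sum_const, Finset.card_univ, ← Nat.card_eq_fintype_card, card_X_all]; norm_num

theorem bm_sq (x y : X) : ∑ z, bm x z * bm z y = 3240 * bm x y := by
  have e : ∀ z, bm x z * bm z y = 81 * (aa x z * aa z y) + 729 * (aa x z * dl z y) - 9 * aa x z
      + 729 * (dl x z * aa z y) + 6561 * (dl x z * dl z y) - 81 * (dl x z * 1) - 9 * aa z y - 81 * (1 * dl z y) + 1 := by
    intro z; unfold bm; ring
  simp only [e, Finset.sum_add_distrib, Finset.sum_sub_distrib, ← Finset.mul_sum]
  rw [sum_aa_aa, sum_dl', sum_aa, sum_dl, sum_dl, sum_dl x (fun _ => 1), sum_aa', one_mul, sum_dl1, card_X_int,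
    cm_eq]
  unfold bm; ring

theorem bm_self (x : X) : bm x x = 80 := by
  unfold bm aa dl; simp [Ad_irrefl]

def BM : Matrix X X ℤ := Matrix.of bm
abbrev VV := X → ℤ
def BL : VV →ₗ[ℤ] VV := BM.mulVecLin

theorem BL_apply (f : VV) (x : X) : BL f x = ∑ y, bm x y * f y := rfl

theorem BL_sq (f : VV) : BL (BL f) = (3240 : ℤ) • BL f := by
  ext x
  rw [BL_apply, Pi.smul_apply, smul_eq_mul, BL_apply, Finset.mul_sum]
  simp only [BL_apply, Finset.mul_sum]
  rw [Finset.sum_comm]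
  refine Finset.sum_congr rfl fun y _ => ?_
  simp only [← mul_assoc, ← Finset.sum_mul]
  rw [bm_sq]

def LL : Submodule ℤ VV := LinearMap.range BL

theorem trace_BL : LinearMap.trace ℤ VV BL = 80 * 31671 := by
  classical
  have : BL = Matrix.toLin' BM := rfl
  rw [this, Matrix.trace_toLin'_eq]
  unfold Matrix.trace
  rw [← card_X_int, Finset.mul_sum]
  exact Finset.sum_congr rfl fun z _ => by
    rw [mul_one]; exact bm_self z

theorem finrank_LL : Module.finrank ℤ LL = 782 := by
  let f : VV →ₗ[ℤ] LL := BL.rangeRestrict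
  have h1 : LL.subtype ∘ₗ f = BL := rfl
  have h2 : f ∘ₗ LL.subtype = (3240 : ℤ) • LinearMap.id := by
    apply LinearMap.ext
    rintro ⟨_, v, rfl⟩
    exact Subtype.ext (BL_sq v)
  have h3 := LinearMap.trace_comp_comm' f LL.subtype
  rw [h1, h2, map_smul, LinearMap.trace_id, trace_BL, smul_eq_mul] at h3
  omega

/-- Permutation representation. -/
def prm (g : G) : VV →ₗ[ℤ] VV := LinearMap.funLeft ℤ ℤ (fun x : X => g⁻¹ • x)

theorem pr_apply (g : G) (f : VV) (x : X) : prm g f x = f (g⁻¹ • x) := rfl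

theorem pr_BL (g : G) (f : VV) : prm g (BL f) = BL (prm g f) := by
  ext x
  rw [pr_apply, BL_apply, BL_apply]
  refine Fintype.sum_equiv (MulAction.toPerm g) _ _ fun y => ?_
  rw [MulAction.toPerm_apply, pr_apply, inv_smul_smul, ← bm_smul g, smul_inv_smul]

theorem pr_LL (g : G) (f : VV) (hf : f ∈ LL) : prm g f ∈ LL := by
  obtain ⟨v, rfl⟩ := hf
  exact ⟨prm g v, (pr_BL g v).symm⟩

def prL : G →* Module.End ℤ LL where
  toFun g := (prm g).restrict (pr_LL g)
  map_one' := by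
    ext f x
    show f.1 ((1 : G)⁻¹ • x) = f.1 x
    rw [inv_one, one_smul]
  map_mul' g h := by
    ext f x
    show f.1 ((g * h)⁻¹ • x) = f.1 (h⁻¹ • g⁻¹ • x)
    rw [mul_inv_rev, mul_smul]

theorem prL_val (g : G) (f : LL) : (prL g f).1 = prm g f.1 := rfl

/-- A basis of the lattice. -/
def bas : Module.Basis (Fin 782) ℤ LL :=
  (Module.finBasis ℤ LL).reindex (finCongr finrank_LL)

/-- The representation over the field with 17 elements. -/
def rep : G →* Matrix.GeneralLinearGroup (Fin 782) (ZMod 17) :=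
  MonoidHom.toHomUnits (((Int.castRingHom (ZMod 17)).mapMatrix.toMonoidHom).comp
    ((LinearMap.toMatrixAlgEquiv bas).toAlgHom.toRingHom.toMonoidHom.comp prL))

theorem rep_val (g : G) : (rep g).1 = (LinearMap.toMatrixAlgEquiv bas (prL g)).map (Int.castRingHom (ZMod 17)) := rfl

theorem rep_one {g : G} (h : rep g = 1) (f : LL) : ∃ w : LL, prL g f = f + (17 : ℤ) • w := by
  have h0 : ∀ i j, ∃ c : ℤ, LinearMap.toMatrixAlgEquiv bas (prL g) i j = (1 : Matrix (Fin 782) (Fin 782) ℤ) i j + 17 * c := by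
    intro i j
    have h1 : (rep g).1 i j = (1 : Matrix (Fin 782) (Fin 782) (ZMod 17)) i j := by rw [h]; rfl
    rw [rep_val, Matrix.map_apply] at h1
    have h2 : (1 : Matrix (Fin 782) (Fin 782) (ZMod 17)) i j =
        (((1 : Matrix (Fin 782) (Fin 782) ℤ) i j : ℤ) : ZMod 17) := by
      rw [Matrix.one_apply, Matrix.one_apply]; split <;> simp
    rw [h2, eq_intCast, ← sub_eq_zero, ← Int.cast_sub, ZMod.intCast_zmod_eq_zero_iff_dvd] at h1
    obtain ⟨c, hc⟩ := h1
    exact ⟨c, by push_cast at hc; linarith⟩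
  choose c hc using h0
  have key : prL g = LinearMap.id + (17 : ℤ) • (LinearMap.toMatrixAlgEquiv bas).symm (Matrix.of c) := by
    apply (LinearMap.toMatrixAlgEquiv bas).injective
    rw [map_add, map_smul, AlgEquiv.apply_symm_apply]
    have : LinearMap.toMatrixAlgEquiv bas (LinearMap.id : LL →ₗ[ℤ] LL) = 1 := map_one _
    rw [this]
    ext i j
    rw [hc]; rfl
  exact ⟨(LinearMap.toMatrixAlgEquiv bas).symm (Matrix.of c) f, by rw [key]; rfl⟩

theorem rep_ker {g : G} (h : rep g = 1) : g = 1 := by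
  classical
  apply G_ext
  intro x
  rw [one_smul]
  obtain ⟨⟨w, hw⟩, h1⟩ := rep_one h ⟨BL (Pi.single x 1), ⟨_, rfl⟩⟩
  have h2 := congrArg (fun f : LL => f.1 (g • x)) h1
  simp only [prL_val, pr_apply, inv_smul_smul] at h2
  have h3 : ∀ y, BL (Pi.single x 1) y = bm y x := by
    intro y; rw [BL_apply]; simp [Pi.single_apply]
  have h4 : BL (Pi.single x 1) x = BL (Pi.single x 1) (g • x) + 17 * w (g • x) := h2
  rw [h3, h3, bm_self] at h4
  by_contra hne
  unfold bm aa dl at h4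
  rw [if_neg hne] at h4
  split at h4 <;> omega

theorem rep_inj : Function.Injective rep := (injective_iff_map_eq_one rep).mpr fun _ h => rep_ker h

theorem hsimp {A C : Type} [Group A] [Group C] [IsSimpleGroup A] (e : A ≃* C) : IsSimpleGroup C :=
  (MulEquiv.isSimpleGroup_congr e).mp inferInstance

end

end Fi23

open Fi23 in
/-- There exist a subgroup `𝔊` of `GL₇₈₂(𝔽₁₇)` and an element `𝔷 ∈ 𝔊` such that `𝔊` is a
simple group of order `2^18·3^13·5^2·7·11·13·17·23 = 4089470473293004800`, `𝔷` has order `2`,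
and the centralizer of `𝔷` in `𝔊` has order `2^18·3^9·5^2·7·11·13 = 129123503308800`,
equivalently index `31671` in `𝔊`. -/
theorem exists_Fi23_involution_centralizer :
    ∃ (𝔊 : Subgroup (Matrix.GeneralLinearGroup (Fin 782) (ZMod 17))) (𝔷 : ↥𝔊),
      IsSimpleGroup ↥𝔊 ∧
      Nat.card ↥𝔊 = 2 ^ 18 * 3 ^ 13 * 5 ^ 2 * 7 * 11 * 13 * 17 * 23 ∧
      orderOf 𝔷 = 2 ∧
      Nat.card ↥(Subgroup.centralizer ({𝔷} : Set ↥𝔊)) =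
        2 ^ 18 * 3 ^ 9 * 5 ^ 2 * 7 * 11 * 13 ∧
      (Subgroup.centralizer ({𝔷} : Set ↥𝔊)).index = 31671 := by
  obtain ⟨e⟩ : Nonempty (G ≃* rep.range) := ⟨MonoidHom.ofInjective rep_inj⟩
  have hc : Nat.card rep.range = 4089470473293004800 := by
    rw [← card_G]; exact (Nat.card_congr e.toEquiv).symm
  have hi : (Subgroup.centralizer ({e (eG 0)} : Set rep.range)).index = 31671 := by
    rw [← index_centralizer]
    have : Subgroup.centralizer ({eG 0} : Set G) =
        (Subgroup.centralizer ({e (eG 0)} : Set rep.range)).comap e.toMonoidHom := by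
      ext g
      rw [Subgroup.mem_comap, Subgroup.mem_centralizer_singleton_iff, Subgroup.mem_centralizer_singleton_iff]
      show _ ↔ e g * e (eG 0) = e (eG 0) * e g
      rw [← map_mul, ← map_mul, e.injective.eq_iff]
    rw [this]
    exact (Subgroup.index_comap_of_surjective _ e.surjective).symm
  refine ⟨rep.range, e (eG 0), ?_, ?_, ?_, ?_, hi⟩
  · have := simple_G
    exact hsimp e
  · rw [hc]; norm_num
  · rw [MulEquiv.orderOf_eq, order_e0]
  · have h := Subgroup.card_mul_index (Subgroup.centralizer ({e (eG 0)} : Set rep.range))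
    rw [hi, hc] at h
    norm_num
    omega
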